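/- arXiv:2405.16319 — 2 statements merged into one kernel-verified Lean document; each statement's English description precedes it below -/
import Mathlib

section
/- A pair (k, ℓ) of normalized diagonal holomorphic kernels on a domain Ω ⊆ ℂ^𝗀 with 0 ∈ Ω is a complete Pick pair (as kernels on Ω) if and only if it is a complete Carathéodory pair. -/
open Matrix
open scoped ComplexOrder

noncomputable section

/-- `k` is a positive (semi-definite) kernel on `X`: every Gram sum is a nonnegative real
(using the partial order on `ℂ`, so `0 ≤ w` means `w` is real and nonnegative). -/
def IsPosKernel {X : Type*} (k : X → X → ℂ) : Prop :=
  ∀ (n : ℕ) (z : Fin n → X) (c : Fin n → ℂ),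
    0 ≤ ∑ i, ∑ j, (starRingEnd ℂ) (c i) * c j * k (z i) (z j)

/-- Positive semidefiniteness of the block matrix `[ℓ(z i, z j)·I − k(z i, z j)·W i (W j)ᴴ]`. -/
def PickBlockPSD {X : Type*} (k ℓ : X → X → ℂ) {n N : ℕ}
    (z : Fin n → X) (W : Fin n → Matrix (Fin N) (Fin N) ℂ) : Prop :=
  ∀ u : Fin n → (Fin N → ℂ),
    0 ≤ ∑ i, ∑ j,
      star (u i) ⬝ᵥ ((ℓ (z i) (z j) • (1 : Matrix (Fin N) (Fin N) ℂ)
        - k (z i) (z j) • (W i * (W j)ᴴ)) *ᵥ u j)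

/-- `Φ` is a contractive multiplier from `k` to `ℓ`. -/
def IsContractiveMultiplier {X : Type*} (k ℓ : X → X → ℂ) {N : ℕ}
    (Φ : X → Matrix (Fin N) (Fin N) ℂ) : Prop :=
  ∀ (n : ℕ) (z : Fin n → X), PickBlockPSD k ℓ z fun i => Φ (z i)

/-- `(k, ℓ)` is a complete Pick pair. -/
def IsCompletePickPair {X : Type*} (k ℓ : X → X → ℂ) : Prop :=
  ∀ (n N : ℕ), 1 ≤ n → 1 ≤ N →
    ∀ (z : Fin n → X) (W : Fin n → Matrix (Fin N) (Fin N) ℂ),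
      PickBlockPSD k ℓ z W →
      ∃ Φ : X → Matrix (Fin N) (Fin N) ℂ,
        IsContractiveMultiplier k ℓ Φ ∧ ∀ i, Φ (z i) = W i
open scoped Classical

/-- The monomial `z^a = ∏ i, (z i)^(a i)` for a multi-index `a ∈ ℕ^𝗀`. -/
def mpow {g : ℕ} (z : Fin g → ℂ) (a : Fin g → ℕ) : ℂ := ∏ i, z i ^ a i

/-- The diagonal kernel `k(z,w) = Σ_a k_a · z^a · conj (w^a)` with coefficients `kc`. -/
def diagKer {g : ℕ} (kc : (Fin g → ℕ) → ℝ) (z w : Fin g → ℂ) : ℂ :=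
  ∑' a : Fin g → ℕ, (kc a : ℂ) * mpow z a * (starRingEnd ℂ) (mpow w a)

/-- `kc` is the coefficient family of a normalized diagonal holomorphic kernel on `Ω`:
`k_0 = 1`, `k_a > 0`, and `Σ_a k_a·|x^a|² < ∞` for every `x ∈ Ω`. -/
def IsNormalizedDiag {g : ℕ} (Ω : Set (Fin g → ℂ)) (kc : (Fin g → ℕ) → ℝ) : Prop :=
  kc 0 = 1 ∧ (∀ a, 0 < kc a) ∧
    ∀ x ∈ Ω, Summable fun a : Fin g → ℕ => kc a * ‖mpow x a‖ ^ 2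

/-- `F ⊆ ℕ^𝗀` is co-invariant: `b ∈ F` and `a ≤ b` imply `a ∈ F`. -/
def IsCoinvariant {g : ℕ} (F : Finset (Fin g → ℕ)) : Prop :=
  ∀ b ∈ F, ∀ a : Fin g → ℕ, a ≤ b → a ∈ F

/-- The Carathéodory block matrix `C(S)` associated with coefficient families `kc, ℓc`
and matrix coefficients `c`: the `(a,b)` block is `√(k_a/ℓ_b)·c_{b−a}` when `a ≤ b` and
`0` otherwise. -/
def caraMatrix {g : ℕ} (kc ℓc : (Fin g → ℕ) → ℝ) {J : ℕ}
    (c : (Fin g → ℕ) → Matrix (Fin J) (Fin J) ℂ) (S : Finset (Fin g → ℕ)) :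
    Matrix (S × Fin J) (S × Fin J) ℂ :=
  fun p q =>
    if (p.1 : Fin g → ℕ) ≤ (q.1 : Fin g → ℕ)
    then (Real.sqrt (kc p.1 / ℓc q.1) : ℂ) * c ((q.1 : Fin g → ℕ) - (p.1 : Fin g → ℕ)) p.2 q.2
    else 0

/-- A (complex) square matrix is a contraction when `I − CᴴC` is positive semidefinite. -/
def IsContractionMat {ι : Type*} [Fintype ι] [DecidableEq ι] (C : Matrix ι ι ℂ) : Prop :=
  ((1 : Matrix ι ι ℂ) - Cᴴ * C).PosSemidef

/-- `(kc, ℓc)` is a complete Carathéodory pair: every contractive Carathéodory data on a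
finite co-invariant set `F` extends to all of `ℕ^𝗀` with all finite sections contractive. -/
def IsCCPair {g : ℕ} (kc ℓc : (Fin g → ℕ) → ℝ) : Prop :=
  ∀ J : ℕ, 1 ≤ J → ∀ F : Finset (Fin g → ℕ), IsCoinvariant F →
    ∀ c₀ : (Fin g → ℕ) → Matrix (Fin J) (Fin J) ℂ,
      IsContractionMat (caraMatrix kc ℓc c₀ F) →
      ∃ c : (Fin g → ℕ) → Matrix (Fin J) (Fin J) ℂ,
        (∀ a ∈ F, c a = c₀ a) ∧
        ∀ S : Finset (Fin g → ℕ), IsContractionMat (caraMatrix kc ℓc c S)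

section Conv
variable {g : ℕ}

def conv (x y : (Fin g → ℕ) → ℝ) (d : Fin g → ℕ) : ℝ := ∑ a ∈ Finset.Iic d, x a * y (d - a)

def dl0 (d : Fin g → ℕ) : ℝ := if d = 0 then 1 else 0

lemma conv_comm (x y : (Fin g → ℕ) → ℝ) : conv x y = conv y x := by
  funext d
  unfold conv
  refine Finset.sum_bij' (fun a _ => d - a) (fun a _ => d - a) ?_ ?_ ?_ ?_ ?_
  · intro a _; simp
  · intro a _; simp
  · intro a ha; exact tsub_tsub_cancel_of_le (Finset.mem_Iic.1 ha)
  · intro a ha; exact tsub_tsub_cancel_of_le (Finset.mem_Iic.1 ha)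
  · intro a ha
    rw [tsub_tsub_cancel_of_le (Finset.mem_Iic.1 ha), mul_comm]

lemma conv_assoc (x y z : (Fin g → ℕ) → ℝ) : conv (conv x y) z = conv x (conv y z) := by
  funext d
  unfold conv
  simp only [Finset.sum_mul, Finset.mul_sum]
  rw [Finset.sum_sigma', Finset.sum_sigma']
  refine Finset.sum_bij' (fun p _ => ⟨p.2, p.1 - p.2⟩) (fun p _ => ⟨p.1 + p.2, p.1⟩) ?_ ?_ ?_ ?_ ?_
  · rintro ⟨c, a⟩ h
    simp only [Finset.mem_sigma, Finset.mem_Iic] at h ⊢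
    exact ⟨h.2.trans h.1, tsub_le_tsub_right h.1 _⟩
  · rintro ⟨a, b⟩ h
    simp only [Finset.mem_sigma, Finset.mem_Iic] at h ⊢
    refine ⟨?_, le_self_add⟩
    have := add_le_add_right h.2 a
    rwa [add_tsub_cancel_of_le h.1] at this
  · rintro ⟨c, a⟩ h
    simp only [Finset.mem_sigma, Finset.mem_Iic] at h ⊢
    rw [add_tsub_cancel_of_le h.2]
  · rintro ⟨a, b⟩ h
    simp
  · rintro ⟨c, a⟩ h
    simp only [Finset.mem_sigma, Finset.mem_Iic] at h ⊢
    rw [tsub_tsub_tsub_cancel_right h.2, mul_assoc]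

lemma conv_add (x y z : (Fin g → ℕ) → ℝ) : conv x (y + z) = conv x y + conv x z := by
  funext d; simp [conv, mul_add, Finset.sum_add_distrib]

lemma add_conv (x y z : (Fin g → ℕ) → ℝ) : conv (x + y) z = conv x z + conv y z := by
  funext d; simp [conv, add_mul, Finset.sum_add_distrib]

lemma conv_dl0 (x : (Fin g → ℕ) → ℝ) : conv x dl0 = x := by
  rw [conv_comm]
  funext d
  unfold conv dl0
  rw [Finset.sum_eq_single 0]
  · simp
  · intro b _ hb; simp [hb]
  · intro h; exact absurd (Finset.mem_Iic.2 zero_le) h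

lemma dl0_conv (x : (Fin g → ℕ) → ℝ) : conv dl0 x = x := by
  rw [conv_comm, conv_dl0]

lemma conv_nonneg {x y : (Fin g → ℕ) → ℝ} (hx : ∀ a, 0 ≤ x a) (hy : ∀ a, 0 ≤ y a) (d) :
    0 ≤ conv x y d := Finset.sum_nonneg fun _ _ => mul_nonneg (hx _) (hy _)

lemma conv_mono_left {x x' y : (Fin g → ℕ) → ℝ} {d : Fin g → ℕ} (h : ∀ a ≤ d, x a ≤ x' a)
    (hy : ∀ a, 0 ≤ y a) : conv x y d ≤ conv x' y d :=
  Finset.sum_le_sum fun a ha => mul_le_mul_of_nonneg_right (h a (Finset.mem_Iic.1 ha)) (hy _)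

lemma conv_zero_left {x y : (Fin g → ℕ) → ℝ} : conv x y 0 = x 0 * y 0 := by
  unfold conv
  rw [Finset.sum_eq_single 0]
  · simp
  · intro b hb h; exact absurd (le_antisymm (Finset.mem_Iic.1 hb) zero_le) h
  · intro h; exact absurd (Finset.mem_Iic.2 zero_le) h

/-- single term bound -/
lemma le_conv {x y : (Fin g → ℕ) → ℝ} (hx : ∀ a, 0 ≤ x a) (hy : ∀ a, 0 ≤ y a) (d)
    (a : Fin g → ℕ) (ha : a ≤ d) : x a * y (d - a) ≤ conv x y d :=
  Finset.single_le_sum (f := fun a => x a * y (d - a))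
    (fun _ _ => mul_nonneg (hx _) (hy _)) (Finset.mem_Iic.2 ha)

def convEquiv : (Σ d : Fin g → ℕ, {a : Fin g → ℕ // a ∈ Finset.Iic d}) ≃
    (Fin g → ℕ) × (Fin g → ℕ) where
  toFun p := (p.2.1, p.1 - p.2.1)
  invFun q := ⟨q.1 + q.2, ⟨q.1, by simp⟩⟩
  left_inv := by
    rintro ⟨d, a, ha⟩
    have h : a + (d - a) = d := add_tsub_cancel_of_le (Finset.mem_Iic.1 ha)
    simp only
    congr 1
    rw! [h]
    rfl
  right_inv := by
    rintro ⟨a, b⟩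
    simp

lemma conv_summable {x y ω : (Fin g → ℕ) → ℝ} (hx : ∀ a, 0 ≤ x a) (hy : ∀ a, 0 ≤ y a)
    (hω : ∀ a, 0 ≤ ω a) (hs : Summable fun d => conv x y d * ω d) :
    Summable (fun q : (Fin g → ℕ) × (Fin g → ℕ) => x q.1 * y q.2 * ω (q.1 + q.2)) ∧
    ∑' q : (Fin g → ℕ) × (Fin g → ℕ), x q.1 * y q.2 * ω (q.1 + q.2)
      = ∑' d, conv x y d * ω d := by
  set G : (Fin g → ℕ) × (Fin g → ℕ) → ℝ := fun q => x q.1 * y q.2 * ω (q.1 + q.2) with hG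
  have hterm : ∀ d : Fin g → ℕ, ∑' a : {a : Fin g → ℕ // a ∈ Finset.Iic d},
      (G ∘ convEquiv) ⟨d, a⟩ = conv x y d * ω d := by
    intro d
    rw [tsum_fintype]
    unfold conv
    rw [Finset.sum_mul, ← Finset.sum_coe_sort (Finset.Iic d)]
    refine Finset.sum_congr rfl fun a _ => ?_
    simp only [hG, convEquiv, Function.comp, Equiv.coe_fn_mk]
    rw [add_tsub_cancel_of_le (Finset.mem_Iic.1 a.2)]
  have h1 : Summable (G ∘ convEquiv) := by
    rw [summable_sigma_of_nonneg]
    · refine ⟨fun d => (hasSum_fintype _).summable, ?_⟩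
      simpa only [hterm] using hs
    · intro q; exact mul_nonneg (mul_nonneg (hx _) (hy _)) (hω _)
  have h2 : Summable G := convEquiv.summable_iff.1 h1
  refine ⟨h2, ?_⟩
  rw [← convEquiv.tsum_eq G]
  have := h1.tsum_sigma' (fun d => (hasSum_fintype _).summable)
  simp only [hterm] at this
  exact this

lemma conv_tsum {x y ω : (Fin g → ℕ) → ℝ} (hx : ∀ a, 0 ≤ x a) (hy : ∀ a, 0 ≤ y a)
    (hω : ∀ a, 0 ≤ ω a) (hs : Summable fun d => conv x y d * ω d) :
    Summable (fun a => x a * ∑' b, y b * ω (a + b)) ∧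
    ∑' a, x a * ∑' b, y b * ω (a + b) = ∑' d, conv x y d * ω d := by
  obtain ⟨h1, h2⟩ := conv_summable hx hy hω hs
  have e : ∀ a, x a * ∑' b, y b * ω (a + b) = ∑' b, x a * y b * ω (a + b) := by
    intro a; rw [← tsum_mul_left]; simp only [mul_assoc]
  constructor
  · simp only [e]
    exact h1.prod
  · simp only [e]
    rw [← h2, h1.tsum_prod]

end Conv

section Greedy
variable {g : ℕ}

lemma exists_rec (k : (Fin g → ℕ) → ℝ) (Ψ : (Fin g → ℕ) → ℝ → ℝ) :
    ∃ f : (Fin g → ℕ) → ℝ, ∀ e, f e = Ψ e (∑ a ∈ Finset.Iio e, f a * k (e - a)) := by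
  let wf : WellFounded ((· < ·) : (Fin g → ℕ) → (Fin g → ℕ) → Prop) := wellFounded_lt
  refine ⟨wf.fix fun e ih => Ψ e (∑ a ∈ (Finset.Iio e).attach,
    ih a.1 (Finset.mem_Iio.1 a.2) * k (e - a.1)), fun e => ?_⟩
  conv_lhs => rw [wf.fix_eq]
  congr 1
  exact Finset.sum_attach (Finset.Iio e)
    (fun a => (wf.fix fun e ih => Ψ e (∑ a ∈ (Finset.Iio e).attach,
    ih a.1 (Finset.mem_Iio.1 a.2) * k (e - a.1))) a * k (e - a))

lemma conv_eq_Iio (f k : (Fin g → ℕ) → ℝ) (e) :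
    conv f k e = (∑ a ∈ Finset.Iio e, f a * k (e - a)) + f e * k 0 := by
  unfold conv
  rw [← Finset.Iio_insert, Finset.sum_insert (by simp)]
  rw [tsub_self, add_comm]

/-- the structural condition -/
def StarCond (k ℓ : (Fin g → ℕ) → ℝ) : Prop :=
  ∃ s : (Fin g → ℕ) → ℝ, s 0 = 0 ∧ (∀ a, 0 ≤ s a) ∧ (∀ d, d ≠ 0 → k d ≤ conv s k d) ∧
    ∀ d, d ≠ 0 → conv s ℓ d ≤ ℓ d

lemma star_of_hyp (k ℓ : (Fin g → ℕ) → ℝ) (hk0 : k 0 = 1) (hk : ∀ a, 0 < k a)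
    (hℓ0 : ℓ 0 = 1) (hℓ : ∀ a, 0 < ℓ a) (N : (Fin g → ℕ) → ℕ)
    (hN : ∀ e b, e < b → N e < N b)
    (hyp : ∀ b, b ≠ 0 → ∀ f : (Fin g → ℕ) → ℝ, (∀ a, 0 ≤ f a) → (∀ e, ¬ e < b → f e = 0) →
      (∀ e, N e < N b → conv f k e ≤ ℓ e) → conv f k b ≤ ℓ b) : StarCond k ℓ := by
  obtain ⟨s, hs⟩ := exists_rec k (fun d r => if d = 0 then 0 else max 0 (k d - r))
  have s0 : s 0 = 0 := by rw [hs]; simp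
  have snn : ∀ a, 0 ≤ s a := by
    intro a; rw [hs]; split_ifs <;> simp
  have sk : ∀ d, d ≠ 0 → k d ≤ conv s k d := by
    intro d hd
    rw [conv_eq_Iio, hk0, mul_one]
    have := hs d
    rw [if_neg hd] at this
    have h2 := le_max_right 0 (k d - ∑ a ∈ Finset.Iio d, s a * k (d - a))
    linarith
  have sk' : ∀ d, d ≠ 0 → 0 < s d → k d = conv s k d := by
    intro d hd hpos
    rw [conv_eq_Iio, hk0, mul_one]
    have := hs d
    rw [if_neg hd] at this
    rcases max_choice 0 (k d - ∑ a ∈ Finset.Iio d, s a * k (d - a)) with h | h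
    · rw [h] at this; linarith
    · rw [h] at this; linarith
  have sk0 : conv s k 0 = 0 := by rw [conv_zero_left, s0, zero_mul]
  refine ⟨s, s0, snn, sk, ?_⟩
  have main : ∀ n : ℕ, ∀ b, b ≠ 0 → N b = n → conv s ℓ b ≤ ℓ b := by
    intro n
    induction n using Nat.strong_induction_on with
    | _ n IH =>
    intro b hb hbn
    have IH' : ∀ e, e ≠ 0 → N e < N b → conv s ℓ e ≤ ℓ e := by
      intro e he hlt
      exact IH (N e) (hbn ▸ hlt) e he rfl
    obtain ⟨f, hf⟩ := exists_rec k (fun e r => if e < b ∧ 0 < s (b - e) then ℓ e - r else 0)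
    have key : ∀ e, N e < N b → 0 ≤ f e ∧ conv f k e ≤ ℓ e := by
      intro e
      induction e using WellFoundedLT.induction with
      | _ e ihe =>
      intro hNe
      have hr : ∑ a ∈ Finset.Iio e, f a * k (e - a) ≤ ℓ e := by
        by_cases he : e = 0
        · subst he
          have : Finset.Iio (0 : Fin g → ℕ) = ∅ := by
            ext x; simp
          rw [this, Finset.sum_empty]; exact (hℓ 0).le
        · have h1 : ∑ a ∈ Finset.Iio e, f a * k (e - a) ≤ conv f (conv s k) e := by
            rw [conv_eq_Iio, sk0, mul_zero, add_zero]
            refine Finset.sum_le_sum fun a ha => ?_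
            have ha' := Finset.mem_Iio.1 ha
            have := (ihe a ha' ((hN _ _ ha').trans hNe)).1
            refine mul_le_mul_of_nonneg_left (sk _ ?_) this
            intro h0
            exact absurd (tsub_eq_zero_iff_le.1 h0) ha'.not_ge
          have h2 : conv f (conv s k) e = conv s (conv f k) e := by
            rw [← conv_assoc, conv_comm f s, conv_assoc]
          have h3 : conv s (conv f k) e ≤ conv s ℓ e := by
            refine Finset.sum_le_sum fun a ha => ?_
            by_cases ha0 : a = 0
            · subst ha0; simp [s0]
            · have hlt : e - a < e := by
                refine lt_of_le_of_ne tsub_le_self ?_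
                intro h
                have h' := tsub_add_cancel_of_le (Finset.mem_Iic.1 ha)
                rw [h] at h'
                exact ha0 (by simpa using h')
              exact mul_le_mul_of_nonneg_left (ihe _ hlt ((hN _ _ hlt).trans hNe)).2 (snn a)
          rw [h2] at h1
          exact (h1.trans h3).trans (IH' e he hNe)
      have hfe := hf e
      rw [conv_eq_Iio, hk0, mul_one]
      split_ifs at hfe with hc
      · constructor <;> linarith
      · constructor <;> linarith
    have fnn : ∀ a, 0 ≤ f a := by
      intro a
      by_cases h : a < b
      · exact (key a (hN _ _ h)).1
      · rw [hf, if_neg (fun h' => h h'.1)]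
    have fz : ∀ e, ¬ e < b → f e = 0 := by
      intro e h
      rw [hf, if_neg (fun h' => h h'.1)]
    have hb1 := hyp b hb f fnn fz (fun e he => (key e he).2)
    have e1 : conv f k b = conv f (conv s k) b := by
      refine Finset.sum_congr rfl fun a ha => ?_
      by_cases hc : a < b ∧ 0 < s (b - a)
      · rw [← sk' (b - a) _ hc.2]
        intro h0
        exact absurd (tsub_eq_zero_iff_le.1 h0) hc.1.not_ge
      · rw [hf, if_neg hc]; simp
    have e2 : conv f (conv s k) b = conv s (conv f k) b := by
      rw [← conv_assoc, conv_comm f s, conv_assoc]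
    have e3 : conv s (conv f k) b = conv s ℓ b := by
      refine Finset.sum_congr rfl fun a ha => ?_
      rcases (snn a).eq_or_lt with h | h
      · rw [← h]; simp
      · congr 1
        have ha0 : a ≠ 0 := by rintro rfl; rw [s0] at h; exact lt_irrefl _ h
        have hba : b - (b - a) = a := tsub_tsub_cancel_of_le (Finset.mem_Iic.1 ha)
        have hlt : b - a < b := by
          refine lt_of_le_of_ne tsub_le_self ?_
          intro h
          rw [h, tsub_self] at hba; exact ha0 hba.symm
        rw [conv_eq_Iio, hk0, mul_one]
        have := hf (b - a)
        rw [if_pos ⟨hlt, by rwa [hba]⟩] at this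
        linarith
    rw [e1, e2, e3] at hb1
    exact hb1
  exact fun d hd => main _ d hd rfl

structure Coef (k ℓ s m p T : (Fin g → ℕ) → ℝ) : Prop where
  s0 : s 0 = 0
  snn : ∀ a, 0 ≤ s a
  mnn : ∀ a, 0 ≤ m a
  pnn : ∀ a, 0 ≤ p a
  Tnn : ∀ a, 0 ≤ T a
  knn : ∀ a, 0 ≤ k a
  k0 : k 0 = 1
  ℓ0 : ℓ 0 = 1
  ℓnn : ∀ a, 0 ≤ ℓ a
  hm : m + conv s ℓ = ℓ
  hp : k + p = dl0 + conv s k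
  hT : T = dl0 + conv T s
  hTm : conv T m = ℓ
  hTp : k + conv T p = T
  hTℓ : ∀ a, T a ≤ ℓ a
  hsℓ : ∀ a, s a ≤ ℓ a
  hmℓ : ∀ a, m a ≤ ℓ a
  hpℓ : ∀ a, p a ≤ ℓ a
  hkℓ : ∀ a, k a ≤ ℓ a

lemma star_coef {k ℓ : (Fin g → ℕ) → ℝ} (hk0 : k 0 = 1) (hk : ∀ a, 0 < k a)
    (hℓ0 : ℓ 0 = 1) (hℓ : ∀ a, 0 < ℓ a) (h : StarCond k ℓ) : ∃ s m p T, Coef k ℓ s m p T := by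
  obtain ⟨s, s0, snn, hsk, hsl⟩ := h
  obtain ⟨T, hT⟩ := exists_rec s (fun d r => dl0 d + r)
  have sℓ0 : conv s ℓ 0 = 0 := by rw [conv_zero_left, s0, zero_mul]
  have sk0 : conv s k 0 = 0 := by rw [conv_zero_left, s0, zero_mul]
  have hT' : T = dl0 + conv T s := by
    funext d
    rw [Pi.add_apply, conv_eq_Iio, s0, mul_zero, add_zero]; exact hT d
  have dnn : ∀ d : Fin g → ℕ, 0 ≤ dl0 d := by intro d; unfold dl0; split_ifs <;> simp
  have Tnn : ∀ a, 0 ≤ T a := by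
    intro e
    induction e using WellFoundedLT.induction with
    | _ e ih =>
    rw [hT]
    exact add_nonneg (dnn _)
      (Finset.sum_nonneg fun a ha => mul_nonneg (ih a (Finset.mem_Iio.1 ha)) (snn _))
  have T0 : T 0 = 1 := by
    have := congrFun hT' 0
    rw [Pi.add_apply, conv_zero_left, s0] at this
    simpa [dl0] using this
  have hTℓ : ∀ a, T a ≤ ℓ a := by
    intro e
    induction e using WellFoundedLT.induction with
    | _ e ih =>
    by_cases he : e = 0
    · subst he; rw [T0, hℓ0]
    · have h1 : T e ≤ conv ℓ s e := by
        rw [hT, conv_eq_Iio, s0, mul_zero, add_zero]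
        have : dl0 e = 0 := by simp [dl0, he]
        rw [this, zero_add]
        exact Finset.sum_le_sum fun a ha =>
          mul_le_mul_of_nonneg_right (ih a (Finset.mem_Iio.1 ha)) (snn _)
      rw [conv_comm] at h1
      exact h1.trans (hsl e he)
  have hm : (ℓ - conv s ℓ) + conv s ℓ = ℓ := by simp
  have hp : k + (dl0 + conv s k - k) = dl0 + conv s k := by simp
  have pnn : ∀ a, 0 ≤ (dl0 + conv s k - k : (Fin g → ℕ) → ℝ) a := by
    intro a
    simp only [Pi.sub_apply, Pi.add_apply]
    by_cases ha : a = 0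
    · subst ha; rw [sk0, hk0]; simp [dl0]
    · have := hsk a ha; have := dnn a; linarith
  have hTm : conv T (ℓ - conv s ℓ) = ℓ := by
    have h1 := congrArg (conv T) hm
    rw [conv_add, ← conv_assoc] at h1
    have h2 : conv T ℓ = ℓ + conv (conv T s) ℓ := by
      conv_lhs => rw [hT', add_conv, dl0_conv]
    rw [h2] at h1
    exact add_right_cancel h1
  have hTp : k + conv T (dl0 + conv s k - k) = T := by
    have h1 := congrArg (conv T) hp
    rw [conv_add, conv_add, ← conv_assoc, conv_dl0] at h1
    have h2 : conv T k = k + conv (conv T s) k := by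
      conv_lhs => rw [hT', add_conv, dl0_conv]
    rw [h2, add_right_comm] at h1
    exact add_right_cancel h1
  have hkT : ∀ a, k a ≤ T a := by
    intro a
    have := congrFun hTp a
    rw [Pi.add_apply] at this
    have := conv_nonneg Tnn pnn a
    linarith
  have hpT : ∀ a, (dl0 + conv s k - k : (Fin g → ℕ) → ℝ) a ≤ T a := by
    intro a
    have h1 := congrFun hTp a
    rw [Pi.add_apply] at h1
    have h2 := le_conv Tnn pnn a 0 zero_le
    rw [T0, one_mul, tsub_zero] at h2
    have := (hk a).le
    linarith
  refine ⟨s, _, _, T, s0, snn, ?_, pnn, Tnn, fun a => (hk a).le, hk0, hℓ0, fun a => (hℓ a).le, hm, hp, hT', hTm, hTp, hTℓ,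
    ?_, ?_, fun a => (hpT a).trans (hTℓ a), fun a => (hkT a).trans (hTℓ a)⟩
  · intro a
    by_cases ha : a = 0
    · subst ha; simp [sℓ0, hℓ0]
    · have := hsl a ha; simp only [Pi.sub_apply]; linarith
  · intro a
    by_cases ha : a = 0
    · subst ha; simp [s0, hℓ0]
    · have h1 := le_conv snn (fun a => (hℓ a).le) a a le_rfl
      rw [tsub_self, hℓ0, mul_one] at h1
      exact h1.trans (hsl a ha)
  · intro a
    have := conv_nonneg snn (fun a => (hℓ a).le) a
    simp only [Pi.sub_apply]; linarith

end Greedy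

section RealStep
variable {g : ℕ} {k ℓ s m p T : (Fin g → ℕ) → ℝ}

lemma summable_dom {ℓ x E : (Fin g → ℕ) → ℝ} (hx : ∀ a, 0 ≤ x a) (hxl : ∀ a, x a ≤ ℓ a)
    (hE : ∀ a, 0 ≤ E a) (h : Summable fun a => ℓ a * E a) : Summable fun a => x a * E a :=
  Summable.of_nonneg_of_le (fun a => mul_nonneg (hx a) (hE a))
    (fun a => mul_le_mul_of_nonneg_right (hxl a) (hE a)) h

lemma tsum_dl0 (E : (Fin g → ℕ) → ℝ) : Summable (fun a => dl0 a * E a) ∧ ∑' a, dl0 a * E a = E 0 := by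
  have h : ∀ a, a ≠ 0 → dl0 a * E a = 0 := by intro a ha; simp [dl0, ha]
  refine ⟨summable_of_ne_finset_zero (s := {0}) (fun b hb => h b (by simpa using hb)), ?_⟩
  rw [tsum_eq_single 0 h]; simp [dl0]

lemma tsum_sum2 {x y z E : (Fin g → ℕ) → ℝ} (h : x + y = z) (hx : Summable fun a => x a * E a)
    (hy : Summable fun a => y a * E a) :
    ∑' a, x a * E a + ∑' a, y a * E a = ∑' a, z a * E a := by
  rw [← hx.tsum_add hy, ← h]
  simp [add_mul]

lemma Coef.sl (hC : Coef k ℓ s m p T) (a) : conv s ℓ a ≤ ℓ a := by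
  have := congrFun hC.hm a; have := hC.mnn a; simp only [Pi.add_apply] at *; linarith

lemma Coef.sk (hC : Coef k ℓ s m p T) (a) : conv s k a ≤ ℓ a := by
  refine le_trans ?_ (hC.sl a)
  rw [conv_comm s k, conv_comm s ℓ]
  exact conv_mono_left (fun a _ => hC.hkℓ a) hC.snn

lemma Coef.Ts (hC : Coef k ℓ s m p T) (a) : conv T s a ≤ ℓ a := by
  have h1 := congrFun hC.hT a; have h2 := hC.hTℓ a; simp only [Pi.add_apply] at *
  have : 0 ≤ dl0 a := by unfold dl0; split_ifs <;> simp
  linarith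

lemma Coef.Tp (hC : Coef k ℓ s m p T) (a) : conv T p a ≤ ℓ a := by
  have h1 := congrFun hC.hTp a; have h2 := hC.hTℓ a; have := hC.knn a
  simp only [Pi.add_apply] at *
  linarith

lemma ker_eq (hC : Coef k ℓ s m p T) {E Φ D : (Fin g → ℕ) → ℝ} (hE : ∀ a, 0 ≤ E a)
    (hΦ : ∀ a, 0 ≤ Φ a)
    (sE : Summable fun a => ℓ a * E a) (sΦ : Summable fun a => ℓ a * Φ a)
    (h : ∀ a, D a = ∑' b, ℓ b * E (a + b) - ∑' b, k b * Φ (a + b)) :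
    D 0 + Φ 0 = ∑' a, m a * E a + ∑' a, s a * D a + ∑' a, p a * Φ a := by
  have c1 := conv_tsum hC.snn hC.ℓnn hE
    (summable_dom (conv_nonneg hC.snn hC.ℓnn) hC.sl hE sE)
  have c2 := conv_tsum hC.snn hC.knn hΦ
    (summable_dom (conv_nonneg hC.snn hC.knn) hC.sk hΦ sΦ)
  have h1 : ∑' a, s a * D a = ∑' d, conv s ℓ d * E d - ∑' d, conv s k d * Φ d := by
    rw [← c1.2, ← c2.2, ← c1.1.tsum_sub c2.1]
    exact tsum_congr fun a => by rw [h a]; ring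
  have h2 := tsum_sum2 hC.hm (summable_dom hC.mnn hC.hmℓ hE sE)
    (summable_dom (conv_nonneg hC.snn hC.ℓnn) hC.sl hE sE)
  have h3 := tsum_sum2 hC.hp (summable_dom hC.knn hC.hkℓ hΦ sΦ) (summable_dom hC.pnn hC.hpℓ hΦ sΦ)
  have h4 := tsum_sum2 (E := Φ) (rfl : dl0 + conv s k = _) (tsum_dl0 Φ).1
    (summable_dom (conv_nonneg hC.snn hC.knn) hC.sk hΦ sΦ)
  rw [(tsum_dl0 Φ).2] at h4
  have h0 := h 0
  simp only [zero_add] at h0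
  linarith

lemma final_ineq (hC : Coef k ℓ s m p T) {E Φ D : (Fin g → ℕ) → ℝ} (hE : ∀ a, 0 ≤ E a)
    (hΦ : ∀ a, 0 ≤ Φ a) (hD : ∀ a, 0 ≤ D a)
    (sE : Summable fun a => ℓ a * E a) (sΦ : Summable fun a => ℓ a * Φ a)
    (sD : Summable fun a => ℓ a * D a)
    (h : ∀ c, D c + Φ c ≤ ∑' b, m b * E (c + b) + ∑' b, s b * D (c + b) + ∑' b, p b * Φ (c + b)) :
    ∑' a, k a * Φ a ≤ ∑' a, ℓ a * E a := by
  have c1 := conv_tsum hC.Tnn hC.mnn hE (by rw [hC.hTm]; exact sE)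
  have c2 := conv_tsum hC.Tnn hC.snn hD (summable_dom (conv_nonneg hC.Tnn hC.snn) hC.Ts hD sD)
  have c3 := conv_tsum hC.Tnn hC.pnn hΦ (summable_dom (conv_nonneg hC.Tnn hC.pnn) hC.Tp hΦ sΦ)
  rw [hC.hTm] at c1
  have t1 := summable_dom hC.Tnn hC.hTℓ hD sD
  have t2 := summable_dom hC.Tnn hC.hTℓ hΦ sΦ
  have key : ∑' c, (T c * D c + T c * Φ c) ≤ ∑' c, (T c * ∑' b, m b * E (c + b) +
      T c * ∑' b, s b * D (c + b) + T c * ∑' b, p b * Φ (c + b)) := by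
    refine Summable.tsum_le_tsum (fun c => ?_) (t1.add t2) ((c1.1.add c2.1).add c3.1)
    have := mul_le_mul_of_nonneg_left (h c) (hC.Tnn c)
    linarith
  rw [t1.tsum_add t2, (c1.1.add c2.1).tsum_add c3.1, c1.1.tsum_add c2.1, c1.2, c2.2, c3.2] at key
  have h3 := tsum_sum2 hC.hTp (summable_dom hC.knn hC.hkℓ hΦ sΦ)
    (summable_dom (conv_nonneg hC.Tnn hC.pnn) hC.Tp hΦ sΦ)
  have h4 := tsum_sum2 (E := D) hC.hT.symm (tsum_dl0 D).1
    (summable_dom (conv_nonneg hC.Tnn hC.snn) hC.Ts hD sD)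
  rw [(tsum_dl0 D).2] at h4
  have := hD 0
  linarith

lemma contr_consts (hC : Coef k ℓ s m p T) {ω : (Fin g → ℕ) → ℝ} (hω : ∀ a, 0 ≤ ω a)
    (h0 : ω 0 = 1) (hmul : ∀ a b, ω (a + b) = ω a * ω b) (sω : Summable fun a => ℓ a * ω a) :
    ∑' a, s a * ω a < 1 ∧ ∑' a, p a * ω a < 1 := by
  have sl := summable_dom (conv_nonneg hC.snn hC.ℓnn) hC.sl hω sω
  have skk := summable_dom (conv_nonneg hC.snn hC.knn) hC.sk hω sω
  have c1 := (conv_tsum hC.snn hC.ℓnn hω sl).2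
  have c2 := (conv_tsum hC.snn hC.knn hω skk).2
  have r : ∀ y : (Fin g → ℕ) → ℝ, ∑' a, s a * ∑' b, y b * ω (a + b)
      = (∑' a, s a * ω a) * ∑' b, y b * ω b := by
    intro y
    have e2 : ∀ a, ∑' b, y b * ω (a + b) = ω a * ∑' b, y b * ω b := by
      intro a
      rw [← (tsum_mul_left : ∑' b, ω a * (y b * ω b) = _)]
      refine tsum_congr fun b => ?_
      rw [hmul]; ring
    simp only [e2, ← mul_assoc]
    exact tsum_mul_right
  rw [r] at c1 c2
  have sm := summable_dom hC.mnn hC.hmℓ hω sω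
  have sk := summable_dom hC.knn hC.hkℓ hω sω
  have sp := summable_dom hC.pnn hC.hpℓ hω sω
  have h2 := tsum_sum2 hC.hm sm sl
  have h3 := tsum_sum2 hC.hp sk sp
  have h4 := tsum_sum2 (E := ω) (rfl : dl0 + conv s k = _) (tsum_dl0 ω).1 skk
  rw [(tsum_dl0 ω).2, h0] at h4
  have m0 : m 0 = 1 := by
    have := congrFun hC.hm 0
    rw [Pi.add_apply, conv_zero_left, hC.s0, hC.ℓ0] at this
    linarith
  have gm := sm.le_tsum 0 (fun a _ => mul_nonneg (hC.mnn a) (hω a))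
  have gk := sk.le_tsum 0 (fun a _ => mul_nonneg (hC.knn a) (hω a))
  have gl := sω.le_tsum 0 (fun a _ => mul_nonneg (hC.ℓnn a) (hω a))
  rw [h0, m0] at gm
  rw [h0, hC.k0] at gk
  rw [h0, hC.ℓ0] at gl
  have hA : ∑' a, s a * ω a < 1 := by
    by_contra hcon
    push Not at hcon
    have : 1 * ∑' b, ℓ b * ω b ≤ (∑' a, s a * ω a) * ∑' b, ℓ b * ω b :=
      mul_le_mul_of_nonneg_right hcon (by linarith)
    linarith
  refine ⟨hA, ?_⟩
  nlinarith
end RealStep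

section Hilb
open scoped InnerProductSpace

lemma gram_factor0 {K H₁ H₂ : Type*} [AddCommGroup K] [Module ℂ K] [FiniteDimensional ℂ K]
    [NormedAddCommGroup H₁] [InnerProductSpace ℂ H₁] [NormedAddCommGroup H₂]
    [InnerProductSpace ℂ H₂] (E : K →ₗ[ℂ] H₁) (F : K →ₗ[ℂ] H₂) (h : ∀ u, ‖F u‖ ^ 2 ≤ ‖E u‖ ^ 2) :
    ∃ δ : K →ₗ[ℂ] EuclideanSpace ℂ (Fin (Module.finrank ℂ K)),
      ∀ u, ‖δ u‖ ^ 2 + ‖F u‖ ^ 2 = ‖E u‖ ^ 2 := by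
  set n := Module.finrank ℂ K
  let b : Module.Basis (Fin n) ℂ K := Module.finBasis ℂ K
  let M : Matrix (Fin n) (Fin n) ℂ := fun i j => ⟪E (b i), E (b j)⟫_ℂ - ⟪F (b i), F (b j)⟫_ℂ
  have hM : ∀ u, star (⇑(b.repr u)) ⬝ᵥ (M *ᵥ ⇑(b.repr u)) = ((‖E u‖ ^ 2 - ‖F u‖ ^ 2 : ℝ) : ℂ) := by
    intro u
    have hE : E u = ∑ i, b.repr u i • E (b i) := by
      conv_lhs => rw [← b.sum_repr u, map_sum]
      simp
    have hF : F u = ∑ i, b.repr u i • F (b i) := by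
      conv_lhs => rw [← b.sum_repr u, map_sum]
      simp
    have h1 : ((‖E u‖ ^ 2 : ℝ) : ℂ) = ∑ i, ∑ j, star (b.repr u i) * (b.repr u j * ⟪E (b i), E (b j)⟫_ℂ) := by
      have := inner_self_eq_norm_sq_to_K (𝕜 := ℂ) (E u)
      push_cast
      rw [← RCLike.ofReal_eq_complex_ofReal, ← this, hE, sum_inner, Finset.sum_congr rfl (fun _ _ => inner_sum _ _ _)]
      simp only [inner_smul_left, inner_smul_right, Finset.mul_sum]
      refine Finset.sum_congr rfl fun i _ => Finset.sum_congr rfl fun j _ => ?_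
      simp only [RCLike.star_def]; ring
    have h2 : ((‖F u‖ ^ 2 : ℝ) : ℂ) = ∑ i, ∑ j, star (b.repr u i) * (b.repr u j * ⟪F (b i), F (b j)⟫_ℂ) := by
      have := inner_self_eq_norm_sq_to_K (𝕜 := ℂ) (F u)
      push_cast
      rw [← RCLike.ofReal_eq_complex_ofReal, ← this, hF, sum_inner, Finset.sum_congr rfl (fun _ _ => inner_sum _ _ _)]
      simp only [inner_smul_left, inner_smul_right, Finset.mul_sum]
      refine Finset.sum_congr rfl fun i _ => Finset.sum_congr rfl fun j _ => ?_
      simp only [RCLike.star_def]; ring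
    rw [Complex.ofReal_sub, h1, h2, ← Finset.sum_sub_distrib]
    simp only [dotProduct, mulVec, Finset.mul_sum, ← Finset.sum_sub_distrib, Pi.star_apply, M]
    refine Finset.sum_congr rfl fun i _ => Finset.sum_congr rfl fun j _ => ?_
    ring
  have hpsd : M.PosSemidef := by
    refine Matrix.PosSemidef.of_dotProduct_mulVec_nonneg ?_ ?_
    · ext i j
      rw [conjTranspose_apply]
      simp [M]
    · intro x
      obtain ⟨u, hu⟩ : ∃ u, ⇑(b.repr u) = x := by
        refine ⟨b.equivFun.symm x, ?_⟩
        have := b.equivFun.apply_symm_apply x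
        rwa [b.equivFun_apply] at this
      rw [← hu, hM]
      exact_mod_cast sub_nonneg.2 (h u)
  obtain ⟨A, hA⟩ : ∃ A : Matrix (Fin n) (Fin n) ℂ, M = Aᴴ * A :=
    by
    open scoped MatrixOrder in
    exact CStarAlgebra.nonneg_iff_eq_star_mul_self.mp hpsd.nonneg
  refine ⟨(WithLp.linearEquiv 2 ℂ (Fin n → ℂ)).symm.toLinearMap ∘ₗ A.mulVecLin ∘ₗ
    b.equivFun.toLinearMap, fun u => ?_⟩
  have h1 := hM u
  rw [hA, ← mulVec_mulVec, dotProduct_mulVec, ← star_mulVec] at h1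
  have h2 : ‖((WithLp.linearEquiv 2 ℂ (Fin n → ℂ)).symm.toLinearMap ∘ₗ A.mulVecLin ∘ₗ
    b.equivFun.toLinearMap) u‖ ^ 2 = ‖E u‖ ^ 2 - ‖F u‖ ^ 2 := by
    rw [EuclideanSpace.norm_sq_eq]
    have h3 : ((∑ i, ‖(A *ᵥ ⇑(b.repr u)) i‖ ^ 2 : ℝ) : ℂ) = ((‖E u‖ ^ 2 - ‖F u‖ ^ 2 : ℝ) : ℂ) := by
      rw [← h1]
      push_cast
      simp only [dotProduct, Pi.star_apply]
      refine Finset.sum_congr rfl fun i _ => ?_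
      rw [RCLike.star_def, Complex.conj_mul']
    have h4 := Complex.ofReal_injective h3
    rw [← h4]
    rfl
  rw [h2]; ring

lemma gram_factor {U H₁ H₂ : Type*} [AddCommGroup U] [Module ℂ U] [FiniteDimensional ℂ U]
    [NormedAddCommGroup H₁] [InnerProductSpace ℂ H₁] [NormedAddCommGroup H₂]
    [InnerProductSpace ℂ H₂] (K : Submodule ℂ U) (E : U →ₗ[ℂ] H₁) (F : U →ₗ[ℂ] H₂)
    (h : ∀ u ∈ K, ‖F u‖ ^ 2 ≤ ‖E u‖ ^ 2) :
    ∃ (d : ℕ) (δ : U →ₗ[ℂ] EuclideanSpace ℂ (Fin d)),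
      ∀ u ∈ K, ‖δ u‖ ^ 2 + ‖F u‖ ^ 2 = ‖E u‖ ^ 2 := by
  obtain ⟨δ, hδ⟩ := gram_factor0 (E ∘ₗ K.subtype) (F ∘ₗ K.subtype) (fun u => h u.1 u.2)
  obtain ⟨δ', h'⟩ := LinearMap.exists_extend δ
  refine ⟨_, δ', fun u hu => ?_⟩
  have := hδ ⟨u, hu⟩
  rw [← h'] at this
  exact this

lemma douglas {U Y X : Type*} [AddCommGroup U] [Module ℂ U] [FiniteDimensional ℂ U]
    [NormedAddCommGroup Y] [InnerProductSpace ℂ Y] [NormedAddCommGroup X]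
    [InnerProductSpace ℂ X] (K : Submodule ℂ U) (y : U →ₗ[ℂ] Y) (x : U →ₗ[ℂ] X)
    (h : ∀ u ∈ K, ‖x u‖ ^ 2 = ‖y u‖ ^ 2) :
    ∃ V : Y →ₗ[ℂ] X, (∀ v, ‖V v‖ ≤ ‖v‖) ∧ ∀ u ∈ K, V (y u) = x u := by
  let yK := y ∘ₗ K.subtype
  let R := LinearMap.range yK
  haveI : FiniteDimensional ℂ R := inferInstance
  obtain ⟨σ, hσ⟩ := yK.rangeRestrict.exists_rightInverse_of_surjective yK.range_rangeRestrict
  have hn : ∀ u ∈ K, ‖x u‖ = ‖y u‖ := fun u hu => by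
    have := h u hu
    rwa [sq_eq_sq₀ (norm_nonneg _) (norm_nonneg _)] at this
  have hσ' : ∀ r : R, y (σ r) = r := fun r => by
    have := congrArg (Subtype.val) (LinearMap.congr_fun hσ r)
    exact this
  refine ⟨(x ∘ₗ K.subtype ∘ₗ σ) ∘ₗ (R.orthogonalProjectionOnto).toLinearMap, ?_, ?_⟩
  · intro v
    have h1 : ‖x (σ (R.orthogonalProjectionOnto v))‖ = ‖y (σ (R.orthogonalProjectionOnto v))‖ :=
      hn _ (σ _).2
    rw [hσ'] at h1
    show ‖x (σ (R.orthogonalProjectionOnto v))‖ ≤ _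
    rw [h1]
    exact Submodule.norm_orthogonalProjectionOnto_apply_le R v
  · intro u hu
    have hr : R.orthogonalProjectionOnto (y u) = ⟨y u, ⟨⟨u, hu⟩, rfl⟩⟩ :=
      Submodule.orthogonalProjectionOnto_mem_subspace_eq_self (K := R) ⟨y u, ⟨⟨u, hu⟩, rfl⟩⟩
    show x (σ (R.orthogonalProjectionOnto (y u))) = x u
    rw [hr]
    rw [← sub_eq_zero, ← map_sub, ← norm_eq_zero]
    rw [hn _ (K.sub_mem (σ _).2 hu), map_sub, hσ', sub_self, norm_zero]

/-- weighted sequence map -/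
lemma seqmap {I U G : Type*} [AddCommGroup U] [Module ℂ U] [NormedAddCommGroup G]
    [InnerProductSpace ℂ G] (w : I → ℝ) (hw : ∀ a, 0 ≤ w a) (D : I → U →ₗ[ℂ] G)
    (hs : ∀ u, Summable fun a => w a * ‖D a u‖ ^ 2) :
    ∃ y : U →ₗ[ℂ] lp (fun _ : I => G) 2, (∀ u, ‖y u‖ ^ 2 = ∑' a, w a * ‖D a u‖ ^ 2) ∧
      ∀ u a, y u a = (Real.sqrt (w a) : ℂ) • D a u := by
  have hn : ∀ u a, ‖(Real.sqrt (w a) : ℂ) • D a u‖ ^ 2 = w a * ‖D a u‖ ^ 2 := by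
    intro u a
    rw [norm_smul, mul_pow, Complex.norm_real, Real.norm_of_nonneg (Real.sqrt_nonneg _),
      Real.sq_sqrt (hw a)]
  have hmem : ∀ u, Memℓp (fun a => (Real.sqrt (w a) : ℂ) • D a u) 2 := by
    intro u
    rw [memℓp_gen_iff (by norm_num)]
    simp only [ENNReal.toReal_ofNat, Real.rpow_two, hn]
    exact hs u
  refine ⟨{ toFun := fun u => ⟨fun a => (Real.sqrt (w a) : ℂ) • D a u, hmem u⟩
            map_add' := ?_, map_smul' := ?_ }, ?_, ?_⟩
  · intro u v
    ext a
    exact (congrArg _ ((D a).map_add u v)).trans (smul_add _ _ _)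
  · intro c u
    ext a
    exact (congrArg _ ((D a).map_smul c u)).trans (smul_comm _ _ _)
  · intro u
    have := lp.norm_rpow_eq_tsum (p := 2) (by norm_num) (⟨fun a => (Real.sqrt (w a) : ℂ) • D a u, hmem u⟩ : lp (fun _ : I => G) 2)
    simp only [ENNReal.toReal_ofNat, Real.rpow_two, hn] at this
    exact this
  · intro u a; rfl

end Hilb

section OneStep

def pairL {U A B : Type*} [AddCommGroup U] [Module ℂ U] [NormedAddCommGroup A]
    [InnerProductSpace ℂ A] [NormedAddCommGroup B] [InnerProductSpace ℂ B]
    (f : U →ₗ[ℂ] A) (h : U →ₗ[ℂ] B) : U →ₗ[ℂ] WithLp 2 (A × B) :=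
  (WithLp.linearEquiv 2 ℂ (A × B)).symm.toLinearMap ∘ₗ f.prod h

def fstL {A B : Type*} [NormedAddCommGroup A]
    [InnerProductSpace ℂ A] [NormedAddCommGroup B] [InnerProductSpace ℂ B] :
    WithLp 2 (A × B) →ₗ[ℂ] A := LinearMap.fst ℂ A B ∘ₗ (WithLp.linearEquiv 2 ℂ (A × B)).toLinearMap

def sndL {A B : Type*} [NormedAddCommGroup A]
    [InnerProductSpace ℂ A] [NormedAddCommGroup B] [InnerProductSpace ℂ B] :
    WithLp 2 (A × B) →ₗ[ℂ] B := LinearMap.snd ℂ A B ∘ₗ (WithLp.linearEquiv 2 ℂ (A × B)).toLinearMap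

lemma pair_norm {A B : Type*} [NormedAddCommGroup A]
    [InnerProductSpace ℂ A] [NormedAddCommGroup B] [InnerProductSpace ℂ B]
    (x : WithLp 2 (A × B)) : ‖x‖ ^ 2 = ‖fstL x‖ ^ 2 + ‖sndL x‖ ^ 2 :=
  WithLp.prod_norm_sq_eq_of_L2 x

lemma pair_ext {A B : Type*} [NormedAddCommGroup A]
    [InnerProductSpace ℂ A] [NormedAddCommGroup B] [InnerProductSpace ℂ B]
    {x y : WithLp 2 (A × B)} (h1 : fstL x = fstL y) (h2 : sndL x = sndL y) : x = y := by
  apply (WithLp.linearEquiv 2 ℂ (A × B)).injective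
  exact Prod.ext h1 h2

@[simp] lemma fstL_pairL {U A B : Type*} [AddCommGroup U] [Module ℂ U] [NormedAddCommGroup A]
    [InnerProductSpace ℂ A] [NormedAddCommGroup B] [InnerProductSpace ℂ B]
    (f : U →ₗ[ℂ] A) (h : U →ₗ[ℂ] B) (u) : fstL (pairL f h u) = f u := rfl

@[simp] lemma sndL_pairL {U A B : Type*} [AddCommGroup U] [Module ℂ U] [NormedAddCommGroup A]
    [InnerProductSpace ℂ A] [NormedAddCommGroup B] [InnerProductSpace ℂ B]
    (f : U →ₗ[ℂ] A) (h : U →ₗ[ℂ] B) (u) : sndL (pairL f h u) = h u := rfl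

lemma contr_aux {A P x y : ℝ} (hA : A < 1) (hP : P < 1) (hx : 0 ≤ x) (hy : 0 ≤ y)
    (h : x + y ≤ A * x + P * y) : x = 0 ∧ y = 0 := by
  have h1 := mul_nonneg (sub_nonneg.2 hA.le) hx
  have h2 := mul_nonneg (sub_nonneg.2 hP.le) hy
  have h3 : (1 - A) * x = 0 := by nlinarith
  have h4 : (1 - P) * y = 0 := by nlinarith
  constructor
  · exact (mul_eq_zero.1 h3).resolve_left (by linarith)
  · exact (mul_eq_zero.1 h4).resolve_left (by linarith)

set_option maxHeartbeats 2000000 in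
theorem one_step {g N : ℕ} {k ℓ s m p T : (Fin g → ℕ) → ℝ} (hC : Coef k ℓ s m p T)
    {U W : Type*} [AddCommGroup U] [Module ℂ U] [FiniteDimensional ℂ U]
    [AddCommGroup W] [Module ℂ W]
    (S : (Fin g → ℕ) → U →ₗ[ℂ] U) (S0 : ∀ u, S 0 u = u) (SS : ∀ a b u, S b (S a u) = S (a + b) u)
    (e φ : U →ₗ[ℂ] EuclideanSpace ℂ (Fin N)) (π : U →ₗ[ℂ] W) (sec : W →ₗ[ℂ] U)
    (hsec : ∀ w, π (sec w) = w) (β : (Fin g → ℕ) → ℂ) (hπ : ∀ a u, π (S a u) = β a • π u)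
    (hβ : ∀ a b, ‖β (a + b)‖ = ‖β a‖ * ‖β b‖) (hβ0 : ‖β 0‖ = 1)
    (hβs : Summable fun a => ℓ a * ‖β a‖ ^ 2)
    (grow : ∀ (f : U →ₗ[ℂ] ℂ) u, Summable fun a => ℓ a * ‖f (S a u)‖ ^ 2)
    (h : ∀ u, π u = 0 → ∑' a, k a * ‖φ (S a u)‖ ^ 2 ≤ ∑' a, ℓ a * ‖e (S a u)‖ ^ 2) :
    ∃ φ' : U →ₗ[ℂ] EuclideanSpace ℂ (Fin N), (∀ u, π u = 0 → φ' u = φ u) ∧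
      ∀ u, ∑' a, k a * ‖φ' (S a u)‖ ^ 2 ≤ ∑' a, ℓ a * ‖e (S a u)‖ ^ 2 := by
  have grow' : ∀ (d : ℕ) (f : U →ₗ[ℂ] EuclideanSpace ℂ (Fin d)) u,
      Summable fun a => ℓ a * ‖f (S a u)‖ ^ 2 := by
    intro d f u
    simp only [EuclideanSpace.norm_sq_eq, Finset.mul_sum]
    refine summable_sum fun i _ => ?_
    exact grow ((EuclideanSpace.proj i : EuclideanSpace ℂ (Fin d) →L[ℂ] ℂ).toLinearMap ∘ₗ f) u
  have dom : ∀ {x : (Fin g → ℕ) → ℝ} (_ : ∀ a, 0 ≤ x a) (_ : ∀ a, x a ≤ ℓ a) {d : ℕ}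
      (f : U →ₗ[ℂ] EuclideanSpace ℂ (Fin d)) u, Summable fun a => x a * ‖f (S a u)‖ ^ 2 := by
    intro x h1 h2 d f u
    exact summable_dom h1 h2 (fun a => sq_nonneg _) (grow' d f u)
  obtain ⟨yE, hyE, -⟩ := seqmap ℓ hC.ℓnn (fun a => e ∘ₗ S a) (grow' _ e)
  obtain ⟨yF, hyF, -⟩ := seqmap k hC.knn (fun a => φ ∘ₗ S a) (dom hC.knn hC.hkℓ φ)
  obtain ⟨d, δ, hδ⟩ := gram_factor (LinearMap.ker π) yE yF (by
    intro u hu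
    rw [hyE, hyF]
    exact h u hu)
  obtain ⟨ye, hye, -⟩ := seqmap m hC.mnn (fun a => e ∘ₗ S a) (dom hC.mnn hC.hmℓ e)
  obtain ⟨yδ, hyδ, hyδ'⟩ := seqmap s hC.snn (fun a => δ ∘ₗ S a) (dom hC.snn hC.hsℓ δ)
  obtain ⟨yφ, hyφ, hyφ'⟩ := seqmap p hC.pnn (fun a => φ ∘ₗ S a) (dom hC.pnn hC.hpℓ φ)
  have nβ : ∀ {d : ℕ} (x : EuclideanSpace ℂ (Fin d)) (w : (Fin g → ℕ) → ℝ) a,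
      w a * ‖(β a • (LinearMap.id : EuclideanSpace ℂ (Fin d) →ₗ[ℂ] EuclideanSpace ℂ (Fin d))) x‖ ^ 2
        = w a * ‖β a‖ ^ 2 * ‖x‖ ^ 2 := by
    intro d x w a
    simp only [LinearMap.smul_apply, LinearMap.id_apply, norm_smul]; ring
  obtain ⟨bs, hbs, hbs'⟩ := seqmap s hC.snn
    (fun a => β a • (LinearMap.id : EuclideanSpace ℂ (Fin d) →ₗ[ℂ] EuclideanSpace ℂ (Fin d)))
    (by
      intro x
      simp only [nβ]
      exact (summable_dom hC.snn hC.hsℓ (fun a => sq_nonneg _) hβs).mul_right _)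
  obtain ⟨bp, hbp, hbp'⟩ := seqmap p hC.pnn
    (fun a => β a • (LinearMap.id : EuclideanSpace ℂ (Fin N) →ₗ[ℂ] EuclideanSpace ℂ (Fin N)))
    (by
      intro x
      simp only [nβ]
      exact (summable_dom hC.pnn hC.hpℓ (fun a => sq_nonneg _) hβs).mul_right _)
  simp only [nβ, tsum_mul_right] at hbs hbp
  obtain ⟨cs, cp⟩ := contr_consts hC (ω := fun a => ‖β a‖ ^ 2) (fun a => sq_nonneg _)
    (by simp [hβ0]) (fun a b => by simp only [hβ]; ring) hβs
  set X := pairL δ φ with hX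
  set y := pairL ye (pairL yδ yφ) with hy
  obtain ⟨V, hV, hVy⟩ := douglas (LinearMap.ker π) y X (by
    intro u hu
    have hu' : π u = 0 := hu
    rw [pair_norm, pair_norm (y u)]
    simp only [hX, hy, fstL_pairL, sndL_pairL]
    rw [pair_norm (pairL yδ yφ u)]
    simp only [fstL_pairL, sndL_pairL]
    rw [hye, hyδ, hyφ]
    have := ker_eq hC (E := fun a => ‖e (S a u)‖ ^ 2) (Φ := fun a => ‖φ (S a u)‖ ^ 2)
      (D := fun a => ‖δ (S a u)‖ ^ 2) (fun _ => sq_nonneg _) (fun _ => sq_nonneg _)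
      (grow' _ e u) (grow' _ φ u) (by
        intro a
        have h1 := hδ (S a u) (by rw [LinearMap.mem_ker, hπ, hu', smul_zero])
        rw [hyE, hyF] at h1
        simp only [LinearMap.comp_apply, SS] at h1
        linarith)
    simp only [S0] at this
    simp only [LinearMap.comp_apply]
    linarith)
  let B : WithLp 2 (EuclideanSpace ℂ (Fin d) × EuclideanSpace ℂ (Fin N)) →ₗ[ℂ] _ :=
    pairL (0 : _ →ₗ[ℂ] lp (fun _ : Fin g → ℕ => EuclideanSpace ℂ (Fin N)) 2)
      (pairL (bs ∘ₗ fstL) (bp ∘ₗ sndL))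
  have hB : ∀ x, ‖B x‖ ^ 2 = (∑' a, s a * ‖β a‖ ^ 2) * ‖fstL x‖ ^ 2 +
      (∑' a, p a * ‖β a‖ ^ 2) * ‖sndL x‖ ^ 2 := by
    intro x
    rw [pair_norm]
    simp only [B, fstL_pairL, sndL_pairL]
    rw [pair_norm (pairL (bs ∘ₗ fstL) (bp ∘ₗ sndL) x)]
    simp only [fstL_pairL, sndL_pairL, LinearMap.comp_apply, hbs, hbp]
    simp
  have hinj : Function.Injective ⇑(LinearMap.id - V ∘ₗ B : WithLp 2 (EuclideanSpace ℂ (Fin d) × EuclideanSpace ℂ (Fin N)) →ₗ[ℂ] WithLp 2 (EuclideanSpace ℂ (Fin d) × EuclideanSpace ℂ (Fin N))) := by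
    rw [← LinearMap.ker_eq_bot, LinearMap.ker_eq_bot']
    intro x hx
    have hx' : x = V (B x) := by simpa [sub_eq_zero] using hx
    have h1 : ‖x‖ ≤ ‖B x‖ := by
      conv_lhs => rw [hx']
      exact hV _
    have h2 : ‖x‖ ^ 2 ≤ ‖B x‖ ^ 2 := pow_le_pow_left₀ (norm_nonneg _) h1 2
    rw [hB, pair_norm] at h2
    obtain ⟨z1, z2⟩ := contr_aux cs cp (sq_nonneg _) (sq_nonneg _) h2
    have z3 := pair_norm x
    rw [z1, z2, add_zero] at z3
    simpa using z3
  haveI : FiniteDimensional ℂ (WithLp 2 (EuclideanSpace ℂ (Fin d) × EuclideanSpace ℂ (Fin N))) :=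
    (WithLp.linearEquiv 2 ℂ (EuclideanSpace ℂ (Fin d) × EuclideanSpace ℂ (Fin N))).symm.finiteDimensional
  let L := LinearEquiv.ofInjectiveEndo _ hinj
  let T0 := L.symm.toLinearMap ∘ₗ (V ∘ₗ y - X) ∘ₗ sec
  have hL : ∀ w, T0 w - V (B (T0 w)) = V (y (sec w)) - X (sec w) := by
    intro w
    have : L (T0 w) = V (y (sec w)) - X (sec w) := by
      simp only [T0, LinearMap.comp_apply, LinearEquiv.coe_coe, LinearEquiv.apply_symm_apply]
      rfl
    rw [← this]
    rfl
  let X' := X + T0 ∘ₗ π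
  have hX' : ∀ u, X' u = V (y u + B (T0 (π u))) := by
    intro u
    have h1 := hVy (u - sec (π u)) (by simp [hsec])
    have h2 := hL (π u)
    simp only [map_sub] at h1
    simp only [X', LinearMap.add_apply, LinearMap.comp_apply, map_add]
    rw [sub_eq_sub_iff_add_eq_add] at h1 h2
    have h1' : V (y u) - X u = V (y (sec (π u))) - X (sec (π u)) := by
      rw [sub_eq_sub_iff_add_eq_add, h1, add_comm]
    have h2' : T0 (π u) - V (B (T0 (π u))) = V (y (sec (π u))) - X (sec (π u)) :=
      hL (π u)
    rw [← h1'] at h2'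
    rw [sub_eq_sub_iff_add_eq_add] at h2'
    rw [add_comm, h2']
  set δ' := fstL ∘ₗ X' with hδ'
  set φ' := sndL ∘ₗ X' with hφ'
  have dδ : ∀ u, δ' u = δ u + fstL (T0 (π u)) := by
    intro u; simp [hδ', X', hX]
  have dφ : ∀ u, φ' u = φ u + sndL (T0 (π u)) := by
    intro u; simp [hφ', X', hX]
  refine ⟨φ', fun u hu => by rw [dφ, hu]; simp, ?_⟩
  obtain ⟨zδ, hzδ, hzδ'⟩ := seqmap s hC.snn (fun a => δ' ∘ₗ S a) (dom hC.snn hC.hsℓ δ')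
  obtain ⟨zφ, hzφ, hzφ'⟩ := seqmap p hC.pnn (fun a => φ' ∘ₗ S a) (dom hC.pnn hC.hpℓ φ')
  have main : ∀ u, ‖δ' u‖ ^ 2 + ‖φ' u‖ ^ 2 ≤ ∑' b, m b * ‖e (S b u)‖ ^ 2 +
      ∑' b, s b * ‖δ' (S b u)‖ ^ 2 + ∑' b, p b * ‖φ' (S b u)‖ ^ 2 := by
    intro u
    have e1 : y u + B (T0 (π u)) = pairL ye (pairL zδ zφ) u := by
      refine pair_ext ?_ (pair_ext ?_ ?_)
      · rw [map_add]; simp [hy, B]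
      · rw [map_add, map_add]
        simp only [hy, B, sndL_pairL, fstL_pairL, LinearMap.comp_apply]
        ext1
        funext a
        rw [lp.coeFn_add, Pi.add_apply, hyδ', hbs', hzδ']
        simp only [LinearMap.comp_apply, dδ, hπ, map_smul, smul_add, LinearMap.smul_apply,
          LinearMap.id_apply]
      · rw [map_add, map_add]
        simp only [hy, B, sndL_pairL, LinearMap.comp_apply]
        ext1
        funext a
        rw [lp.coeFn_add, Pi.add_apply, hyφ', hbp', hzφ']
        simp only [LinearMap.comp_apply, dφ, hπ, map_smul, smul_add, LinearMap.smul_apply,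
          LinearMap.id_apply]
    have e2 : ‖X' u‖ ^ 2 ≤ ‖pairL ye (pairL zδ zφ) u‖ ^ 2 := by
      rw [hX', e1]
      exact pow_le_pow_left₀ (norm_nonneg _) (hV _) 2
    rw [pair_norm, pair_norm (pairL ye (pairL zδ zφ) u)] at e2
    simp only [fstL_pairL, sndL_pairL] at e2
    rw [pair_norm (pairL zδ zφ u)] at e2
    simp only [fstL_pairL, sndL_pairL] at e2
    rw [hye, hzδ, hzφ, ← add_assoc] at e2
    exact e2
  intro u
  refine final_ineq hC (E := fun a => ‖e (S a u)‖ ^ 2) (Φ := fun a => ‖φ' (S a u)‖ ^ 2)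
      (D := fun a => ‖δ' (S a u)‖ ^ 2) (fun _ => sq_nonneg _) (fun _ => sq_nonneg _)
      (fun _ => sq_nonneg _) (grow' _ e u) (grow' _ φ' u) (grow' _ δ' u) ?_
  intro c
  have := main (S c u)
  simp only [SS] at this
  exact this

end OneStep

section CC
variable {g : ℕ}

lemma star_dot_self {ι : Type*} [Fintype ι] (x : ι → ℂ) :
    star x ⬝ᵥ x = ((∑ i, ‖x i‖ ^ 2 : ℝ) : ℂ) := by
  push_cast
  simp only [dotProduct, Pi.star_apply]
  refine Finset.sum_congr rfl fun i _ => ?_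
  rw [RCLike.star_def, Complex.conj_mul']

lemma contraction_iff {ι : Type*} [Fintype ι] [DecidableEq ι] (C : Matrix ι ι ℂ) :
    IsContractionMat C ↔ ∀ x : ι → ℂ, ∑ i, ‖(C *ᵥ x) i‖ ^ 2 ≤ ∑ i, ‖x i‖ ^ 2 := by
  have hq : ∀ x : ι → ℂ, star x ⬝ᵥ (((1 : Matrix ι ι ℂ) - Cᴴ * C) *ᵥ x) =
      ((∑ i, ‖x i‖ ^ 2 - ∑ i, ‖(C *ᵥ x) i‖ ^ 2 : ℝ) : ℂ) := by
    intro x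
    rw [sub_mulVec, one_mulVec, dotProduct_sub, ← mulVec_mulVec, dotProduct_mulVec _ Cᴴ, ← star_mulVec,
      star_dot_self, star_dot_self, Complex.ofReal_sub]
  constructor
  · intro h x
    have := h.dotProduct_mulVec_nonneg x
    rw [hq] at this
    have h2 : (0 : ℝ) ≤ (∑ i, ‖x i‖ ^ 2 - ∑ i, ‖(C *ᵥ x) i‖ ^ 2 : ℝ) := by exact_mod_cast this
    linarith
  · intro h
    refine Matrix.PosSemidef.of_dotProduct_mulVec_nonneg ?_ ?_
    · exact (Matrix.isHermitian_one).sub (isHermitian_conjTranspose_mul_self C)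
    · intro x
      rw [hq]
      exact_mod_cast sub_nonneg.2 (h x)

lemma contr_iff {kc ℓc : (Fin g → ℕ) → ℝ} (hk : ∀ a, 0 < kc a) (hℓ : ∀ a, 0 < ℓc a) {J : ℕ}
    (c : (Fin g → ℕ) → Matrix (Fin J) (Fin J) ℂ) (S : Finset (Fin g → ℕ)) :
    IsContractionMat (caraMatrix kc ℓc c S) ↔ ∀ u : (Fin g → ℕ) → Fin J → ℂ,
      ∑ a ∈ S, kc a * ∑ i, ‖∑ b ∈ S, if a ≤ b then ∑ j, c (b - a) i j * u b j else 0‖ ^ 2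
        ≤ ∑ b ∈ S, ℓc b * ∑ i, ‖u b i‖ ^ 2 := by
  rw [contraction_iff]
  have key : ∀ u : (Fin g → ℕ) → Fin J → ℂ, ∀ x : S × Fin J → ℂ,
      (∀ q, x q = (Real.sqrt (ℓc q.1) : ℂ) * u q.1 q.2) →
      (∑ i, ‖(caraMatrix kc ℓc c S *ᵥ x) i‖ ^ 2 = ∑ a ∈ S, kc a * ∑ i, ‖∑ b ∈ S, if a ≤ b then ∑ j, c (b - a) i j * u b j else 0‖ ^ 2) ∧ ∑ i, ‖x i‖ ^ 2 = ∑ b ∈ S, ℓc b * ∑ i, ‖u b i‖ ^ 2 := by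
    intro u x hx
    constructor
    · rw [Fintype.sum_prod_type, ← Finset.sum_coe_sort S]
      refine Finset.sum_congr rfl fun a _ => ?_
      rw [Finset.mul_sum]
      refine Finset.sum_congr rfl fun i _ => ?_
      have : (caraMatrix kc ℓc c S *ᵥ x) (a, i) = (Real.sqrt (kc a) : ℂ) *
          ∑ b ∈ S, if a.1 ≤ b then ∑ j, c (b - a) i j * u b j else 0 := by
        simp only [mulVec, dotProduct]
        rw [Fintype.sum_prod_type, ← Finset.sum_coe_sort S, Finset.mul_sum]
        refine Finset.sum_congr rfl fun b _ => ?_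
        simp only [caraMatrix, hx]
        split_ifs with hab
        · rw [Finset.mul_sum]
          refine Finset.sum_congr rfl fun j _ => ?_
          rw [Real.sqrt_div (hk _).le]
          have : (Real.sqrt (ℓc b) : ℂ) ≠ 0 := by
            exact_mod_cast (Real.sqrt_pos.2 (hℓ b)).ne'
          push_cast
          field_simp
        · simp
      rw [this, norm_mul, mul_pow, Complex.norm_real, Real.norm_of_nonneg (Real.sqrt_nonneg _),
        Real.sq_sqrt (hk _).le]
    · rw [Fintype.sum_prod_type, ← Finset.sum_coe_sort S]
      refine Finset.sum_congr rfl fun a _ => ?_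
      rw [Finset.mul_sum]
      refine Finset.sum_congr rfl fun i _ => ?_
      rw [hx, norm_mul, mul_pow, Complex.norm_real, Real.norm_of_nonneg (Real.sqrt_nonneg _),
        Real.sq_sqrt (hℓ _).le]
  constructor
  · intro h u
    obtain ⟨h1, h2⟩ := key u (fun q => (Real.sqrt (ℓc q.1) : ℂ) * u q.1 q.2) (fun q => rfl)
    rw [← h1, ← h2]
    exact h _
  · intro h x
    obtain ⟨h1, h2⟩ := key (fun b j => if hb : b ∈ S then x (⟨b, hb⟩, j) / (Real.sqrt (ℓc b) : ℂ) else 0) x (by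
      rintro ⟨⟨b, hb⟩, j⟩
      have : (Real.sqrt (ℓc b) : ℂ) ≠ 0 := by
        exact_mod_cast (Real.sqrt_pos.2 (hℓ b)).ne'
      simp only [hb, dif_pos]
      field_simp)
    rw [h1, h2]
    exact h _

lemma shift_sum {J : ℕ} (c : (Fin g → ℕ) → Matrix (Fin J) (Fin J) ℂ) {S : Finset (Fin g → ℕ)}
    (hS : IsCoinvariant S) (u : (Fin g → ℕ) → Fin J → ℂ) (hu : ∀ a, a ∉ S → u a = 0) (a i) :
    (∑ b ∈ S, if a ≤ b then ∑ j, c (b - a) i j * u b j else 0)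
      = ∑ d ∈ S, ∑ j, c d i j * u (d + a) j := by
  rw [← Finset.sum_filter]
  symm
  have h1 : ∑ d ∈ S, ∑ j, c d i j * u (d + a) j
      = ∑ d ∈ S with d + a ∈ S, ∑ j, c d i j * u (d + a) j := by
    rw [Finset.sum_filter]
    refine Finset.sum_congr rfl fun d _ => ?_
    split_ifs with h
    · rfl
    · rw [hu _ h]; simp
  rw [h1]
  refine Finset.sum_bij' (fun d _ => d + a) (fun b _ => b - a) ?_ ?_ ?_ ?_ ?_
  · intro d hd
    simp only [Finset.mem_filter] at hd ⊢
    exact ⟨hd.2, le_add_self⟩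
  · intro b hb
    simp only [Finset.mem_filter] at hb ⊢
    rw [tsub_add_cancel_of_le hb.2]
    exact ⟨hS b hb.1 _ tsub_le_self, hb.1⟩
  · intro d hd; exact add_tsub_cancel_right d a
  · intro b hb
    exact tsub_add_cancel_of_le (Finset.mem_filter.1 hb).2
  · intro d hd
    rw [add_tsub_cancel_right]

lemma contr_iff_shift {kc ℓc : (Fin g → ℕ) → ℝ} (hk : ∀ a, 0 < kc a) (hℓ : ∀ a, 0 < ℓc a) {J : ℕ}
    (c : (Fin g → ℕ) → Matrix (Fin J) (Fin J) ℂ) {S : Finset (Fin g → ℕ)} (hS : IsCoinvariant S) :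
    IsContractionMat (caraMatrix kc ℓc c S) ↔ ∀ u : (Fin g → ℕ) → Fin J → ℂ, (∀ a, a ∉ S → u a = 0) →
      ∑ a ∈ S, kc a * ∑ i, ‖∑ d ∈ S, ∑ j, c d i j * u (d + a) j‖ ^ 2
        ≤ ∑ b ∈ S, ℓc b * ∑ i, ‖u b i‖ ^ 2 := by
  rw [contr_iff hk hℓ]
  constructor
  · intro h u hu
    have := h u
    simpa only [shift_sum c hS u hu] using this
  · intro h u
    have hu' : ∀ a, a ∉ S → (fun b => if b ∈ S then u b else 0) a = 0 := by
      intro a ha; simp [ha]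
    have := h _ hu'
    simp only [← shift_sum c hS _ hu'] at this
    have e1 : ∑ b ∈ S, ℓc b * ∑ i, ‖u b i‖ ^ 2 =
        ∑ b ∈ S, ℓc b * ∑ i, ‖(if b ∈ S then u b else 0) i‖ ^ 2 :=
      Finset.sum_congr rfl fun b hb => by rw [if_pos hb]
    rw [e1]
    refine le_trans (le_of_eq ?_) this
    refine Finset.sum_congr rfl fun a ha => ?_
    congr 1
    refine Finset.sum_congr rfl fun i _ => ?_
    congr 2
    refine Finset.sum_congr rfl fun b hb => ?_
    rw [if_pos hb]

lemma norm_sq_sum_one {ι : Type*} (s : Finset ι) (f : ι → ℂ)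
    (h : ∀ x ∈ s, ∀ y ∈ s, f x ≠ 0 → f y ≠ 0 → x = y) : ‖∑ x ∈ s, f x‖ ^ 2 = ∑ x ∈ s, ‖f x‖ ^ 2 := by
  by_cases hx : ∃ x ∈ s, f x ≠ 0
  · obtain ⟨x, hxs, hx⟩ := hx
    have hz : ∀ y ∈ s, y ≠ x → f y = 0 := by
      intro y hy hne
      by_contra h0
      exact hne (h y hy x hxs h0 hx)
    rw [Finset.sum_eq_single_of_mem x hxs hz, Finset.sum_eq_single_of_mem x hxs]
    intro y hy hne; rw [hz y hy hne]; simp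
  · push Not at hx
    rw [Finset.sum_eq_zero hx, Finset.sum_eq_zero]
    · simp
    · intro y hy; rw [hx y hy]; simp

lemma cc_hyp {k ℓ : (Fin g → ℕ) → ℝ} (hk : ∀ a, 0 < k a) (hℓ : ∀ a, 0 < ℓ a)
    (N : (Fin g → ℕ) → ℕ) (hN : ∀ e b, e < b → N e < N b) (hNi : Function.Injective N)
    (hcc : IsCCPair k ℓ) :
    ∀ b, b ≠ 0 → ∀ f : (Fin g → ℕ) → ℝ, (∀ a, 0 ≤ f a) → (∀ e, ¬ e < b → f e = 0) →
      (∀ e, N e < N b → conv f k e ≤ ℓ e) → conv f k b ≤ ℓ b := by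
  intro b hb f hf hfb hfk
  have hJ : 0 < N b := lt_of_le_of_lt (Nat.zero_le _) (hN 0 b (pos_iff_ne_zero.2 hb))
  let c₀ : (Fin g → ℕ) → Matrix (Fin (N b)) (Fin (N b)) ℂ := fun d i j =>
    if (j = ⟨0, hJ⟩ ∧ i.val = N d) then (Real.sqrt (f d) : ℂ) else 0
  have hF : IsCoinvariant (Finset.Iio b) := by
    intro x hx a ha
    rw [Finset.mem_Iio] at *
    exact lt_of_le_of_lt ha hx
  have c0n : ∀ d i, ‖c₀ d i ⟨0, hJ⟩‖ ^ 2 = if i.val = N d then f d else 0 := by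
    intro d i
    simp only [c₀, true_and]
    split_ifs
    · rw [Complex.norm_real, Real.norm_of_nonneg (Real.sqrt_nonneg _), Real.sq_sqrt (hf _)]
    · simp
  have hcon : IsContractionMat (caraMatrix k ℓ c₀ (Finset.Iio b)) := by
    rw [contr_iff hk hℓ]
    intro u
    have h1 : ∀ a d i, ∑ j, c₀ d i j * u a j = c₀ d i ⟨0, hJ⟩ * u a ⟨0, hJ⟩ := by
      intro a d i
      rw [Finset.sum_eq_single ⟨0, hJ⟩]
      · intro j _ hj; simp [c₀, hj]
      · simp
    simp only [h1]
    have h2 : ∀ a i, ‖∑ x ∈ Finset.Iio b, if a ≤ x then c₀ (x - a) i ⟨0, hJ⟩ * u x ⟨0, hJ⟩ else 0‖ ^ 2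
        = ∑ x ∈ Finset.Iio b, if a ≤ x then (if i.val = N (x - a) then f (x - a) else 0) * ‖u x ⟨0, hJ⟩‖ ^ 2 else 0 := by
      intro a i
      rw [norm_sq_sum_one]
      · refine Finset.sum_congr rfl fun x _ => ?_
        split_ifs with h h'
        · rw [norm_mul, mul_pow, c0n, if_pos h']
        · rw [norm_mul, mul_pow, c0n, if_neg h']
        · simp
      · intro x _ y _ hx hy
        have hx1 : a ≤ x := by by_contra h; simp [h] at hx
        have hy1 : a ≤ y := by by_contra h; simp [h] at hy
        have hx2 : i.val = N (x - a) := by by_contra h; simp [h, c₀] at hx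
        have hy2 : i.val = N (y - a) := by by_contra h; simp [h, c₀] at hy
        have := hNi (hx2.symm.trans hy2)
        rw [← tsub_add_cancel_of_le hx1, this, tsub_add_cancel_of_le hy1]
    simp only [h2]
    have h3 : ∀ a, ∑ i : Fin (N b), (∑ x ∈ Finset.Iio b, if a ≤ x then (if i.val = N (x - a) then f (x - a) else 0) * ‖u x ⟨0, hJ⟩‖ ^ 2 else 0) ≤ ∑ x ∈ Finset.Iio b, if a ≤ x then f (x - a) * ‖u x ⟨0, hJ⟩‖ ^ 2 else 0 := by
      intro a
      rw [Finset.sum_comm]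
      refine Finset.sum_le_sum fun x _ => ?_
      split_ifs
      · rw [← Finset.sum_mul]
        refine mul_le_mul_of_nonneg_right ?_ (sq_nonneg _)
        by_cases hlt : N (x - a) < N b
        · rw [Finset.sum_eq_single ⟨N (x - a), hlt⟩]
          · simp
          · intro i _ hi
            rw [if_neg]
            intro h; apply hi; ext; exact h
          · simp
        · rw [Finset.sum_eq_zero]
          · exact hf _
          · intro i _
            rw [if_neg]
            intro h; exact hlt (h ▸ i.2)
      · simp
    refine (Finset.sum_le_sum fun a _ => mul_le_mul_of_nonneg_left (h3 a) (hk a).le).trans ?_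
    simp only [Finset.mul_sum]
    rw [Finset.sum_comm]
    refine Finset.sum_le_sum fun x hx => ?_
    rw [← Finset.mul_sum]
    have h4 : ∑ a ∈ Finset.Iio b, k a * (if a ≤ x then f (x - a) * ‖u x ⟨0, hJ⟩‖ ^ 2 else 0)
        = conv f k x * ‖u x ⟨0, hJ⟩‖ ^ 2 := by
      rw [conv_comm]
      unfold conv
      rw [Finset.sum_mul]
      simp only [mul_ite, mul_zero]
      rw [← Finset.sum_filter]
      refine Finset.sum_congr ?_ fun a _ => by ring
      ext a
      simp only [Finset.mem_filter, Finset.mem_Iio, Finset.mem_Iic]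
      exact ⟨fun h => h.2, fun h => ⟨lt_of_le_of_lt h (Finset.mem_Iio.1 hx), h⟩⟩
    rw [h4]
    refine mul_le_mul (hfk x (hN _ _ (Finset.mem_Iio.1 hx))) ?_ (sq_nonneg _) (hℓ x).le
    exact Finset.single_le_sum (f := fun i => ‖u x i‖ ^ 2) (fun _ _ => sq_nonneg _) (Finset.mem_univ _)
  obtain ⟨c, hc, hcS⟩ := hcc (N b) hJ (Finset.Iio b) hF c₀ hcon
  have h1 := (contr_iff hk hℓ c (Finset.Iic b)).1 (hcS _) (fun x j => if x = b ∧ j = ⟨0, hJ⟩ then 1 else 0)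
  have h2 : ∑ x ∈ Finset.Iic b, ℓ x * ∑ i : Fin (N b), ‖(if x = b ∧ i = ⟨0, hJ⟩ then 1 else 0 : ℂ)‖ ^ 2 = ℓ b := by
    rw [Finset.sum_eq_single b]
    · rw [Finset.sum_eq_single ⟨0, hJ⟩] <;> simp +contextual
    · intro x _ hx; simp [hx]
    · simp
  rw [h2] at h1
  refine le_trans ?_ h1
  rw [conv_comm]
  unfold conv
  refine Finset.sum_le_sum fun a ha => mul_le_mul_of_nonneg_left ?_ (hk a).le
  by_cases hlt : b - a < b
  · refine le_trans (le_of_eq ?_) (Finset.single_le_sum (fun _ _ => sq_nonneg _) (Finset.mem_univ ⟨N (b - a), hN _ _ hlt⟩))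
    rw [Finset.sum_eq_single b]
    · rw [if_pos (Finset.mem_Iic.1 ha), Finset.sum_eq_single ⟨0, hJ⟩]
      · simp only [and_self, if_true, mul_one]
        rw [hc _ (Finset.mem_Iio.2 hlt), c0n, if_pos rfl]
      · intro j _ hj; simp [hj]
      · simp
    · intro x _ hx; simp [hx]
    · simp
  · rw [hfb _ hlt]
    exact Finset.sum_nonneg fun _ _ => sq_nonneg _
end CC

section CCstep
variable {g : ℕ}

lemma cc_step {k ℓ s m p T : (Fin g → ℕ) → ℝ} (hC : Coef k ℓ s m p T) (hk : ∀ a, 0 < k a)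
    (hℓ : ∀ a, 0 < ℓ a) {J : ℕ} {F : Finset (Fin g → ℕ)} {b : Fin g → ℕ} (hF : IsCoinvariant F)
    (hb : b ∉ F) (hF' : IsCoinvariant (insert b F))
    (c : (Fin g → ℕ) → Matrix (Fin J) (Fin J) ℂ) (hc : IsContractionMat (caraMatrix k ℓ c F)) :
    ∃ c' : (Fin g → ℕ) → Matrix (Fin J) (Fin J) ℂ, (∀ a, a ≠ b → c' a = c a) ∧
      IsContractionMat (caraMatrix k ℓ c' (insert b F)) := by
  set G := insert b F with hG
  have hbG : b ∈ G := Finset.mem_insert_self _ _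
  have h0G : (0 : Fin g → ℕ) ∈ G := hF' b hbG 0 zero_le
  have sI : ∀ {A : Type} [AddCommMonoid A] (f : (Fin g → ℕ) → A),
      ∑ a ∈ G, f a = f b + ∑ a ∈ F, f a := fun f => Finset.sum_insert hb
  let ex : (G → Fin J → ℂ) →ₗ[ℂ] ((Fin g → ℕ) → Fin J → ℂ) :=
    LinearMap.pi fun a => if h : a ∈ G then LinearMap.proj (⟨a, h⟩ : G) else 0
  have ex_in : ∀ u a (h : a ∈ G), ex u a = u ⟨a, h⟩ := by
    intro u a h; simp [ex, h]
  have ex_out : ∀ u a, a ∉ G → ex u a = 0 := by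
    intro u a h; simp [ex, h]
  let S : (Fin g → ℕ) → (G → Fin J → ℂ) →ₗ[ℂ] (G → Fin J → ℂ) := fun a =>
    LinearMap.pi fun d => LinearMap.proj (d.1 + a) ∘ₗ ex
  have hS : ∀ a u (d : G), S a u d = ex u (d.1 + a) := fun a u d => rfl
  have exS : ∀ a u d, ex (S a u) d = ex u (d + a) := by
    intro a u d
    by_cases h : d ∈ G
    · rw [ex_in _ _ h, hS]
    · rw [ex_out _ _ h, ex_out]
      intro h'
      exact h (hF' _ h' d le_self_add)
  let toE := (WithLp.linearEquiv 2 ℂ (Fin J → ℂ)).symm.toLinearMap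
  have toE_norm : ∀ v, ‖toE v‖ ^ 2 = ∑ i, ‖v i‖ ^ 2 := fun v => EuclideanSpace.norm_sq_eq _
  let e : (G → Fin J → ℂ) →ₗ[ℂ] EuclideanSpace ℂ (Fin J) := toE ∘ₗ LinearMap.proj (⟨0, h0G⟩ : G)
  let φ : (G → Fin J → ℂ) →ₗ[ℂ] EuclideanSpace ℂ (Fin J) :=
    toE ∘ₗ ∑ d ∈ G, (c d).mulVecLin ∘ₗ LinearMap.proj d ∘ₗ ex
  let π : (G → Fin J → ℂ) →ₗ[ℂ] (Fin J → ℂ) := LinearMap.proj (⟨b, hbG⟩ : G)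
  have S_zero : ∀ a u, a ∉ G → S a u = 0 := by
    intro a u ha
    funext d
    rw [hS, ex_out]
    · rfl
    · intro h; exact ha (hF' _ h a le_add_self)
  have sumG : ∀ (ψ : (G → Fin J → ℂ) →ₗ[ℂ] EuclideanSpace ℂ (Fin J)) (w : (Fin g → ℕ) → ℝ) u,
      ∑' a, w a * ‖ψ (S a u)‖ ^ 2 = ∑ a ∈ G, w a * ‖ψ (S a u)‖ ^ 2 := by
    intro ψ w u
    refine tsum_eq_sum fun a ha => ?_
    rw [S_zero a u ha]; simp
  have he : ∀ u, ∑' a, ℓ a * ‖e (S a u)‖ ^ 2 = ∑ a ∈ G, ℓ a * ∑ i, ‖ex u a i‖ ^ 2 := by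
    intro u
    rw [sumG]
    refine Finset.sum_congr rfl fun a ha => ?_
    have : e (S a u) = toE (ex u (0 + a)) := rfl
    rw [this, zero_add, toE_norm]
  have hπex : ∀ u, π u = ex u b := fun u => (ex_in u b hbG).symm
  have hbplus : ∀ a u, a ≠ 0 → ex u (b + a) = 0 := by
    intro a u ha
    apply ex_out
    intro h
    rcases Finset.mem_insert.1 h with h | h
    · exact ha (by simpa using h)
    · exact hb (hF _ h b le_self_add)
  obtain ⟨φ', hφ1, hφ2⟩ := one_step hC S (fun u => by
      funext d; rw [hS, add_zero, ex_in u d.1 d.2])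
    (fun a d u => by
      funext x; rw [hS, exS, hS, add_assoc, add_comm d a]) e φ π
    (LinearMap.single ℂ (fun _ : G => Fin J → ℂ) (⟨b, hbG⟩ : G)) (fun w => by simp [π])
    (fun a => if a = 0 then 1 else 0)
    (fun a u => by
      rw [hπex, exS, hπex]
      split_ifs with h
      · rw [h, add_zero, one_smul]
      · rw [hbplus a u h, zero_smul])
    (fun a d => by
      by_cases ha : a = 0 <;> by_cases hd : d = 0 <;> simp [ha, hd])
    (by simp)
    (by
      refine summable_of_ne_finset_zero (s := {0}) fun a ha => ?_
      have : a ≠ 0 := by simpa using ha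
      simp [this])
    (fun f u => by
      refine summable_of_ne_finset_zero (s := G) fun a ha => ?_
      rw [S_zero a u ha]; simp)
    (by
      intro u hu
      rw [he, sumG]
      have hub : ex u b = 0 := by rw [← hπex, hu]
      have hout : ∀ a, a ∉ F → ex u a = 0 := by
        intro a ha
        by_cases h : a = b
        · rw [h, hub]
        · exact ex_out u a (by simp [hG, h, ha])
      have h1 := (contr_iff_shift hk hℓ c hF).1 hc (ex u) hout
      have h2 : ∑ a ∈ G, ℓ a * ∑ i, ‖ex u a i‖ ^ 2 = ∑ a ∈ F, ℓ a * ∑ i, ‖ex u a i‖ ^ 2 := by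
        rw [sI, hub]; simp
      rw [h2]
      refine le_trans (le_of_eq ?_) h1
      have hz : ∀ a i, ∑ d ∈ G, ∑ j, c d i j * ex u (d + a) j = ∑ d ∈ F, ∑ j, c d i j * ex u (d + a) j := by
        intro a i
        rw [sI]
        have : ex u (b + a) = 0 := by
          by_cases ha : a = 0
          · rw [ha, add_zero, hub]
          · exact hbplus a u ha
        rw [this]; simp
      have h3 : ∀ a, ‖φ (S a u)‖ ^ 2 = ∑ i, ‖∑ d ∈ F, ∑ j, c d i j * ex u (d + a) j‖ ^ 2 := by
        intro a
        have : φ (S a u) = toE (∑ d ∈ G, c d *ᵥ ex u (d + a)) := by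
          simp only [φ, LinearMap.comp_apply, LinearMap.sum_apply, mulVecLin_apply, LinearMap.proj_apply, exS]
        rw [this, toE_norm]
        refine Finset.sum_congr rfl fun i _ => ?_
        rw [← hz]
        simp only [Finset.sum_apply, mulVec, dotProduct]
      simp only [h3]
      rw [sI]
      have hz2 : ∀ d ∈ F, ex u (d + b) = 0 := by
        intro d hd
        by_cases hd0 : d = 0
        · rw [hd0, zero_add, hub]
        · rw [add_comm]; exact hbplus d u hd0
      have : ∀ i, ∑ d ∈ F, ∑ j, c d i j * ex u (d + b) j = 0 := by
        intro i
        refine Finset.sum_eq_zero fun d hd => ?_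
        rw [hz2 d hd]; simp
      simp [this])
  let M : Matrix (Fin J) (Fin J) ℂ := fun i j => φ' (Pi.single (⟨b, hbG⟩ : G) (Pi.single j 1)) i
  refine ⟨Function.update c b M, fun a ha => Function.update_of_ne ha _ _, ?_⟩
  rw [contr_iff_shift hk hℓ _ hF']
  intro u hu
  let v : G → Fin J → ℂ := fun d => u d.1
  have hv : ex v = u := by
    funext a
    by_cases h : a ∈ G
    · rw [ex_in v a h]
    · rw [ex_out v a h, hu a h]
  have h1 := hφ2 v
  rw [he, sumG, hv] at h1
  refine le_trans (le_of_eq ?_) h1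
  refine Finset.sum_congr rfl fun a ha => ?_
  congr 1
  rw [EuclideanSpace.norm_sq_eq]
  refine Finset.sum_congr rfl fun i _ => ?_
  congr 2
  -- formula for φ'
  have hform : ∀ w : G → Fin J → ℂ, φ' w i = ∑ d ∈ G, ∑ j, (Function.update c b M) d i j * ex w d j := by
    intro w
    have hw : w = (w - Pi.single (⟨b, hbG⟩ : G) (w ⟨b, hbG⟩)) + Pi.single (⟨b, hbG⟩ : G) (w ⟨b, hbG⟩) := by
      simp
    have hw2 : (w ⟨b, hbG⟩) = ∑ j, w ⟨b, hbG⟩ j • (Pi.single j (1 : ℂ) : Fin J → ℂ) := by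
      funext j
      simp [Finset.sum_apply, Pi.single_apply]
    set w1 := w - Pi.single (⟨b, hbG⟩ : G) (w ⟨b, hbG⟩) with hw1
    have a1 : φ' w1 = φ w1 := hφ1 _ (by simp [π, hw1])
    have a2 : φ' (Pi.single (⟨b, hbG⟩ : G) (w ⟨b, hbG⟩)) i = ∑ j, M i j * w ⟨b, hbG⟩ j := by
      have : (Pi.single (⟨b, hbG⟩ : G) (w ⟨b, hbG⟩) : G → Fin J → ℂ) = ∑ j, w ⟨b, hbG⟩ j • (Pi.single (⟨b, hbG⟩ : G) (Pi.single j (1 : ℂ) : Fin J → ℂ)) := by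
        conv_lhs => rw [hw2]
        have h := map_sum (LinearMap.single ℂ (fun _ : G => Fin J → ℂ) (⟨b, hbG⟩ : G)) (fun j => w ⟨b, hbG⟩ j • (Pi.single j (1 : ℂ) : Fin J → ℂ)) Finset.univ
        simp only [map_smul] at h
        exact h
      rw [this, map_sum]
      simp only [map_smul, WithLp.ofLp_sum, Finset.sum_apply, PiLp.smul_apply, smul_eq_mul]
      refine Finset.sum_congr rfl fun j _ => ?_
      simp only [M]; ring
    have a3 : φ w1 i = ∑ d ∈ F, ∑ j, c d i j * ex w d j := by
      have : φ w1 i = (∑ d ∈ G, c d *ᵥ ex w1 d) i := by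
        simp only [φ, LinearMap.comp_apply, LinearMap.sum_apply, mulVecLin_apply, LinearMap.proj_apply]
        rfl
      rw [this, sI]
      have hb0 : ex w1 b = 0 := by rw [ex_in _ _ hbG]; simp [hw1]
      rw [hb0, mulVec_zero, zero_add, Finset.sum_apply]
      refine Finset.sum_congr rfl fun d hd => ?_
      have hdG : d ∈ G := Finset.mem_insert_of_mem hd
      have hdb : d ≠ b := fun h => hb (h ▸ hd)
      have : ex w1 d = ex w d := by
        rw [ex_in _ _ hdG, ex_in _ _ hdG, hw1, Pi.sub_apply, Pi.single_eq_of_ne, sub_zero]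
        intro h; exact hdb (congrArg Subtype.val h)
      rw [this]; rfl
    rw [hw, map_add, PiLp.add_apply, a1, a2, a3, sI, add_comm]
    rw [← hw]
    congr 1
    · rw [Function.update_self, ex_in _ _ hbG]
    · refine Finset.sum_congr rfl fun d hd => ?_
      have hdb : d ≠ b := fun h => hb (h ▸ hd)
      rw [Function.update_of_ne hdb]
  rw [hform]
  simp only [exS, hv]

lemma contr_mono {kc ℓc : (Fin g → ℕ) → ℝ} (hk : ∀ a, 0 < kc a) (hℓ : ∀ a, 0 < ℓc a) {J : ℕ}
    {c : (Fin g → ℕ) → Matrix (Fin J) (Fin J) ℂ} {S S' : Finset (Fin g → ℕ)} (h : S ⊆ S')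
    (hc : IsContractionMat (caraMatrix kc ℓc c S')) : IsContractionMat (caraMatrix kc ℓc c S) := by
  rw [contr_iff hk hℓ] at *
  intro u
  have h1 := hc (fun a => if a ∈ S then u a else 0)
  have e1 : ∑ b ∈ S', ℓc b * ∑ i, ‖(if b ∈ S then u b else 0) i‖ ^ 2 = ∑ b ∈ S, ℓc b * ∑ i, ‖u b i‖ ^ 2 := by
    rw [← Finset.sum_subset h]
    · exact Finset.sum_congr rfl fun b hb => by rw [if_pos hb]
    · intro b _ hb; simp [hb]
  rw [e1] at h1
  refine le_trans ?_ h1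
  have e2 : ∀ a i, (∑ b ∈ S', if a ≤ b then ∑ j, c (b - a) i j * (if b ∈ S then u b else 0) j else 0)
      = ∑ b ∈ S, if a ≤ b then ∑ j, c (b - a) i j * u b j else 0 := by
    intro a i
    rw [← Finset.sum_subset h]
    · exact Finset.sum_congr rfl fun b hb => by rw [if_pos hb]
    · intro b _ hb; simp [hb]
  simp only [e2]
  refine Finset.sum_le_sum_of_subset_of_nonneg h fun a _ _ => ?_
  exact mul_nonneg (hk a).le (Finset.sum_nonneg fun _ _ => sq_nonneg _)

lemma contr_congr {kc ℓc : (Fin g → ℕ) → ℝ} (hk : ∀ a, 0 < kc a) (hℓ : ∀ a, 0 < ℓc a) {J : ℕ}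
    {c c' : (Fin g → ℕ) → Matrix (Fin J) (Fin J) ℂ} {S : Finset (Fin g → ℕ)} (hS : IsCoinvariant S)
    (h : ∀ a ∈ S, c a = c' a)
    (hc : IsContractionMat (caraMatrix kc ℓc c S)) : IsContractionMat (caraMatrix kc ℓc c' S) := by
  rw [contr_iff_shift hk hℓ _ hS] at *
  intro u hu
  have := hc u hu
  refine le_trans (le_of_eq ?_) this
  refine Finset.sum_congr rfl fun a _ => ?_
  congr 1
  refine Finset.sum_congr rfl fun i _ => ?_
  congr 2
  refine Finset.sum_congr rfl fun d hd => ?_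
  rw [h d hd]

theorem cc_of_coef {k ℓ s m p T : (Fin g → ℕ) → ℝ} (hC : Coef k ℓ s m p T) (hk : ∀ a, 0 < k a)
    (hℓ : ∀ a, 0 < ℓ a) (N : (Fin g → ℕ) → ℕ) (hN : ∀ e b, e < b → N e < N b)
    (hNi : Function.Injective N) (hNf : ∀ n, {a | N a < n}.Finite) : IsCCPair k ℓ := by
  intro J hJ F hF c₀ hc₀
  let Fn : ℕ → Finset (Fin g → ℕ) := fun n => F ∪ (hNf n).toFinset
  have memFn : ∀ n a, a ∈ Fn n ↔ a ∈ F ∨ N a < n := by intro n a; simp [Fn]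
  have hFn : ∀ n, IsCoinvariant (Fn n) := by
    intro n x hx a ha
    rw [memFn] at *
    rcases hx with hx | hx
    · exact Or.inl (hF x hx a ha)
    · right
      rcases ha.eq_or_lt with h | h
      · rwa [h]
      · exact (hN _ _ h).trans hx
  have step : ∀ n (c : (Fin g → ℕ) → Matrix (Fin J) (Fin J) ℂ),
      IsContractionMat (caraMatrix k ℓ c (Fn n)) →
      ∃ c' : (Fin g → ℕ) → Matrix (Fin J) (Fin J) ℂ, (∀ a ∈ Fn n, c' a = c a) ∧
        IsContractionMat (caraMatrix k ℓ c' (Fn (n + 1))) := by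
    intro n c hc
    by_cases hex : ∃ b, N b = n ∧ b ∉ Fn n
    · obtain ⟨b, hbn, hb⟩ := hex
      have hins : Fn (n + 1) = insert b (Fn n) := by
        ext a
        rw [Finset.mem_insert, memFn, memFn, Nat.lt_succ_iff_lt_or_eq]
        constructor
        · rintro (h | h | h)
          · exact Or.inr (Or.inl h)
          · exact Or.inr (Or.inr h)
          · exact Or.inl (hNi (h.trans hbn.symm))
        · rintro (h | h | h)
          · exact Or.inr (Or.inr (h ▸ hbn))
          · exact Or.inl h
          · exact Or.inr (Or.inl h)
      have hco := hFn (n + 1)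
      rw [hins] at hco ⊢
      obtain ⟨c', h1, h2⟩ := cc_step hC hk hℓ (hFn n) hb hco c hc
      exact ⟨c', fun a ha => h1 a (fun h => hb (h ▸ ha)), h2⟩
    · push Not at hex
      have hins : Fn (n + 1) = Fn n := by
        ext a
        rw [memFn, memFn, Nat.lt_succ_iff_lt_or_eq]
        constructor
        · rintro (h | h | h)
          · exact Or.inl h
          · exact Or.inr h
          · exact (memFn n a).1 (hex a h)
        · rintro (h | h)
          · exact Or.inl h
          · exact Or.inr (Or.inl h)
      rw [hins]
      exact ⟨c, fun _ _ => rfl, hc⟩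
  choose! nx hnx1 hnx2 using step
  let cs : ℕ → (Fin g → ℕ) → Matrix (Fin J) (Fin J) ℂ := fun n => Nat.rec c₀ (fun n c => nx n c) n
  have hcs : ∀ n, IsContractionMat (caraMatrix k ℓ (cs n) (Fn n)) := by
    intro n
    induction n with
    | zero =>
      have : Fn 0 = F := by ext a; rw [memFn]; simp
      rw [this]; exact hc₀
    | succ n ih => exact hnx2 n _ ih
  have hstep : ∀ n, ∀ a ∈ Fn n, cs (n + 1) a = cs n a := fun n => hnx1 n _ (hcs n)
  have hmono : ∀ n n', n ≤ n' → ∀ a ∈ Fn n, cs n' a = cs n a := by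
    intro n n' h
    induction n', h using Nat.le_induction with
    | base => intro a _; rfl
    | succ n' h ih =>
      intro a ha
      rw [hstep n' a ?_, ih a ha]
      rw [memFn] at *
      exact ha.imp id (fun h' => lt_of_lt_of_le h' h)
  refine ⟨fun a => cs (N a + 1) a, ?_, ?_⟩
  · intro a ha
    exact hmono 0 (N a + 1) (Nat.zero_le _) a ((memFn _ _).2 (Or.inl ha))
  · intro S
    obtain ⟨n, hn⟩ : ∃ n, ∀ a ∈ S, N a < n := by
      refine ⟨S.sup N + 1, fun a ha => Nat.lt_succ_of_le (Finset.le_sup ha)⟩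
    refine contr_mono hk hℓ (S' := Fn n) (fun a ha => (memFn _ _).2 (Or.inr (hn a ha))) ?_
    refine contr_congr hk hℓ (hFn n) ?_ (hcs n)
    intro a ha
    rcases le_total n (N a + 1) with h | h
    · exact (hmono _ _ h a ha).symm
    · exact hmono _ _ h a ((memFn _ _).2 (Or.inr (Nat.lt_succ_self _)))
end CCstep

section PickForm
variable {g : ℕ}

def pform (k : (Fin g → ℕ) → ℝ) {n N : ℕ} (z : Fin n → Fin g → ℂ) (v : Fin n → Fin N → ℂ) : ℝ :=
  ∑' a, k a * ∑ r, ‖∑ j, (starRingEnd ℂ) (mpow (z j) a) * v j r‖ ^ 2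

lemma ker_summable {k : (Fin g → ℕ) → ℝ} (hk : ∀ a, 0 < k a) {x y : Fin g → ℂ}
    (hx : Summable fun a => k a * ‖mpow x a‖ ^ 2) (hy : Summable fun a => k a * ‖mpow y a‖ ^ 2) :
    Summable fun a => (k a : ℂ) * mpow x a * (starRingEnd ℂ) (mpow y a) := by
  refine Summable.of_norm_bounded (hx.add hy) fun a => ?_
  rw [norm_mul, norm_mul, Complex.norm_real, Real.norm_of_nonneg (hk a).le, RCLike.norm_conj]
  nlinarith [sq_nonneg (‖mpow x a‖ - ‖mpow y a‖), hk a, norm_nonneg (mpow x a), norm_nonneg (mpow y a),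
    mul_nonneg (hk a).le (sq_nonneg (‖mpow x a‖ - ‖mpow y a‖)), mul_nonneg (hk a).le (sq_nonneg (‖mpow x a‖)), mul_nonneg (hk a).le (sq_nonneg (‖mpow y a‖))]

lemma pform_term {n N : ℕ} (κ : ℝ) (p : Fin n → ℂ) (v : Fin n → Fin N → ℂ) :
    ∑ i, ∑ j, ((κ : ℂ) * p i * (starRingEnd ℂ) (p j)) * (star (v i) ⬝ᵥ v j) =
      ((κ * ∑ r, ‖∑ j, (starRingEnd ℂ) (p j) * v j r‖ ^ 2 : ℝ) : ℂ) := by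
  push_cast
  have : ∀ r, ((‖∑ j, (starRingEnd ℂ) (p j) * v j r‖ : ℂ)) ^ 2 =
      ∑ i, ∑ j, p i * (starRingEnd ℂ) (p j) * ((starRingEnd ℂ) (v i r) * v j r) := by
    intro r
    rw [← Complex.conj_mul', map_sum, Finset.sum_mul_sum]
    refine Finset.sum_congr rfl fun i _ => Finset.sum_congr rfl fun j _ => ?_
    simp only [map_mul, Complex.conj_conj]; ring
  simp only [this, Finset.mul_sum]
  symm
  rw [Finset.sum_comm]
  refine Finset.sum_congr rfl fun i _ => ?_
  rw [Finset.sum_comm]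
  refine Finset.sum_congr rfl fun j _ => ?_
  simp only [dotProduct, Finset.mul_sum, Pi.star_apply, RCLike.star_def]
  refine Finset.sum_congr rfl fun r _ => ?_
  ring

lemma pform_hasSum {k : (Fin g → ℕ) → ℝ} (hk : ∀ a, 0 < k a) {n N : ℕ} (z : Fin n → Fin g → ℂ)
    (hz : ∀ i, Summable fun a => k a * ‖mpow (z i) a‖ ^ 2) (v : Fin n → Fin N → ℂ) :
    (Summable fun a => k a * ∑ r, ‖∑ j, (starRingEnd ℂ) (mpow (z j) a) * v j r‖ ^ 2) ∧
    ∑ i, ∑ j, diagKer k (z i) (z j) * (star (v i) ⬝ᵥ v j) = ((pform k z v : ℝ) : ℂ) := by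
  have h1 : HasSum (fun a => ∑ i, ∑ j, ((k a : ℂ) * mpow (z i) a * (starRingEnd ℂ) (mpow (z j) a)) *
      (star (v i) ⬝ᵥ v j)) (∑ i, ∑ j, diagKer k (z i) (z j) * (star (v i) ⬝ᵥ v j)) := by
    refine hasSum_sum fun i _ => hasSum_sum fun j _ => ?_
    exact (ker_summable hk (hz i) (hz j)).hasSum.mul_right _
  simp only [pform_term] at h1
  refine ⟨Complex.summable_ofReal.1 h1.summable, ?_⟩
  rw [← h1.tsum_eq, ← Complex.ofReal_tsum]; rfl

lemma pick_iff {k ℓ : (Fin g → ℕ) → ℝ} (hk : ∀ a, 0 < k a) (hℓ : ∀ a, 0 < ℓ a)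
    {Ω : Set (Fin g → ℂ)} (hks : ∀ x ∈ Ω, Summable fun a => k a * ‖mpow x a‖ ^ 2)
    (hℓs : ∀ x ∈ Ω, Summable fun a => ℓ a * ‖mpow x a‖ ^ 2) {n N : ℕ} (z : Fin n → Ω)
    (W : Fin n → Matrix (Fin N) (Fin N) ℂ) :
    PickBlockPSD (fun z w : Ω => diagKer k ↑z ↑w) (fun z w : Ω => diagKer ℓ ↑z ↑w) z W ↔
      ∀ u : Fin n → Fin N → ℂ, pform k (fun i => (z i : Fin g → ℂ)) (fun j => (W j)ᴴ *ᵥ u j) ≤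
        pform ℓ (fun i => (z i : Fin g → ℂ)) u := by
  unfold PickBlockPSD
  refine forall_congr' fun u => ?_
  have e : ∑ i, ∑ j, star (u i) ⬝ᵥ ((diagKer ℓ (z i) (z j) • (1 : Matrix (Fin N) (Fin N) ℂ)
        - diagKer k (z i) (z j) • (W i * (W j)ᴴ)) *ᵥ u j) =
      ((pform ℓ (fun i => (z i : Fin g → ℂ)) u -
        pform k (fun i => (z i : Fin g → ℂ)) (fun j => (W j)ᴴ *ᵥ u j) : ℝ) : ℂ) := by
    rw [Complex.ofReal_sub, ← (pform_hasSum hk _ (fun i => hks _ (z i).2) _).2,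
      ← (pform_hasSum hℓ _ (fun i => hℓs _ (z i).2) _).2, ← Finset.sum_sub_distrib]
    refine Finset.sum_congr rfl fun i _ => ?_
    rw [← Finset.sum_sub_distrib]
    refine Finset.sum_congr rfl fun j _ => ?_
    rw [sub_mulVec, smul_mulVec, smul_mulVec, one_mulVec, dotProduct_sub, dotProduct_smul,
      dotProduct_smul, ← mulVec_mulVec, dotProduct_mulVec _ (W i), star_mulVec, conjTranspose_conjTranspose]
    rfl
  simp only [e]
  rw [Complex.zero_le_real, sub_nonneg]

lemma pick_reindex {k ℓ : (Fin g → ℕ) → ℝ} (hk : ∀ a, 0 < k a) (hℓ : ∀ a, 0 < ℓ a)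
    {Ω : Set (Fin g → ℂ)} (hks : ∀ x ∈ Ω, Summable fun a => k a * ‖mpow x a‖ ^ 2)
    (hℓs : ∀ x ∈ Ω, Summable fun a => ℓ a * ‖mpow x a‖ ^ 2) {n n' N : ℕ} (z : Fin n → Ω)
    (W : Fin n → Matrix (Fin N) (Fin N) ℂ) (σ : Fin n' → Fin n)
    (h : PickBlockPSD (fun z w : Ω => diagKer k ↑z ↑w) (fun z w : Ω => diagKer ℓ ↑z ↑w) z W) :
    PickBlockPSD (fun z w : Ω => diagKer k ↑z ↑w) (fun z w : Ω => diagKer ℓ ↑z ↑w)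
      (fun i => z (σ i)) (fun i => W (σ i)) := by
  rw [pick_iff hk hℓ hks hℓs] at *
  intro u
  have h1 := h (fun j => ∑ i with σ i = j, u i)
  have key : ∀ (w : (Fin g → ℕ) → ℝ) (B : Fin n → Matrix (Fin N) (Fin N) ℂ),
      pform w (fun i => (z i : Fin g → ℂ)) (fun j => B j *ᵥ ∑ i with σ i = j, u i)
      = pform w (fun i => (z (σ i) : Fin g → ℂ)) (fun i => B (σ i) *ᵥ u i) := by
    intro w B
    unfold pform
    refine tsum_congr fun a => ?_
    congr 1
    refine Finset.sum_congr rfl fun r _ => ?_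
    congr 2
    rw [← Finset.sum_fiberwise Finset.univ σ]
    refine Finset.sum_congr rfl fun j _ => ?_
    have : (B j *ᵥ ∑ i with σ i = j, u i) = ∑ i with σ i = j, B j *ᵥ u i := by
      exact map_sum (B j).mulVecLin _ _
    beta_reduce
    rw [this, Finset.sum_apply, Finset.mul_sum]
    refine Finset.sum_congr rfl fun i hi => ?_
    rw [(Finset.mem_filter.1 hi).2]
  rw [key k (fun j => (W j)ᴴ)] at h1
  have h2 := key ℓ (fun j => 1)
  simp only [one_mulVec] at h2
  rw [h2] at h1
  exact h1

lemma mpow_zero (x : Fin g → ℂ) : mpow x 0 = 1 := by simp [mpow]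
lemma mpow_add (x : Fin g → ℂ) (a b) : mpow x (a + b) = mpow x a * mpow x b := by
  simp [mpow, pow_add, Finset.prod_mul_distrib]

lemma pick_consistent {k ℓ : (Fin g → ℕ) → ℝ} (hk : ∀ a, 0 < k a) (hℓ : ∀ a, 0 < ℓ a)
    {Ω : Set (Fin g → ℂ)} (hks : ∀ x ∈ Ω, Summable fun a => k a * ‖mpow x a‖ ^ 2)
    (hℓs : ∀ x ∈ Ω, Summable fun a => ℓ a * ‖mpow x a‖ ^ 2) {n N : ℕ} (z : Fin n → Ω)
    (W : Fin n → Matrix (Fin N) (Fin N) ℂ)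
    (h : PickBlockPSD (fun z w : Ω => diagKer k ↑z ↑w) (fun z w : Ω => diagKer ℓ ↑z ↑w) z W)
    (i j : Fin n) (hij : z i = z j) : W i = W j := by
  have h2 := pick_reindex hk hℓ hks hℓs z W (![i, j] : Fin 2 → Fin n) h
  rw [pick_iff hk hℓ hks hℓs] at h2
  have hv : ∀ v : Fin N → ℂ, (W i)ᴴ *ᵥ v = (W j)ᴴ *ᵥ v := by
    intro v
    have h3 := h2 (![v, -v] : Fin 2 → Fin N → ℂ)
    have e0 : pform ℓ (fun t : Fin 2 => (z ((![i, j] : Fin 2 → Fin n) t) : Fin g → ℂ)) (![v, -v] : Fin 2 → Fin N → ℂ) = 0 := by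
      unfold pform
      simp [Fin.sum_univ_two, hij]
    rw [e0] at h3
    have hs := (pform_hasSum hk (fun t : Fin 2 => (z ((![i, j] : Fin 2 → Fin n) t) : Fin g → ℂ))
      (fun t => hks _ (z _).2) (fun t => (W ((![i, j] : Fin 2 → Fin n) t))ᴴ *ᵥ (![v, -v] : Fin 2 → Fin N → ℂ) t)).1
    have h4 := hs.le_tsum 0 (fun a _ => mul_nonneg (hk a).le (Finset.sum_nonneg fun _ _ => sq_nonneg _))
    have h5 := h4.trans h3
    simp only [Fin.sum_univ_two, mpow_zero, map_one, one_mul, Matrix.cons_val_zero, Matrix.cons_val_one, mulVec_neg, Pi.neg_apply] at h5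
    have h6 : ∑ r, ‖((W i)ᴴ *ᵥ v) r + -((W j)ᴴ *ᵥ v) r‖ ^ 2 ≤ 0 := by
      by_contra hc
      push Not at hc
      exact absurd h5 (not_le.2 (mul_pos (hk 0) hc))
    have h7 := (Finset.sum_eq_zero_iff_of_nonneg (fun r _ => sq_nonneg _)).1
      (le_antisymm h6 (Finset.sum_nonneg fun _ _ => sq_nonneg _))
    funext r
    have := h7 r (Finset.mem_univ _)
    rw [sq_eq_zero_iff, norm_eq_zero, ← sub_eq_add_neg, sub_eq_zero] at this
    exact this
  have : (W i)ᴴ = (W j)ᴴ := by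
    apply Matrix.mulVec_injective
    funext v; exact hv v
  exact conjTranspose_injective this

lemma pick_bound {k ℓ : (Fin g → ℕ) → ℝ} (hk : ∀ a, 0 < k a) (hk0 : k 0 = 1) (hℓ : ∀ a, 0 < ℓ a)
    {Ω : Set (Fin g → ℂ)} (hks : ∀ x ∈ Ω, Summable fun a => k a * ‖mpow x a‖ ^ 2)
    (hℓs : ∀ x ∈ Ω, Summable fun a => ℓ a * ‖mpow x a‖ ^ 2) {n N : ℕ} (z : Fin n → Ω)
    (W : Fin n → Matrix (Fin N) (Fin N) ℂ)
    (h : PickBlockPSD (fun z w : Ω => diagKer k ↑z ↑w) (fun z w : Ω => diagKer ℓ ↑z ↑w) z W)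
    (i : Fin n) (r t : Fin N) : ‖W i r t‖ ≤ Real.sqrt (∑' a, ℓ a * ‖mpow (z i) a‖ ^ 2) := by
  have h2 := pick_reindex hk hℓ hks hℓs z W (fun _ : Fin 1 => i) h
  rw [pick_iff hk hℓ hks hℓs] at h2
  have h3 := h2 (fun _ => Pi.single r 1)
  have hs := (pform_hasSum hk (fun _ : Fin 1 => (z i : Fin g → ℂ))
      (fun t => hks _ (z _).2) (fun _ => (W i)ᴴ *ᵥ Pi.single r 1)).1
  have h4 := hs.le_tsum 0 (fun a _ => mul_nonneg (hk a).le (Finset.sum_nonneg fun _ _ => sq_nonneg _))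
  have h5 := h4.trans h3
  apply Real.le_sqrt_of_sq_le
  have e1 : pform ℓ (fun _ : Fin 1 => (z i : Fin g → ℂ)) (fun _ => (Pi.single r 1 : Fin N → ℂ))
      = ∑' a, ℓ a * ‖mpow (z i) a‖ ^ 2 := by
    unfold pform
    refine tsum_congr fun a => ?_
    congr 1
    rw [Finset.sum_eq_single r]
    · simp
    · intro b _ hb; simp [hb]
    · simp
  rw [e1] at h5
  refine le_trans ?_ h5
  rw [hk0, one_mul]
  refine le_trans (le_of_eq ?_) (Finset.single_le_sum (fun _ _ => sq_nonneg _) (Finset.mem_univ t))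
  simp [mpow_zero, conjTranspose_apply]
end PickForm

section PickStep
variable {g : ℕ}

lemma pick_step {k ℓ s m p T : (Fin g → ℕ) → ℝ} (hC : Coef k ℓ s m p T) (hk : ∀ a, 0 < k a)
    (hℓ : ∀ a, 0 < ℓ a)
    {Ω : Set (Fin g → ℂ)} (hks : ∀ x ∈ Ω, Summable fun a => k a * ‖mpow x a‖ ^ 2)
    (hℓs : ∀ x ∈ Ω, Summable fun a => ℓ a * ‖mpow x a‖ ^ 2) {n N : ℕ} (z : Fin (n + 1) → Ω)
    (W : Fin n → Matrix (Fin N) (Fin N) ℂ)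
    (h : PickBlockPSD (fun z w : Ω => diagKer k ↑z ↑w) (fun z w : Ω => diagKer ℓ ↑z ↑w)
      (fun i => z i.succ) W) :
    ∃ M : Matrix (Fin N) (Fin N) ℂ,
      PickBlockPSD (fun z w : Ω => diagKer k ↑z ↑w) (fun z w : Ω => diagKer ℓ ↑z ↑w)
        z (Fin.cons M W) := by
  simp only [pick_iff hk hℓ hks hℓs] at *
  let toE := (WithLp.linearEquiv 2 ℂ (Fin N → ℂ)).symm.toLinearMap
  have toE_norm : ∀ v, ‖toE v‖ ^ 2 = ∑ i, ‖v i‖ ^ 2 := fun v => EuclideanSpace.norm_sq_eq _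
  let q : Fin (n + 1) → (Fin g → ℕ) → ℂ := fun i a => (starRingEnd ℂ) (mpow (z i) a)
  let S : (Fin g → ℕ) → (Fin (n + 1) → Fin N → ℂ) →ₗ[ℂ] (Fin (n + 1) → Fin N → ℂ) := fun a =>
    LinearMap.pi fun i => q i a • LinearMap.proj i
  have hS : ∀ a u i, S a u i = q i a • u i := fun a u i => rfl
  let e : (Fin (n + 1) → Fin N → ℂ) →ₗ[ℂ] EuclideanSpace ℂ (Fin N) :=
    toE ∘ₗ ∑ i, LinearMap.proj i
  let V : Fin (n + 1) → Matrix (Fin N) (Fin N) ℂ := Fin.cons 0 W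
  let φ : (Fin (n + 1) → Fin N → ℂ) →ₗ[ℂ] EuclideanSpace ℂ (Fin N) :=
    toE ∘ₗ ∑ i, (V i)ᴴ.mulVecLin ∘ₗ LinearMap.proj i
  let π : (Fin (n + 1) → Fin N → ℂ) →ₗ[ℂ] (Fin N → ℂ) := LinearMap.proj 0
  have he : ∀ u, ∑' a, ℓ a * ‖e (S a u)‖ ^ 2 = pform ℓ (fun i => (z i : Fin g → ℂ)) u := by
    intro u
    refine tsum_congr fun a => ?_
    have : e (S a u) = toE (∑ i, q i a • u i) := by
      simp only [e, LinearMap.comp_apply, LinearMap.sum_apply, LinearMap.proj_apply, hS]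
    rw [this, toE_norm]
    simp only [Finset.sum_apply, Pi.smul_apply, smul_eq_mul, q]
  have hφS : ∀ u (r : Fin N), φ u r = ∑ i, ((V i)ᴴ *ᵥ u i) r := by
    intro u r
    have : φ u = toE (∑ i, (V i)ᴴ *ᵥ u i) := by
      simp only [φ, LinearMap.comp_apply, LinearMap.sum_apply, LinearMap.proj_apply, mulVecLin_apply]
    rw [this, ← Finset.sum_apply]; rfl
  obtain ⟨φ', hφ1, hφ2⟩ := one_step hC S (fun u => by
      funext i; rw [hS]; simp [q, mpow_zero])
    (fun a d u => by
      funext i; rw [hS, hS, hS, smul_smul]; congr 1; simp only [q, mpow_add, map_mul]; ring) e φ π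
    (LinearMap.single ℂ (fun _ : Fin (n + 1) => Fin N → ℂ) 0) (fun w => by simp [π])
    (fun a => q 0 a) (fun a u => hS a u 0)
    (fun a d => by simp only [q, mpow_add, map_mul, norm_mul])
    (by simp [q, mpow_zero])
    (by
      have := hℓs _ (z 0).2
      simpa [q] using this)
    (fun f u => by
      have h1 := (pform_hasSum hℓ (N := 1) (fun i => (z i : Fin g → ℂ)) (fun i => hℓs _ (z i).2)
        (fun i _ => f (Pi.single i (u i)))).1
      refine h1.congr fun a => ?_
      congr 1
      simp only [Finset.univ_unique, Finset.sum_singleton]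
      congr 2
      have : S a u = ∑ i, q i a • (Pi.single i (u i) : Fin (n + 1) → Fin N → ℂ) := by
        funext i
        rw [hS, Finset.sum_apply, Finset.sum_eq_single i]
        · simp
        · intro j _ hj; simp [Pi.single_eq_of_ne hj.symm]
        · simp
      rw [this, map_sum]
      simp only [map_smul, smul_eq_mul]; rfl)
    (by
      intro u hu
      have hu0 : u 0 = 0 := hu
      rw [he]
      have h1 := h (fun i => u i.succ)
      have e1 : pform ℓ (fun i => (z i : Fin g → ℂ)) u = pform ℓ (fun i => (z (Fin.succ i) : Fin g → ℂ)) (fun i => u i.succ) := by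
        unfold pform
        simp only [Fin.sum_univ_succ, hu0, Pi.zero_apply, mul_zero, zero_add]
      rw [e1]
      refine le_trans (le_of_eq ?_) h1
      refine tsum_congr fun a => ?_
      congr 1
      rw [EuclideanSpace.norm_sq_eq]
      refine Finset.sum_congr rfl fun r _ => ?_
      congr 2
      rw [hφS, Fin.sum_univ_succ, hS, hu0]
      simp only [smul_zero, mulVec_zero, Pi.zero_apply, zero_add]
      refine Finset.sum_congr rfl fun i _ => ?_
      rw [hS, mulVec_smul]; rfl)
  let M : Matrix (Fin N) (Fin N) ℂ := fun i j => φ' (Pi.single 0 (Pi.single j 1)) i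
  refine ⟨Mᴴ, fun u => ?_⟩
  have h1 := hφ2 u
  rw [he] at h1
  refine le_trans (le_of_eq ?_) h1
  refine tsum_congr fun a => ?_
  congr 1
  rw [EuclideanSpace.norm_sq_eq]
  refine Finset.sum_congr rfl fun i _ => ?_
  congr 2
  have hform : ∀ w : Fin (n + 1) → Fin N → ℂ, φ' w i = (M *ᵥ w 0) i + ∑ d, ((W d)ᴴ *ᵥ w d.succ) i := by
    intro w
    have hw : w = (w - Pi.single 0 (w 0)) + Pi.single 0 (w 0) := by simp
    have hw2 : w 0 = ∑ j, w 0 j • (Pi.single j (1 : ℂ) : Fin N → ℂ) := by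
      funext j
      simp [Finset.sum_apply, Pi.single_apply]
    set w1 := w - Pi.single 0 (w 0) with hw1
    have a1 : φ' w1 = φ w1 := hφ1 _ (by simp [π, hw1])
    have a2 : φ' (Pi.single 0 (w 0)) i = (M *ᵥ w 0) i := by
      have : (Pi.single 0 (w 0) : Fin (n + 1) → Fin N → ℂ) = ∑ j, w 0 j • (Pi.single 0 (Pi.single j (1 : ℂ) : Fin N → ℂ)) := by
        conv_lhs => rw [hw2]
        have h := map_sum (LinearMap.single ℂ (fun _ : Fin (n + 1) => Fin N → ℂ) 0) (fun j => w 0 j • (Pi.single j (1 : ℂ) : Fin N → ℂ)) Finset.univ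
        simp only [map_smul] at h
        exact h
      rw [this, map_sum]
      simp only [map_smul, WithLp.ofLp_sum, Finset.sum_apply, PiLp.smul_apply, smul_eq_mul, mulVec, dotProduct]
      refine Finset.sum_congr rfl fun j _ => ?_
      simp only [M]; ring
    have a3 : φ w1 i = ∑ d, ((W d)ᴴ *ᵥ w d.succ) i := by
      rw [hφS, Fin.sum_univ_succ]
      have : w1 0 = 0 := by simp [hw1]
      rw [this, mulVec_zero, Pi.zero_apply, zero_add]
      refine Finset.sum_congr rfl fun d _ => ?_
      have : w1 d.succ = w d.succ := by simp [hw1]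
      rw [this]; rfl
    conv_lhs => rw [hw, map_add, PiLp.add_apply, a1, a2, a3, add_comm]
  rw [hform, Fin.sum_univ_succ]
  simp only [Fin.cons_zero, Fin.cons_succ, conjTranspose_conjTranspose, hS, mulVec_smul]
  rfl
end PickStep

section PickLimit
variable {g : ℕ}

lemma pick_finite {k ℓ s m p T : (Fin g → ℕ) → ℝ} (hC : Coef k ℓ s m p T) (hk : ∀ a, 0 < k a)
    (hℓ : ∀ a, 0 < ℓ a)
    {Ω : Set (Fin g → ℂ)} (hks : ∀ x ∈ Ω, Summable fun a => k a * ‖mpow x a‖ ^ 2)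
    (hℓs : ∀ x ∈ Ω, Summable fun a => ℓ a * ‖mpow x a‖ ^ 2) {n N : ℕ} (z : Fin n → Ω)
    (W : Fin n → Matrix (Fin N) (Fin N) ℂ)
    (h : PickBlockPSD (fun z w : Ω => diagKer k ↑z ↑w) (fun z w : Ω => diagKer ℓ ↑z ↑w) z W)
    (Λ : Finset Ω) :
    ∃ Φ : Ω → Matrix (Fin N) (Fin N) ℂ, (∀ i, Φ (z i) = W i) ∧ ∃ (n' : ℕ) (z' : Fin n' → Ω),
      PickBlockPSD (fun z w : Ω => diagKer k ↑z ↑w) (fun z w : Ω => diagKer ℓ ↑z ↑w) z'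
        (fun i => Φ (z' i)) ∧ (∀ x ∈ Λ, x ∈ Set.range z') ∧ ∀ i, z i ∈ Set.range z' := by
  induction Λ using Finset.induction_on with
  | empty =>
    let Φ : Ω → Matrix (Fin N) (Fin N) ℂ := fun x => if h : ∃ i, z i = x then W h.choose else 0
    have hΦ : ∀ i, Φ (z i) = W i := by
      intro i
      have hex : ∃ j, z j = z i := ⟨i, rfl⟩
      simp only [Φ, dif_pos hex]
      exact pick_consistent hk hℓ hks hℓs z W h _ _ hex.choose_spec
    refine ⟨Φ, hΦ, n, z, ?_, by simp, fun i => ⟨i, rfl⟩⟩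
    simpa only [hΦ] using h
  | insert x Λ _ ih =>
    obtain ⟨Φ, hΦ, n', z', hP, h1, h2⟩ := ih
    by_cases hx : x ∈ Set.range z'
    · refine ⟨Φ, hΦ, n', z', hP, ?_, h2⟩
      intro y hy
      rcases Finset.mem_insert.1 hy with rfl | hy
      · exact hx
      · exact h1 y hy
    · obtain ⟨M, hM⟩ := pick_step hC hk hℓ hks hℓs (Fin.cons x z' : Fin (n' + 1) → Ω)
        (fun i => Φ (z' i)) (by simpa only [Fin.cons_succ] using hP)
      have hne : ∀ i, z' i ≠ x := fun i hi => hx ⟨i, hi⟩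
      refine ⟨Function.update Φ x M, ?_, n' + 1, Fin.cons x z', ?_, ?_, ?_⟩
      · intro i
        obtain ⟨j, hj⟩ := h2 i
        rw [Function.update_of_ne (by rw [← hj]; exact hne j), hΦ]
      · convert hM using 1
        funext i
        refine Fin.cases ?_ (fun i => ?_) i
        · simp
        · simp [Function.update_of_ne (hne i)]
      · intro y hy
        rcases Finset.mem_insert.1 hy with rfl | hy
        · exact ⟨0, rfl⟩
        · obtain ⟨j, hj⟩ := h1 y hy
          exact ⟨j.succ, by simpa using hj⟩
      · intro i
        obtain ⟨j, hj⟩ := h2 i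
        exact ⟨j.succ, by simpa using hj⟩

lemma psd_tendsto {X ι : Type*} {k ℓ : X → X → ℂ} {m N : ℕ} (y : Fin m → X) {F : Filter ι} [F.NeBot]
    (A : ι → Fin m → Matrix (Fin N) (Fin N) ℂ) (B : Fin m → Matrix (Fin N) (Fin N) ℂ)
    (h : ∀ i, Filter.Tendsto (fun t => A t i) F (nhds (B i)))
    (hP : ∀ᶠ t in F, PickBlockPSD k ℓ y (A t)) : PickBlockPSD k ℓ y B := by
  intro u
  have hcont : ∀ (x w : ℂ) (p q : Fin N → ℂ), Continuous fun AB : Matrix (Fin N) (Fin N) ℂ × Matrix (Fin N) (Fin N) ℂ =>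
      p ⬝ᵥ ((x • (1 : Matrix (Fin N) (Fin N) ℂ) - w • (AB.1 * AB.2ᴴ)) *ᵥ q) := by
    intro x w p q
    have h1 : Continuous fun AB : Matrix (Fin N) (Fin N) ℂ × Matrix (Fin N) (Fin N) ℂ =>
       x • (1 : Matrix (Fin N) (Fin N) ℂ) - w • (AB.1 * AB.2ᴴ) :=
      continuous_const.sub ((continuous_fst.matrix_mul continuous_snd.matrix_conjTranspose).const_smul w)
    have h2 : Continuous fun AB : Matrix (Fin N) (Fin N) ℂ × Matrix (Fin N) (Fin N) ℂ =>
       (x • (1 : Matrix (Fin N) (Fin N) ℂ) - w • (AB.1 * AB.2ᴴ)) *ᵥ q :=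
      Continuous.matrix_mulVec h1 (continuous_const (y := q))
    have h3 : Continuous fun v : Fin N → ℂ => p ⬝ᵥ v := by
      unfold dotProduct; fun_prop
    exact Continuous.comp (g := fun v : Fin N → ℂ => p ⬝ᵥ v) h3 h2
  have hT : ∀ i j, Filter.Tendsto (fun t => star (u i) ⬝ᵥ ((ℓ (y i) (y j) • (1 : Matrix (Fin N) (Fin N) ℂ)
        - k (y i) (y j) • (A t i * (A t j)ᴴ)) *ᵥ u j)) F (nhds (star (u i) ⬝ᵥ ((ℓ (y i) (y j) • (1 : Matrix (Fin N) (Fin N) ℂ)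
        - k (y i) (y j) • (B i * (B j)ᴴ)) *ᵥ u j))) := by
    intro i j
    have hh := Filter.Tendsto.comp ((hcont (ℓ (y i) (y j)) (k (y i) (y j)) (star (u i)) (u j)).tendsto (B i, B j)) ((h i).prodMk_nhds (h j))
    exact hh
  refine ge_of_tendsto (tendsto_finsetSum _ fun i _ => tendsto_finsetSum _ fun j _ => hT i j) ?_
  filter_upwards [hP] with t ht
  exact ht u

lemma pick_of_coef {k ℓ s m p T : (Fin g → ℕ) → ℝ} (hC : Coef k ℓ s m p T) (hk0 : k 0 = 1) (hk : ∀ a, 0 < k a)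
    (hℓ : ∀ a, 0 < ℓ a)
    {Ω : Set (Fin g → ℂ)} (hks : ∀ x ∈ Ω, Summable fun a => k a * ‖mpow x a‖ ^ 2)
    (hℓs : ∀ x ∈ Ω, Summable fun a => ℓ a * ‖mpow x a‖ ^ 2) :
    IsCompletePickPair (fun z w : Ω => diagKer k ↑z ↑w) (fun z w : Ω => diagKer ℓ ↑z ↑w) := by
  intro n N _ _ z W h
  choose Φ hΦ n' z' hP h1 _ using fun Λ => pick_finite hC hk hℓ hks hℓs z W h Λ
  let F : Ultrafilter (Finset Ω) := Ultrafilter.of Filter.atTop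
  have hF : (F : Filter (Finset Ω)) ≤ Filter.atTop := Ultrafilter.of_le _
  have hlim : ∀ x r t, ∃ y, Filter.Tendsto (fun Λ => Φ Λ x r t) F (nhds y) := by
    intro x r t
    let R := Real.sqrt (∑' a, ℓ a * ‖mpow (x : Fin g → ℂ) a‖ ^ 2)
    have hc : IsCompact (Metric.closedBall (0 : ℂ) R) := isCompact_closedBall _ _
    have hle : (F.map (fun Λ => Φ Λ x r t) : Filter ℂ) ≤ Filter.principal (Metric.closedBall (0 : ℂ) R) := by
      rw [Filter.le_principal_iff, Ultrafilter.coe_map, Filter.mem_map]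
      apply hF
      filter_upwards [Filter.mem_atTop ({x} : Finset Ω)] with Λ hΛ
      obtain ⟨i, hi⟩ := h1 Λ x (hΛ (by simp))
      have := pick_bound hk hk0 hℓ hks hℓs (z' Λ) _ (hP Λ) i r t
      rw [hi] at this
      simpa [R] using this
    obtain ⟨y, _, hy⟩ := hc.ultrafilter_le_nhds _ hle
    exact ⟨y, hy⟩
  choose Ψ hΨ using hlim
  have hΨ' : ∀ x, Filter.Tendsto (fun Λ => Φ Λ x) F (nhds (Matrix.of (Ψ x))) := by
    intro x
    exact tendsto_pi_nhds.2 fun r => tendsto_pi_nhds.2 fun t => hΨ x r t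
  refine ⟨fun x => Matrix.of (Ψ x), ?_, ?_⟩
  · intro m y
    refine psd_tendsto y (fun Λ i => Φ Λ (y i)) _ (fun i => hΨ' (y i)) ?_
    apply hF
    filter_upwards [Filter.mem_atTop (Finset.univ.image y)] with Λ hΛ
    have : ∀ i, ∃ j, z' Λ j = y i := fun i => h1 Λ (y i) (hΛ (by simp))
    choose σ hσ using this
    have h3 := pick_reindex hk hℓ hks hℓs (z' Λ) _ σ (hP Λ)
    simp only [hσ] at h3
    exact h3
  · intro i
    refine tendsto_nhds_unique (hΨ' (z i)) ?_
    simp only [hΦ]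
    exact tendsto_const_nhds
end PickLimit

section Unisolv
variable {g : ℕ}

def mon (e n : Fin g → ℕ) : ℂ := ∏ i, ((n i : ℂ) + 1) ^ e i

def dpoly (m : ℕ) : Polynomial ℂ := ∏ s ∈ Finset.range m, (Polynomial.X - Polynomial.C ((s : ℂ) + 1))

lemma dpoly_monic (m : ℕ) : (dpoly m).Monic := Polynomial.monic_prod_of_monic _ _ fun s _ => Polynomial.monic_X_sub_C _

lemma dpoly_deg (m : ℕ) : (dpoly m).natDegree = m := by
  unfold dpoly
  rw [Polynomial.natDegree_prod_of_monic _ _ fun s _ => Polynomial.monic_X_sub_C _]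
  simp only [Polynomial.natDegree_X_sub_C]
  simp

lemma dpoly_eval (m n : ℕ) : (dpoly m).eval ((n : ℂ) + 1) = 0 ↔ n < m := by
  unfold dpoly
  rw [Polynomial.eval_prod, Finset.prod_eq_zero_iff]
  simp only [Finset.mem_range, Polynomial.eval_sub, Polynomial.eval_X, Polynomial.eval_C, add_sub_add_right_eq_sub, sub_eq_zero]
  constructor
  · rintro ⟨a, ha, h⟩
    have : n = a := by exact_mod_cast h
    omega
  · intro h; exact ⟨n, h, rfl⟩

lemma dpoly_zero (m : ℕ) : (dpoly m).coeff 0 ≠ 0 := by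
  rw [Polynomial.coeff_zero_eq_eval_zero]
  unfold dpoly
  rw [Polynomial.eval_prod, Finset.prod_ne_zero_iff]
  intro s _
  simp only [Polynomial.eval_sub, Polynomial.eval_X, Polynomial.eval_C, zero_sub, ne_eq, neg_eq_zero]
  exact_mod_cast Nat.succ_ne_zero s

def dcoef (m e : Fin g → ℕ) : ℂ := ∏ i, (dpoly (m i)).coeff (e i)
def dval (m n : Fin g → ℕ) : ℂ := ∏ i, (dpoly (m i)).eval ((n i : ℂ) + 1)

lemma dval_eq (m n : Fin g → ℕ) : dval m n = ∑ e ∈ Finset.Iic m, dcoef m e * mon e n := by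
  unfold dval
  have : ∀ i, (dpoly (m i)).eval ((n i : ℂ) + 1) = ∑ e ∈ Finset.Iic (m i), (dpoly (m i)).coeff e * ((n i : ℂ) + 1) ^ e := by
    intro i
    rw [Polynomial.eval_eq_sum_range, dpoly_deg]
    refine Finset.sum_congr ?_ fun _ _ => rfl
    ext x; simp
  simp only [this]
  rw [Finset.prod_univ_sum]
  refine Finset.sum_congr ?_ fun e _ => ?_
  · ext x; simp [Pi.le_def]
  · rw [Finset.prod_mul_distrib]; rfl

lemma dcoef_self (m : Fin g → ℕ) : dcoef m m = 1 := by
  unfold dcoef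
  refine Finset.prod_eq_one fun i _ => ?_
  have := (dpoly_monic (m i)).coeff_natDegree
  rwa [dpoly_deg] at this

lemma dcoef_zero (m : Fin g → ℕ) : dcoef m 0 ≠ 0 := by
  unfold dcoef
  exact Finset.prod_ne_zero_iff.2 fun i _ => dpoly_zero _

lemma dval_zero (m n : Fin g → ℕ) : dval m n = 0 ↔ ¬ m ≤ n := by
  unfold dval
  rw [Finset.prod_eq_zero_iff]
  simp [dpoly_eval, Pi.le_def]

def ut {M : ℕ} (n : Fin M → Fin g → ℕ) (u : Fin M → ℂ) (d : Fin g → ℕ) : ℂ := ∑ j, mon d (n j) * u j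

lemma ut_dval {M : ℕ} (n : Fin M → Fin g → ℕ) (u : Fin M → ℂ) (m : Fin g → ℕ) :
    ∑ e ∈ Finset.Iic m, dcoef m e * ut n u e = ∑ j, dval m (n j) * u j := by
  simp only [dval_eq, ut, Finset.mul_sum, Finset.sum_mul]
  rw [Finset.sum_comm]
  refine Finset.sum_congr rfl fun j _ => Finset.sum_congr rfl fun e _ => by ring

def utL {M : ℕ} (n : Fin M → Fin g → ℕ) : (Fin M → ℂ) →ₗ[ℂ] (Fin M → ℂ) where
  toFun u i := ut n u (n i)
  map_add' u v := by funext i; simp [ut, mul_add, Finset.sum_add_distrib]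
  map_smul' c v := by
    funext i; simp only [ut, Pi.smul_apply, smul_eq_mul, Finset.mul_sum, RingHom.id_apply]
    exact Finset.sum_congr rfl fun j _ => by ring

lemma utL_inj {M : ℕ} (N : (Fin g → ℕ) → ℕ) (hN : ∀ e b, e < b → N e < N b)
    (B : ℕ) (n : Fin M → Fin g → ℕ) (hn : Function.Injective n) (hr : ∀ a, a ∈ Set.range n ↔ N a < B) :
    Function.Injective (utL n) := by
  rw [← LinearMap.ker_eq_bot, LinearMap.ker_eq_bot']
  intro u hu
  by_contra hne
  obtain ⟨j0, hj0⟩ : ∃ j, u j ≠ 0 := by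
    by_contra h; push Not at h; exact hne (funext h)
  obtain ⟨j, hj, hmax⟩ := (Finset.univ.filter fun j => u j ≠ 0).exists_max_image (fun j => N (n j)) ⟨j0, by simpa using hj0⟩
  have hN' : ∀ e b, e ≤ b → N e ≤ N b := fun e b h => (eq_or_lt_of_le h).elim (fun h => h ▸ le_rfl) (fun h => (hN _ _ h).le)
  have h1 := ut_dval n u (n j)
  rw [Finset.sum_eq_zero, Finset.sum_eq_single j] at h1
  · have h2 : dval (n j) (n j) ≠ 0 := by rw [ne_eq, dval_zero]; simp
    exact (Finset.mem_filter.1 hj).2 ((mul_eq_zero.1 h1.symm).resolve_left h2)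
  · intro i _ hi
    by_cases hui : u i = 0
    · rw [hui, mul_zero]
    · have := hmax i (by simpa using hui)
      rw [(dval_zero _ _).2, zero_mul]
      intro hle
      have hlt : n j < n i := lt_of_le_of_ne hle (fun h => hi (hn h.symm))
      have := hN _ _ hlt
      omega
  · simp
  · intro e he
    have : N e < B := lt_of_le_of_lt (hN' _ _ (Finset.mem_Iic.1 he)) ((hr _).1 ⟨j, rfl⟩)
    obtain ⟨i, hi⟩ := (hr e).2 this
    have h3 : ut n u (n i) = 0 := congrFun hu i
    rw [← hi, h3, mul_zero]

lemma ut_bound {M : ℕ} (n : Fin M → Fin g → ℕ) (hi : Function.Injective (utL n)) :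
    ∃ C : ℝ, 0 ≤ C ∧ ∀ u, (∑ j, ‖u j‖) ^ 2 ≤ C * ∑ i, ‖ut n u (n i)‖ ^ 2 := by
  obtain ⟨K, hK, hanti⟩ := LinearMap.exists_antilipschitzWith (utL n) (LinearMap.ker_eq_bot.2 hi)
  refine ⟨(M * K) ^ 2, by positivity, fun u => ?_⟩
  have h1 : ‖u‖ ≤ K * ‖utL n u‖ := by
    have := hanti.le_mul_dist u 0
    simpa using this
  have h2 : ∑ j, ‖u j‖ ≤ M * ‖u‖ := by
    refine (Finset.sum_le_card_nsmul _ _ ‖u‖ fun j _ => norm_le_pi_norm u j).trans ?_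
    simp
  have h3 : ‖utL n u‖ ^ 2 ≤ ∑ i, ‖ut n u (n i)‖ ^ 2 := by
    have h4 : ‖utL n u‖ ≤ Real.sqrt (∑ i, ‖ut n u (n i)‖ ^ 2) := by
      rw [pi_norm_le_iff_of_nonneg (Real.sqrt_nonneg _)]
      intro i
      apply Real.le_sqrt_of_sq_le
      exact Finset.single_le_sum (f := fun i => ‖ut n u (n i)‖ ^ 2) (fun _ _ => sq_nonneg _) (Finset.mem_univ i)
    calc ‖utL n u‖ ^ 2 ≤ (Real.sqrt (∑ i, ‖ut n u (n i)‖ ^ 2)) ^ 2 := by gcongr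
      _ = _ := Real.sq_sqrt (Finset.sum_nonneg fun _ _ => sq_nonneg _)
  calc (∑ j, ‖u j‖) ^ 2 ≤ (M * (K * ‖utL n u‖)) ^ 2 := by
        have : 0 ≤ ∑ j, ‖u j‖ := Finset.sum_nonneg fun _ _ => norm_nonneg _
        gcongr
        exact h2.trans (by gcongr)
    _ = (M * K) ^ 2 * ‖utL n u‖ ^ 2 := by ring
    _ ≤ _ := by gcongr

lemma ut_test {M : ℕ} (N : (Fin g → ℕ) → ℕ) (hN : ∀ e b, e < b → N e < N b)
    (b : Fin g → ℕ) (hb : b ≠ 0) (n : Fin M → Fin g → ℕ) (hr : ∀ a, a ∈ Set.range n ↔ N a < N b)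
    (hi : Function.Injective (utL n)) :
    ∃ u, (∀ d, N d < N b → ut n u d = if d = 0 then 1 else 0) ∧ ut n u b ≠ 0 := by
  obtain ⟨u, hu⟩ := (LinearMap.injective_iff_surjective.1 hi) (fun i => if n i = 0 then 1 else 0)
  have h1 : ∀ d, N d < N b → ut n u d = if d = 0 then 1 else 0 := by
    intro d hd
    obtain ⟨i, rfl⟩ := (hr d).2 hd
    exact congrFun hu i
  refine ⟨u, h1, fun h0 => ?_⟩
  have h2 := ut_dval n u b
  have h3 : ∑ j, dval b (n j) * u j = 0 := by
    refine Finset.sum_eq_zero fun j _ => ?_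
    rw [(dval_zero _ _).2, zero_mul]
    intro hle
    have h4 := (hr _).1 ⟨j, rfl⟩
    rcases eq_or_lt_of_le hle with h | h
    · rw [h] at h4; omega
    · have := hN _ _ h; omega
  rw [h3, Finset.sum_eq_single 0] at h2
  · rw [h1 0 (hN _ _ (pos_iff_ne_zero.2 hb)), if_pos rfl, mul_one] at h2
    exact dcoef_zero b h2
  · intro e he h
    by_cases heb : e = b
    · rw [heb, h0, mul_zero]
    · rw [h1 e (hN _ _ (lt_of_le_of_ne (Finset.mem_Iic.1 he) heb)), if_neg h, mul_zero]
  · intro h; exact absurd (Finset.mem_Iic.2 zero_le) h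
end Unisolv

section Scal
variable {g : ℕ}

def om {M : ℕ} (N : (Fin g → ℕ) → ℕ) (n : Fin M → Fin g → ℕ) (t : ℕ) (u : Fin M → ℂ) (d : Fin g → ℕ) : ℝ :=
  (((N d : ℝ)⁻¹) ^ t * ‖ut n u d‖) ^ 2

lemma om_nonneg {M : ℕ} (N : (Fin g → ℕ) → ℕ) (n : Fin M → Fin g → ℕ) (t : ℕ) (u : Fin M → ℂ) (d : Fin g → ℕ) :
    0 ≤ om N n t u d := sq_nonneg _

lemma om_tail {M : ℕ} {N : (Fin g → ℕ) → ℕ} {n : Fin M → Fin g → ℕ} {t0 : ℕ} {ρ : (Fin g → ℕ) → ℝ}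
    (H : ∀ u d, ((N d : ℝ)⁻¹) ^ t0 * ‖ut n u d‖ ≤ ρ d * ∑ j, ‖u j‖) (t : ℕ) (u : Fin M → ℂ) (d : Fin g → ℕ)
    (B : ℕ) (hB : 1 ≤ B) (hd : B ≤ N d) :
    om N n (t0 + t) u d ≤ ρ d ^ 2 * ((∑ j, ‖u j‖) ^ 2 * (((B : ℝ)⁻¹) ^ t) ^ 2) := by
  have hB' : (0 : ℝ) < B := by exact_mod_cast hB
  have h1 : ((N d : ℝ)⁻¹) ^ t ≤ ((B : ℝ)⁻¹) ^ t := by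
    gcongr
  unfold om
  have h0 := H u d
  have h2 : 0 ≤ ((N d : ℝ)⁻¹) ^ t0 * ‖ut n u d‖ := by positivity
  calc (((N d : ℝ)⁻¹) ^ (t0 + t) * ‖ut n u d‖) ^ 2
      = ((((N d : ℝ)⁻¹) ^ t0 * ‖ut n u d‖) * ((N d : ℝ)⁻¹) ^ t) ^ 2 := by rw [pow_add]; ring
    _ ≤ ((ρ d * ∑ j, ‖u j‖) * ((B : ℝ)⁻¹) ^ t) ^ 2 := by
        have := h2.trans h0
        gcongr
    _ = _ := by ring

lemma om_summable {M : ℕ} {N : (Fin g → ℕ) → ℕ} {n : Fin M → Fin g → ℕ} {t0 : ℕ} {ρ : (Fin g → ℕ) → ℝ}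
    (hN1 : ∀ a, 1 ≤ N a)
    (H : ∀ u d, ((N d : ℝ)⁻¹) ^ t0 * ‖ut n u d‖ ≤ ρ d * ∑ j, ‖u j‖) (t : ℕ) (u : Fin M → ℂ)
    {ℓ : (Fin g → ℕ) → ℝ} (hℓ : ∀ a, 0 < ℓ a) (sℓ : Summable fun a => ℓ a * ρ a ^ 2) :
    Summable fun a => ℓ a * om N n (t0 + t) u a := by
  refine Summable.of_nonneg_of_le (fun a => mul_nonneg (hℓ a).le (om_nonneg _ _ _ _ _)) (fun a => ?_)
    (sℓ.mul_right ((∑ j, ‖u j‖) ^ 2 * ((((1 : ℕ) : ℝ)⁻¹) ^ t) ^ 2))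
  rw [mul_assoc]
  exact mul_le_mul_of_nonneg_left (om_tail H t u a 1 le_rfl (hN1 a)) (hℓ a).le

lemma pow_small (K D q : ℝ) (hD : 0 < D) (hq0 : 0 ≤ q) (hq : q < 1) :
    ∀ᶠ t : ℕ in Filter.atTop, K * (q ^ t) ^ 2 ≤ D := by
  have h1 : Filter.Tendsto (fun t : ℕ => K * (q ^ t) ^ 2) Filter.atTop (nhds (K * 0 ^ 2)) :=
    ((tendsto_pow_atTop_nhds_zero_of_lt_one hq0 hq).pow 2).const_mul K
  have h2 : K * 0 ^ 2 < D := by simpa using hD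
  exact (h1.eventually (gt_mem_nhds h2)).mono fun t ht => le_of_lt ht

lemma scal_pick {k ℓ f : (Fin g → ℕ) → ℝ} (hk : ∀ a, 0 < k a) (hℓ : ∀ a, 0 < ℓ a) (hf : ∀ a, 0 ≤ f a)
    {M : ℕ} {N : (Fin g → ℕ) → ℕ} (hN1 : ∀ a, 1 ≤ N a) {n : Fin M → Fin g → ℕ} (hn : Function.Injective n)
    {b : Fin g → ℕ} (hr : ∀ a, a ∈ Set.range n ↔ N a < N b) (hB : 2 ≤ N b)
    (hC : ∃ C : ℝ, 0 ≤ C ∧ ∀ u, (∑ j, ‖u j‖) ^ 2 ≤ C * ∑ i, ‖ut n u (n i)‖ ^ 2)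
    {t0 : ℕ} {ρ : (Fin g → ℕ) → ℝ} (hρ0 : ∀ a, 0 ≤ ρ a) (hρ : ∀ a c, ρ (a + c) ≤ ρ a)
    (H : ∀ u d, ((N d : ℝ)⁻¹) ^ t0 * ‖ut n u d‖ ≤ ρ d * ∑ j, ‖u j‖)
    (sk : Summable fun a => k a * ρ a ^ 2) (sℓ : Summable fun a => ℓ a * ρ a ^ 2)
    (hfb : ∀ e, ¬ e < b → f e = 0) (hfk : ∀ e, N e < N b → conv f k e ≤ ℓ e)
    {θ : ℝ} (hθ0 : 0 ≤ θ) (hθ1 : θ < 1) :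
    ∀ᶠ t in Filter.atTop, ∀ u, θ * ∑' a, k a * ∑ c ∈ Finset.Iio b, f c * om N n (t0 + t) u (a + c) ≤
      ∑' a, ℓ a * om N n (t0 + t) u a := by
  obtain ⟨C, hC0, hC⟩ := hC
  obtain ⟨L, hL0, hL⟩ : ∃ L : ℝ, 0 < L ∧ ∀ j, L ≤ ℓ (n j) := by
    have h0 : 0 ≤ ∑ j, (ℓ (n j))⁻¹ := Finset.sum_nonneg fun j _ => (inv_pos.2 (hℓ _)).le
    refine ⟨(1 + ∑ j, (ℓ (n j))⁻¹)⁻¹, by positivity, fun j => ?_⟩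
    rw [inv_le_comm₀ (by positivity) (hℓ _)]
    have := Finset.single_le_sum (f := fun j => (ℓ (n j))⁻¹) (fun j _ => (inv_pos.2 (hℓ _)).le) (Finset.mem_univ j)
    linarith
  set sf := ∑ c ∈ Finset.Iio b, f c with hsf
  set A := ∑' a, k a * ρ a ^ 2 with hA
  have hsf0 : 0 ≤ sf := Finset.sum_nonneg fun _ _ => hf _
  have hA0 : 0 ≤ A := tsum_nonneg fun a => mul_nonneg (hk a).le (sq_nonneg _)
  obtain ⟨B, hBB⟩ : ∃ B, N b = B + 1 := ⟨N b - 1, by omega⟩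
  have hBp : (0 : ℝ) < B := by have : 1 ≤ B := by omega
                               exact_mod_cast this
  filter_upwards [pow_small (θ * (sf * (A * C))) ((1 - θ) * L * (((B : ℝ)⁻¹) ^ t0) ^ 2) (B / (B + 1))
    (mul_pos (mul_pos (by linarith) hL0) (by positivity)) (by positivity)
    (by rw [div_lt_one (by positivity)]; linarith)] with t ht u
  -- E: rescaled inequality
  have E : θ * (sf * (A * C)) * (((N b : ℝ)⁻¹) ^ t) ^ 2 ≤ (1 - θ) * L * (((B : ℝ)⁻¹) ^ (t0 + t)) ^ 2 := by
    have e1 : (((N b : ℝ)⁻¹) ^ t) ^ 2 = (((B : ℝ) / (B + 1)) ^ t) ^ 2 * (((B : ℝ)⁻¹) ^ t) ^ 2 := by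
      rw [hBB, ← mul_pow, ← mul_pow]
      congr 2
      push_cast
      field_simp
    have := mul_le_mul_of_nonneg_right ht (sq_nonneg (((B : ℝ)⁻¹) ^ t))
    rw [e1, pow_add]
    linarith
  set X := ∑ i, ‖ut n u (n i)‖ ^ 2 with hX
  set ω := om N n (t0 + t) u with hω
  have ω0 : ∀ a, 0 ≤ ω a := om_nonneg _ _ _ _
  have hX0 : 0 ≤ X := Finset.sum_nonneg fun _ _ => sq_nonneg _
  set SF := ∑ j, ℓ (n j) * ω (n j) with hSF
  have hlow : L * (((B : ℝ)⁻¹) ^ (t0 + t)) ^ 2 * X ≤ SF := by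
    rw [hX, Finset.mul_sum]
    refine Finset.sum_le_sum fun j _ => ?_
    have h1 : N (n j) ≤ B := by have := (hr (n j)).1 ⟨j, rfl⟩; omega
    have h2 : (0 : ℝ) < N (n j) := by exact_mod_cast hN1 (n j)
    have h3 : (B : ℝ)⁻¹ ≤ (N (n j) : ℝ)⁻¹ := by gcongr
    have : ω (n j) = (((N (n j) : ℝ)⁻¹) ^ (t0 + t)) ^ 2 * ‖ut n u (n j)‖ ^ 2 := by
      simp only [hω, om]; ring
    rw [this, mul_assoc]
    have := hL j
    have := (hℓ (n j)).le
    gcongr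
  have hSFle : SF ≤ ∑' a, ℓ a * ω a := by
    have := (om_summable hN1 H t u hℓ sℓ).sum_le_tsum (Finset.univ.image n)
      (fun a _ => mul_nonneg (hℓ a).le (ω0 a))
    rwa [Finset.sum_image (fun x _ y _ h => hn h)] at this
  -- split
  let ω1 : (Fin g → ℕ) → ℝ := fun a => if N a < N b then ω a else 0
  let ω2 : (Fin g → ℕ) → ℝ := fun a => if N a < N b then 0 else ω a
  have hω12 : ∀ a, ω a = ω1 a + ω2 a := by intro a; simp only [ω1, ω2]; split_ifs <;> simp
  have ω10 : ∀ a, 0 ≤ ω1 a := by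
    intro a; simp only [ω1]; split_ifs
    · exact ω0 a
    · exact le_rfl
  have ω20 : ∀ a, 0 ≤ ω2 a := by
    intro a; simp only [ω2]; split_ifs
    · exact le_rfl
    · exact ω0 a
  have hfs : ∀ (w : (Fin g → ℕ) → ℝ) a, ∑ c ∈ Finset.Iio b, f c * w (a + c) = ∑' c, f c * w (a + c) := by
    intro w a
    rw [tsum_eq_sum]
    intro c hc
    rw [hfb c (by simpa using hc), zero_mul]
  have fin1 : ∀ d ∉ Finset.univ.image n, conv k f d * ω1 d = 0 := by
    intro d hd
    have : ¬ N d < N b := by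
      rw [← hr]; simpa using hd
    simp [ω1, this]
  obtain ⟨s1, T1⟩ := conv_tsum (x := k) (y := f) (ω := ω1) (fun a => (hk a).le) hf ω10
    (summable_of_ne_finset_zero fin1)
  have T1' : ∑' a, k a * ∑' c, f c * ω1 (a + c) ≤ SF := by
    rw [T1, tsum_eq_sum fin1, Finset.sum_image (fun x _ y _ h => hn h)]
    refine Finset.sum_le_sum fun j _ => ?_
    have h1 : N (n j) < N b := (hr (n j)).1 ⟨j, rfl⟩
    rw [conv_comm]
    simp only [ω1, if_pos h1]
    exact mul_le_mul_of_nonneg_right (hfk _ h1) (ω0 _)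
  set Q := (∑ j, ‖u j‖) ^ 2 * (((N b : ℝ)⁻¹) ^ t) ^ 2 with hQ
  have hQ0 : 0 ≤ Q := by positivity
  have hb2 : ∀ a, k a * ∑ c ∈ Finset.Iio b, f c * ω2 (a + c) ≤ (k a * ρ a ^ 2) * (sf * Q) := by
    intro a
    rw [mul_assoc]
    refine mul_le_mul_of_nonneg_left ?_ (hk a).le
    have : ρ a ^ 2 * (sf * Q) = ∑ c ∈ Finset.Iio b, f c * (ρ a ^ 2 * Q) := by
      rw [← Finset.sum_mul]; ring
    rw [this]
    refine Finset.sum_le_sum fun c _ => mul_le_mul_of_nonneg_left ?_ (hf c)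
    simp only [ω2]
    split_ifs with h
    · positivity
    · refine (om_tail H t u (a + c) (N b) (by omega) (not_lt.1 h)).trans ?_
      refine mul_le_mul_of_nonneg_right ?_ hQ0
      have := hρ a c
      have := hρ0 (a + c)
      gcongr
  have s2 : Summable fun a => k a * ∑ c ∈ Finset.Iio b, f c * ω2 (a + c) :=
    Summable.of_nonneg_of_le (fun a => mul_nonneg (hk a).le (Finset.sum_nonneg fun c _ => mul_nonneg (hf c) (ω20 _)))
      hb2 (sk.mul_right _)
  have T2 : ∑' a, k a * ∑ c ∈ Finset.Iio b, f c * ω2 (a + c) ≤ A * (sf * Q) := by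
    refine (s2.tsum_le_tsum hb2 (sk.mul_right _)).trans (le_of_eq ?_)
    rw [tsum_mul_right]
  simp only [← hfs ω1] at s1 T1'
  have hsplit : ∑' a, k a * ∑ c ∈ Finset.Iio b, f c * ω (a + c) =
      ∑' a, k a * ∑ c ∈ Finset.Iio b, f c * ω1 (a + c) + ∑' a, k a * ∑ c ∈ Finset.Iio b, f c * ω2 (a + c) := by
    rw [← s1.tsum_add s2]
    refine tsum_congr fun a => ?_
    rw [← mul_add, ← Finset.sum_add_distrib]
    congr 1
    refine Finset.sum_congr rfl fun c _ => ?_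
    rw [hω12, mul_add]
  rw [hsplit]
  have hQX : A * (sf * Q) ≤ A * (sf * (C * X * (((N b : ℝ)⁻¹) ^ t) ^ 2)) := by
    rw [hQ]
    have := hC u
    gcongr
  have E2 := mul_le_mul_of_nonneg_right E hX0
  have E3 : θ * (A * (sf * (C * X * (((N b : ℝ)⁻¹) ^ t) ^ 2))) ≤ (1 - θ) * SF := by
    calc _ = θ * (sf * (A * C)) * (((N b : ℝ)⁻¹) ^ t) ^ 2 * X := by ring
      _ ≤ _ := E2
      _ = (1 - θ) * (L * (((B : ℝ)⁻¹) ^ (t0 + t)) ^ 2 * X) := by ring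
      _ ≤ _ := mul_le_mul_of_nonneg_left hlow (by linarith)
  have E4 : θ * ∑' a, k a * ∑ c ∈ Finset.Iio b, f c * ω2 (a + c) ≤ (1 - θ) * SF :=
    (mul_le_mul_of_nonneg_left (T2.trans hQX) hθ0).trans E3
  have E5 := mul_le_mul_of_nonneg_left T1' hθ0
  rw [mul_add]
  linarith

lemma scal_limit {ℓ : (Fin g → ℕ) → ℝ} (hℓ : ∀ a, 0 < ℓ a)
    {M : ℕ} {N : (Fin g → ℕ) → ℕ} (hN1 : ∀ a, 1 ≤ N a) (hNi : Function.Injective N) {n : Fin M → Fin g → ℕ}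
    {b : Fin g → ℕ} (hb : b ≠ 0)
    {t0 : ℕ} {ρ : (Fin g → ℕ) → ℝ}
    (H : ∀ u d, ((N d : ℝ)⁻¹) ^ t0 * ‖ut n u d‖ ≤ ρ d * ∑ j, ‖u j‖)
    (sℓ : Summable fun a => ℓ a * ρ a ^ 2)
    (u : Fin M → ℂ) (hu : ∀ d, N d < N b → ut n u d = if d = 0 then 1 else 0) (hub : ut n u b ≠ 0)
    (κ : ℝ) (h : ∀ᶠ t in Filter.atTop, κ * om N n (t0 + t) u b ≤
      ∑' a, ℓ a * (if a = 0 then 0 else om N n (t0 + t) u a)) : κ ≤ ℓ b := by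
  set s := (∑ j, ‖u j‖) ^ 2 with hs
  set A := ∑' a, ℓ a * ρ a ^ 2 with hA
  have hBp : (0 : ℝ) < N b := by exact_mod_cast hN1 b
  have main : ∀ t, ∑' a, ℓ a * (if a = 0 then 0 else om N n (t0 + t) u a) ≤
      ℓ b * om N n (t0 + t) u b + A * (s * ((((N b + 1 : ℕ) : ℝ)⁻¹) ^ t) ^ 2) := by
    intro t
    set Q := s * ((((N b + 1 : ℕ) : ℝ)⁻¹) ^ t) ^ 2 with hQ
    have hQ0 : 0 ≤ Q := by positivity
    have hle : ∀ a, ℓ a * (if a = 0 then 0 else om N n (t0 + t) u a) ≤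
        (if a = b then ℓ b * om N n (t0 + t) u b else 0) + ℓ a * ρ a ^ 2 * Q := by
      intro a
      have hp : 0 ≤ ℓ a * ρ a ^ 2 * Q := mul_nonneg (mul_nonneg (hℓ a).le (sq_nonneg _)) hQ0
      by_cases ha0 : a = 0
      · subst ha0
        rw [if_pos rfl, if_neg hb.symm]; simpa using hp
      rw [if_neg ha0]
      by_cases hab : a = b
      · subst hab; rw [if_pos rfl]; linarith
      rw [if_neg hab, zero_add]
      rcases lt_or_ge (N a) (N b + 1) with h1 | h1
      · have h2 : N a < N b := by
          have : N a ≠ N b := fun h => hab (hNi h)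
          omega
        have : om N n (t0 + t) u a = 0 := by simp [om, hu a h2, ha0]
        rw [this, mul_zero]; exact hp
      · rw [mul_assoc]
        exact mul_le_mul_of_nonneg_left (om_tail H t u a (N b + 1) (by omega) h1) (hℓ a).le
    have hs1 : HasSum (fun a => if a = b then ℓ b * om N n (t0 + t) u b else 0) (ℓ b * om N n (t0 + t) u b) :=
      hasSum_ite_eq b _
    have hs2 : HasSum (fun a => ℓ a * ρ a ^ 2 * Q) (A * Q) := sℓ.hasSum.mul_right _
    have hs3 := hs1.add hs2
    refine (Summable.tsum_le_tsum hle ?_ hs3.summable).trans (le_of_eq hs3.tsum_eq)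
    refine Summable.of_nonneg_of_le (fun a => ?_) hle hs3.summable
    refine mul_nonneg (hℓ a).le ?_
    split_ifs
    · exact le_rfl
    · exact om_nonneg _ _ _ _ _
  set D := (((N b : ℝ)⁻¹) ^ t0) ^ 2 * ‖ut n u b‖ ^ 2 with hD
  have hD0 : 0 < D := by
    have : 0 < ‖ut n u b‖ := norm_pos_iff.2 hub
    positivity
  have hom : ∀ t, om N n (t0 + t) u b = D * (((N b : ℝ)⁻¹) ^ t) ^ 2 := by
    intro t; simp only [om, hD, pow_add]; ring
  by_contra hlt
  push Not at hlt
  have hsm := pow_small (A * s) ((κ - ℓ b) * D / 2) ((N b : ℝ) / (N b + 1)) (by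
    have : 0 < κ - ℓ b := by linarith
    positivity) (by positivity) (by rw [div_lt_one (by positivity)]; linarith)
  obtain ⟨t, h1, h2⟩ := (h.and hsm).exists
  have h3 := h1.trans (main t)
  rw [hom] at h3
  set P := (((N b : ℝ)⁻¹) ^ t) ^ 2 with hP
  have hP0 : 0 < P := by positivity
  have e1 : ((((N b + 1 : ℕ) : ℝ)⁻¹) ^ t) ^ 2 = (((N b : ℝ) / (N b + 1)) ^ t) ^ 2 * P := by
    rw [hP, ← mul_pow, ← mul_pow]
    congr 2
    push_cast
    field_simp
  rw [e1] at h3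
  have h4 := mul_le_mul_of_nonneg_right h2 hP0.le
  have h5 : (κ - ℓ b) * D * P ≤ (κ - ℓ b) * D / 2 * P := by nlinarith
  have h6 : 0 < (κ - ℓ b) * D * P := by
    have : 0 < κ - ℓ b := by linarith
    positivity
  linarith
end Scal

section PrimeWeight
variable {g : ℕ}

def pr (i : Fin g) : ℕ := Nat.nth Nat.Prime i

lemma pr_prime (i : Fin g) : (pr i).Prime := Nat.prime_nth_prime _
lemma pr_inj : Function.Injective (pr (g := g)) := fun _ _ h =>
  Fin.ext (Nat.nth_injective Nat.infinite_setOfPred_prime h)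

def NN (a : Fin g → ℕ) : ℕ := ∏ i, pr i ^ a i

lemma NN_add (a c : Fin g → ℕ) : NN (a + c) = NN a * NN c := by
  simp [NN, pow_add, Finset.prod_mul_distrib]

lemma NN_pos (a : Fin g → ℕ) : 1 ≤ NN a := Nat.succ_le_of_lt (Finset.prod_pos fun i _ => pow_pos (pr_prime i).pos _)

lemma NN_coord (a : Fin g → ℕ) (i : Fin g) : a i < NN a := by
  calc a i < 2 ^ a i := Nat.lt_two_pow_self
    _ ≤ pr i ^ a i := Nat.pow_le_pow_left (pr_prime i).two_le _
    _ ≤ NN a := Finset.single_le_prod' (f := fun i => pr i ^ a i)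
        (fun i _ => Nat.succ_le_of_lt (pow_pos (pr_prime i).pos _)) (Finset.mem_univ i)

lemma NN_lt (e b : Fin g → ℕ) (h : e < b) : NN e < NN b := by
  obtain ⟨c, rfl⟩ := exists_add_of_le h.le
  have hc : c ≠ 0 := by rintro rfl; simp at h
  obtain ⟨i, hi⟩ := Function.ne_iff.1 hc
  have h1 := NN_coord c i
  have h2 : 0 < c i := Nat.pos_of_ne_zero hi
  rw [NN_add]
  have := NN_pos e
  nlinarith

lemma NN_inj : Function.Injective (NN (g := g)) := by
  have key : ∀ (a : Fin g → ℕ) i, (NN a).factorization (pr i) = a i := by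
    intro a i
    unfold NN
    rw [Nat.factorization_prod (fun j _ => pow_ne_zero _ (pr_prime j).ne_zero), Finsupp.finsetSum_apply,
      Finset.sum_eq_single i]
    · rw [(pr_prime i).factorization_pow]; simp
    · intro j _ hj
      rw [(pr_prime j).factorization_pow, Finsupp.single_eq_of_ne]
      exact fun h => hj (pr_inj h).symm
    · simp
  intro a c h
  funext i
  rw [← key a i, h, key]

lemma NN_fin (n : ℕ) : {a : Fin g → ℕ | NN a < n}.Finite := by
  refine (Set.finite_Iic (fun _ : Fin g => n)).subset fun a ha i => ?_
  exact ((NN_coord a i).trans ha).le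

def zz {M : ℕ} (n : Fin M → Fin g → ℕ) (t : ℕ) (j : Fin M) (i : Fin g) : ℂ :=
  ((pr i : ℂ)⁻¹) ^ t * ((n j i : ℂ) + 1)

lemma mpow_zz {M : ℕ} (n : Fin M → Fin g → ℕ) (t : ℕ) (j : Fin M) (d : Fin g → ℕ) :
    mpow (zz n t j) d = ((NN d : ℂ)⁻¹) ^ t * mon d (n j) := by
  unfold mpow zz mon NN
  push_cast
  rw [← Finset.prod_inv_distrib, ← Finset.prod_pow, ← Finset.prod_mul_distrib]
  refine Finset.prod_congr rfl fun i _ => ?_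
  rw [mul_pow, ← inv_pow]; ring

lemma conj_zz {M : ℕ} (n : Fin M → Fin g → ℕ) (t : ℕ) (j : Fin M) (d : Fin g → ℕ) :
    (starRingEnd ℂ) (mpow (zz n t j) d) = mpow (zz n t j) d := by
  simp [mpow, zz, map_prod]

lemma sum_zz {M : ℕ} (n : Fin M → Fin g → ℕ) (t : ℕ) (x : Fin M → ℂ) (d : Fin g → ℕ) :
    ‖∑ j, (starRingEnd ℂ) (mpow (zz n t j) d) * x j‖ ^ 2 = om NN n t x d := by
  simp only [conj_zz]
  simp only [mpow_zz, mul_assoc, ← Finset.mul_sum]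
  unfold om
  rw [norm_mul, norm_pow, norm_inv, Complex.norm_natCast]
  rfl

lemma zz_small {M : ℕ} (n : Fin M → Fin g → ℕ) (r : ℝ) (hr : 0 < r) :
    ∃ t0, ∀ t ≥ t0, ∀ j i, ‖zz n t j i‖ ≤ r := by
  rw [← Filter.eventually_atTop]
  rw [Filter.eventually_all]; intro j
  rw [Filter.eventually_all]; intro i
  have h1 : Filter.Tendsto (fun t => zz n t j i) Filter.atTop (nhds (0 * ((n j i : ℂ) + 1))) := by
    refine (tendsto_pow_atTop_nhds_zero_of_norm_lt_one ?_).mul_const _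
    rw [norm_inv, Complex.norm_natCast]
    apply inv_lt_one_of_one_lt₀
    exact_mod_cast (pr_prime i).one_lt
  rw [zero_mul] at h1
  have h2 := h1.norm
  rw [norm_zero] at h2
  exact (h2.eventually (gt_mem_nhds hr)).mono fun t ht => ht.le

def Wm {M : ℕ} (n : Fin M → Fin g → ℕ) (t : ℕ) (f : (Fin g → ℕ) → ℝ) (θ : ℝ) (i0 : Fin M) (j : Fin M) :
    Matrix (Fin M) (Fin M) ℂ := fun r c =>
  if r = i0 then (Real.sqrt (θ * f (n c)) : ℂ) * mpow (zz n t j) (n c) else 0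

lemma Wm_mulVec {M : ℕ} (n : Fin M → Fin g → ℕ) (t : ℕ) (f : (Fin g → ℕ) → ℝ) (θ : ℝ) (i0 : Fin M) (j : Fin M)
    (v : Fin M → ℂ) (c : Fin M) : ((Wm n t f θ i0 j)ᴴ *ᵥ v) c =
      (Real.sqrt (θ * f (n c)) : ℂ) * (mpow (zz n t j) (n c) * v i0) := by
  simp only [mulVec, dotProduct, conjTranspose_apply]
  rw [Finset.sum_eq_single i0]
  · simp only [Wm, if_pos, RCLike.star_def, map_mul, conj_zz, Complex.conj_ofReal]; ring
  · intro r _ hr; simp [Wm, hr]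
  · simp

lemma Wm_form {M : ℕ} {n : Fin M → Fin g → ℕ} (hn : Function.Injective n) (t : ℕ) {f : (Fin g → ℕ) → ℝ} (hf : ∀ a, 0 ≤ f a)
    {θ : ℝ} (hθ : 0 ≤ θ) (i0 : Fin M) {b : Fin g → ℕ} (hr : ∀ a, a < b → a ∈ Set.range n) (hfb : ∀ e, ¬ e < b → f e = 0)
    (u : Fin M → Fin M → ℂ) (a : Fin g → ℕ) :
    ∑ r, ‖∑ j, (starRingEnd ℂ) (mpow (zz n t j) a) * ((Wm n t f θ i0 j)ᴴ *ᵥ u j) r‖ ^ 2 =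
      θ * ∑ c ∈ Finset.Iio b, f c * om NN n t (fun j => u j i0) (a + c) := by
  have h1 : ∀ r, ‖∑ j, (starRingEnd ℂ) (mpow (zz n t j) a) * ((Wm n t f θ i0 j)ᴴ *ᵥ u j) r‖ ^ 2 =
      θ * (f (n r) * om NN n t (fun j => u j i0) (a + n r)) := by
    intro r
    rw [← sum_zz]
    have : ∑ j, (starRingEnd ℂ) (mpow (zz n t j) a) * ((Wm n t f θ i0 j)ᴴ *ᵥ u j) r =
       (Real.sqrt (θ * f (n r)) : ℂ) * ∑ j, (starRingEnd ℂ) (mpow (zz n t j) (a + n r)) * u j i0 := by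
      rw [Finset.mul_sum]
      refine Finset.sum_congr rfl fun j _ => ?_
      rw [Wm_mulVec, conj_zz, conj_zz, mpow_add]; ring
    rw [this, norm_mul, mul_pow, Complex.norm_real, Real.norm_of_nonneg (Real.sqrt_nonneg _),
      Real.sq_sqrt (mul_nonneg hθ (hf _)), mul_assoc]
  simp only [h1]
  rw [← Finset.mul_sum]
  congr 1
  rw [← Finset.sum_image (s := Finset.univ) (g := n) (f := fun c => f c * om NN n t (fun j => u j i0) (a + c))
    (fun x _ y _ h => hn h)]
  symm
  refine Finset.sum_subset (fun c hc => ?_) fun c _ hc => ?_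
  · obtain ⟨j, hj⟩ := hr c (Finset.mem_Iio.1 hc)
    exact Finset.mem_image.2 ⟨j, Finset.mem_univ _, hj⟩
  · rw [hfb c (by simpa using hc), zero_mul]

lemma mpow_origin {a : Fin g → ℕ} (h : a ≠ 0) : mpow (0 : Fin g → ℂ) a = 0 := by
  obtain ⟨i, hi⟩ := Function.ne_iff.1 h
  exact Finset.prod_eq_zero (Finset.mem_univ i) (by simpa using hi)

lemma pick_hyp {k ℓ : (Fin g → ℕ) → ℝ} (hk : ∀ a, 0 < k a) (hℓ : ∀ a, 0 < ℓ a)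
    {Ω : Set (Fin g → ℂ)} (hΩ : IsOpen Ω) (h0 : (0 : Fin g → ℂ) ∈ Ω)
    (hks : ∀ x ∈ Ω, Summable fun a => k a * ‖mpow x a‖ ^ 2)
    (hℓs : ∀ x ∈ Ω, Summable fun a => ℓ a * ‖mpow x a‖ ^ 2)
    (hP : IsCompletePickPair (fun z w : Ω => diagKer k ↑z ↑w) (fun z w : Ω => diagKer ℓ ↑z ↑w)) :
    ∀ b, b ≠ 0 → ∀ f : (Fin g → ℕ) → ℝ, (∀ a, 0 ≤ f a) → (∀ e, ¬ e < b → f e = 0) →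
      (∀ e, NN e < NN b → conv f k e ≤ ℓ e) → conv f k b ≤ ℓ b := by
  intro b hb f hf hfb hfk
  -- enumeration
  let F := (NN_fin (g := g) (NN b)).toFinset
  let M := F.card
  let n : Fin M → Fin g → ℕ := fun j => (F.equivFin.symm j).1
  have hn : Function.Injective n := fun x y h => F.equivFin.symm.injective (Subtype.ext h)
  have hr : ∀ a, a ∈ Set.range n ↔ NN a < NN b := by
    intro a
    have hF : a ∈ F ↔ NN a < NN b := by simp [F]
    rw [← hF]
    constructor
    · rintro ⟨j, rfl⟩; exact (F.equivFin.symm j).2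
    · intro h; exact ⟨F.equivFin ⟨a, h⟩, by simp [n]⟩
  have h0b : NN (0 : Fin g → ℕ) < NN b := NN_lt _ _ (pos_iff_ne_zero.2 hb)
  obtain ⟨i0, hi0⟩ := (hr 0).2 h0b
  have hM : 1 ≤ M := by have := i0.2; omega
  have hB : 2 ≤ NN b := by have := NN_pos (0 : Fin g → ℕ); omega
  have hinj := utL_inj NN NN_lt (NN b) n hn hr
  have hC := ut_bound n hinj
  obtain ⟨u, hu, hub⟩ := ut_test NN NN_lt b hb n hr hinj
  -- radius
  obtain ⟨ε, hε, hball⟩ := Metric.isOpen_iff.1 hΩ 0 h0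
  let r := min (ε / 2) 1
  have hr0 : 0 < r := lt_min (by linarith) one_pos
  have hrε : r < ε := lt_of_le_of_lt (min_le_left _ _) (by linarith)
  have hr1 : r ≤ 1 := min_le_right _ _
  have hmem : ∀ x : Fin g → ℂ, (∀ i, ‖x i‖ ≤ r) → x ∈ Ω := by
    intro x hx
    apply hball
    rw [mem_ball_zero_iff]
    exact lt_of_le_of_lt ((pi_norm_le_iff_of_nonneg hr0.le).2 hx) hrε
  let ρ : (Fin g → ℕ) → ℝ := fun d => ∏ i, r ^ d i
  have hρ0 : ∀ d, 0 ≤ ρ d := fun d => Finset.prod_nonneg fun i _ => pow_nonneg hr0.le _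
  have hρ : ∀ a c, ρ (a + c) ≤ ρ a := by
    intro a c
    refine Finset.prod_le_prod (fun i _ => pow_nonneg hr0.le _) fun i _ => ?_
    exact pow_le_pow_of_le_one hr0.le hr1 (by simp)
  have hrΩ : (fun _ : Fin g => (r : ℂ)) ∈ Ω := hmem _ fun i => by
    rw [Complex.norm_real, Real.norm_of_nonneg hr0.le]
  have hρm : ∀ d, ‖mpow (fun _ : Fin g => (r : ℂ)) d‖ = ρ d := by
    intro d
    simp only [mpow, ρ, norm_prod, norm_pow, Complex.norm_real, Real.norm_of_nonneg hr0.le]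
  have sk : Summable fun a => k a * ρ a ^ 2 := by simpa only [hρm] using hks _ hrΩ
  have sℓ : Summable fun a => ℓ a * ρ a ^ 2 := by simpa only [hρm] using hℓs _ hrΩ
  obtain ⟨t0, ht0⟩ := zz_small n r hr0
  have H : ∀ u d, ((NN d : ℝ)⁻¹) ^ t0 * ‖ut n u d‖ ≤ ρ d * ∑ j, ‖u j‖ := by
    intro u d
    have h1 : ((NN d : ℝ)⁻¹) ^ t0 * ‖ut n u d‖ = ‖∑ j, mpow (zz n t0 j) d * u j‖ := by
      simp only [mpow_zz, mul_assoc, ← Finset.mul_sum]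
      rw [norm_mul, norm_pow, norm_inv, Complex.norm_natCast]; rfl
    rw [h1, Finset.mul_sum]
    refine norm_sum_le_of_le _ fun j _ => ?_
    rw [norm_mul]
    refine mul_le_mul_of_nonneg_right ?_ (norm_nonneg _)
    unfold mpow
    rw [norm_prod]
    refine Finset.prod_le_prod (fun i _ => norm_nonneg _) fun i _ => ?_
    rw [norm_pow]
    exact pow_le_pow_left₀ (norm_nonneg _) (ht0 t0 le_rfl j i) _
  have main : ∀ θ : ℝ, 0 ≤ θ → θ < 1 → θ * conv f k b ≤ ℓ b := by
    intro θ hθ0 hθ1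
    refine scal_limit hℓ NN_pos NN_inj hb H sℓ u hu hub _ ?_
    filter_upwards [scal_pick hk hℓ hf NN_pos hn hr hB hC hρ0 hρ H sk sℓ hfb hfk hθ0 hθ1] with t ht
    let z : Fin M → Ω := fun j => ⟨zz n (t0 + t) j, hmem _ fun i => ht0 _ (by omega) j i⟩
    have hform := fun (u : Fin M → Fin M → ℂ) a => Wm_form hn (t0 + t) hf hθ0 i0 (b := b)
      (fun a ha => (hr a).2 (NN_lt _ _ ha)) hfb u a
    have hpsd : PickBlockPSD (fun z w : Ω => diagKer k ↑z ↑w) (fun z w : Ω => diagKer ℓ ↑z ↑w) z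
        (Wm n (t0 + t) f θ i0) := by
      rw [pick_iff hk hℓ hks hℓs]
      intro v
      have e1 : pform k (fun i => (z i : Fin g → ℂ)) (fun j => (Wm n (t0 + t) f θ i0 j)ᴴ *ᵥ v j) =
          θ * ∑' a, k a * ∑ c ∈ Finset.Iio b, f c * om NN n (t0 + t) (fun j => v j i0) (a + c) := by
        unfold pform
        rw [← tsum_mul_left]
        refine tsum_congr fun a => ?_
        rw [hform v a]; ring
      rw [e1]
      refine (ht _).trans ?_
      refine (om_summable NN_pos H t _ hℓ sℓ).tsum_le_tsum (fun a => ?_)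
        (pform_hasSum hℓ _ (fun i => hℓs _ (z i).2) v).1
      refine mul_le_mul_of_nonneg_left ?_ (hℓ a).le
      rw [← sum_zz]
      exact Finset.single_le_sum (f := fun r => ‖∑ j, (starRingEnd ℂ) (mpow (zz n (t0 + t) j) a) * v j r‖ ^ 2)
        (fun _ _ => sq_nonneg _) (Finset.mem_univ i0)
    obtain ⟨Φ, hΦ, hΦz⟩ := hP M M hM hM z _ hpsd
    have h1 := hΦ (M + 1) (Fin.cons ⟨0, h0⟩ z : Fin (M + 1) → Ω)
    rw [pick_iff hk hℓ hks hℓs] at h1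
    let v : Fin M → Fin M → ℂ := fun j => Pi.single i0 (u j)
    let V : Fin (M + 1) → Fin M → ℂ := Fin.cons (Pi.single i0 (-∑ j, u j)) v
    have h2 := h1 V
    have hv : (fun j => v j i0) = u := by funext j; simp [v]
    have eR : pform ℓ (fun i => ((Fin.cons ⟨0, h0⟩ z : Fin (M + 1) → Ω) i : Fin g → ℂ)) V =
        ∑' a, ℓ a * (if a = 0 then 0 else om NN n (t0 + t) u a) := by
      unfold pform
      refine tsum_congr fun a => ?_
      congr 1
      rw [Finset.sum_eq_single i0]
      · rw [Fin.sum_univ_succ]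
        simp only [Fin.cons_zero, Fin.cons_succ, V, v, Pi.single_eq_same]
        split_ifs with h
        · subst h; simp [mpow_zero]
        · rw [mpow_origin h, map_zero, zero_mul, zero_add]
          exact sum_zz n (t0 + t) u a
      · intro c _ hc
        rw [Fin.sum_univ_succ]
        simp [V, v, hc]
      · simp
    rw [eR] at h2
    refine le_trans ?_ h2
    have hsum := (pform_hasSum hk (fun i => ((Fin.cons ⟨0, h0⟩ z : Fin (M + 1) → Ω) i : Fin g → ℂ))
      (fun i => hks _ ((Fin.cons ⟨0, h0⟩ z : Fin (M + 1) → Ω) i).2)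
      (fun j => (Φ ((Fin.cons ⟨0, h0⟩ z : Fin (M + 1) → Ω) j))ᴴ *ᵥ V j)).1
    refine le_trans ?_ (hsum.sum_le_tsum (Finset.Ioc 0 b)
      (fun a _ => mul_nonneg (hk a).le (Finset.sum_nonneg fun _ _ => sq_nonneg _)))
    have eL : θ * conv f k b * om NN n (t0 + t) u b =
        ∑ a ∈ Finset.Ioc 0 b, k a * (θ * (f (b - a) * om NN n (t0 + t) u b)) := by
      rw [conv_comm]
      unfold conv
      rw [Finset.mul_sum, Finset.sum_mul]
      rw [← Finset.sum_subset (s₁ := Finset.Ioc 0 b) (s₂ := Finset.Iic b)]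
      · refine Finset.sum_congr rfl fun a _ => by ring
      · intro a ha; exact Finset.mem_Iic.2 (Finset.mem_Ioc.1 ha).2
      · intro a ha ha'
        have : a = 0 := by
          by_contra hne
          exact ha' (Finset.mem_Ioc.2 ⟨pos_iff_ne_zero.2 hne, Finset.mem_Iic.1 ha⟩)
        rw [this, tsub_zero, hfb b (lt_irrefl _)]; ring
    rw [eL]
    refine Finset.sum_le_sum fun a ha => mul_le_mul_of_nonneg_left ?_ (hk a).le
    obtain ⟨ha0, hab⟩ := Finset.mem_Ioc.1 ha
    have ha0' : a ≠ 0 := ha0.ne'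
    have e3 : ∑ r, ‖∑ j, (starRingEnd ℂ) (mpow ((Fin.cons ⟨0, h0⟩ z : Fin (M + 1) → Ω) j : Fin g → ℂ) a) *
        ((Φ ((Fin.cons ⟨0, h0⟩ z : Fin (M + 1) → Ω) j))ᴴ *ᵥ V j) r‖ ^ 2 =
        θ * ∑ c ∈ Finset.Iio b, f c * om NN n (t0 + t) u (a + c) := by
      have := hform v a
      rw [hv] at this
      rw [← this]
      refine Finset.sum_congr rfl fun c _ => ?_
      rw [Fin.sum_univ_succ]
      simp only [Fin.cons_zero, Fin.cons_succ, V, mpow_origin ha0', map_zero, zero_mul, zero_add, hΦz]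
      rfl
    rw [e3]
    refine mul_le_mul_of_nonneg_left ?_ hθ0
    have hba : b - a ∈ Finset.Iio b := by
      rw [Finset.mem_Iio]
      refine lt_of_le_of_ne tsub_le_self fun h => ha0' ?_
      funext i
      have h3 : b i - a i = b i := congrFun h i
      have h4 : a i ≤ b i := hab i
      simp only [Pi.zero_apply]
      omega
    have := Finset.single_le_sum (f := fun c => f c * om NN n (t0 + t) u (a + c))
      (fun c _ => mul_nonneg (hf c) (om_nonneg _ _ _ _ _)) hba
    simpa only [add_tsub_cancel_of_le hab] using this
  have hlim : Filter.Tendsto (fun θ : ℝ => θ * conv f k b) (nhdsWithin 1 (Set.Iio 1)) (nhds (1 * conv f k b)) :=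
    ((continuous_id.mul continuous_const).tendsto 1).mono_left nhdsWithin_le_nhds
  rw [one_mul] at hlim
  refine le_of_tendsto hlim ?_
  filter_upwards [Ioo_mem_nhdsLT (show (0 : ℝ) < 1 by norm_num)] with θ hθ
  exact main θ hθ.1.le hθ.2
end PrimeWeight

/-- A pair of normalized diagonal holomorphic kernels on a domain `Ω ∋ 0` is a complete
Pick pair iff it is a complete Carathéodory pair. -/
theorem diag_completePick_iff_completeCaratheodory {g : ℕ} (hg : 1 ≤ g)
    (Ω : Set (Fin g → ℂ)) (hΩo : IsOpen Ω) (hΩc : IsConnected Ω)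
    (h0 : (0 : Fin g → ℂ) ∈ Ω)
    (kc ℓc : (Fin g → ℕ) → ℝ)
    (hk : IsNormalizedDiag Ω kc) (hℓ : IsNormalizedDiag Ω ℓc) :
    IsCompletePickPair (fun z w : Ω => diagKer kc ↑z ↑w) (fun z w : Ω => diagKer ℓc ↑z ↑w) ↔
      IsCCPair kc ℓc := by
  obtain ⟨hk0, hk1, hks⟩ := hk
  obtain ⟨hℓ0, hℓ1, hℓs⟩ := hℓ
  constructor
  · intro hP
    have hyp := pick_hyp hk1 hℓ1 hΩo h0 hks hℓs hP
    obtain ⟨s, m, p, T, hC⟩ := star_coef hk0 hk1 hℓ0 hℓ1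
      (star_of_hyp kc ℓc hk0 hk1 hℓ0 hℓ1 NN NN_lt hyp)
    exact cc_of_coef hC hk1 hℓ1 NN NN_lt NN_inj NN_fin
  · intro hcc
    have hyp := cc_hyp hk1 hℓ1 NN NN_lt NN_inj hcc
    obtain ⟨s, m, p, T, hC⟩ := star_coef hk0 hk1 hℓ0 hℓ1
      (star_of_hyp kc ℓc hk0 hk1 hℓ0 hℓ1 NN NN_lt hyp)
    exact pick_of_coef hC hk0 hk1 hℓ1 hks hℓs
end
end

section
/- Let (k, ℓ) be a complete Pick pair of positive kernels on a nonempty set X and let w ∈ X. Then the pair (k, ℓ^w), where ℓ^w(z,v) = ℓ(z,v) − ℓ(z,w)ℓ(w,v)/ℓ(w,w), is again a complete Pick pair, and consequently there exists a positive kernel g on X such that ℓ^w(z,v) = k(z,v)·g(z,v) for all z, v ∈ X. -/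
open Matrix
open scoped ComplexOrder

noncomputable section

/-- The kernel `ℓ^w (z, v) = ℓ(z,v) − ℓ(z,w)·ℓ(w,v)/ℓ(w,w)`. -/
def kerShift {X : Type*} (ℓ : X → X → ℂ) (w : X) (z v : X) : ℂ :=
  ℓ z v - ℓ z w * ℓ w v / ℓ w w

theorem IsPosKernel.two {X : Type*} {k : X → X → ℂ} (hk : IsPosKernel k) (x y : X) (a b : ℂ) :
    0 ≤ star a * a * k x x + star a * b * k x y + star b * a * k y x + star b * b * k y y := by
  have h := hk 2 ![x, y] ![a, b]
  simp [Fin.sum_univ_two] at h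
  simpa [add_assoc] using h

theorem IsPosKernel.diag {X : Type*} {k : X → X → ℂ} (hk : IsPosKernel k) (x : X) :
    0 ≤ k x x := by
  simpa using hk.two x x 1 0

theorem IsPosKernel.herm {X : Type*} {k : X → X → ℂ} (hk : IsPosKernel k) (x y : X) :
    star (k x y) = k y x := by
  have h1 := (Complex.le_def.1 (hk.two x y 1 1)).2
  have h2 := (Complex.le_def.1 (hk.two x y 1 Complex.I)).2
  have h3 := (Complex.le_def.1 (hk.diag x)).2
  have h4 := (Complex.le_def.1 (hk.diag y)).2
  simp at h1 h2 h3 h4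
  apply Complex.ext
  · simp; linarith
  · simp; linarith

theorem IsPosKernel.zero_of_diag {X : Type*} {k : X → X → ℂ} (hk : IsPosKernel k) (x y : X)
    (hx : k x x = 0) : k y x = 0 := by
  set c := k y x with hc
  have hxy : k x y = star c := (hk.herm y x).symm
  set d := (k y y).re with hd
  have h : ∀ t : ℝ, 2 * t * (c.re * c.re + c.im * c.im) ≤ d := by
    intro t
    have h := (Complex.le_def.1 (hk.two x y (-(t : ℂ) * star c) 1)).1
    rw [hx, hxy, ← hc] at h
    simp at h
    nlinarith
  have hn : c.re * c.re + c.im * c.im = 0 := by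
    by_contra h0
    have h1 := h ((|d| + 1) / (c.re * c.re + c.im * c.im))
    rw [mul_assoc, div_mul_cancel₀ _ h0] at h1
    have h5 := le_abs_self d
    have h6 := abs_nonneg d
    linarith
  apply Complex.ext
  · simp; nlinarith [mul_self_nonneg c.re, mul_self_nonneg c.im]
  · simp; nlinarith [mul_self_nonneg c.re, mul_self_nonneg c.im]

theorem schur_iff {X : Type*} (k ℓ : X → X → ℂ) (hℓ : IsPosKernel ℓ) (w : X) (hw : 0 < ℓ w w)
    {n N : ℕ} (Z : Fin (n + 1) → X) (W : Fin (n + 1) → Matrix (Fin N) (Fin N) ℂ)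
    (hZ : Z 0 = w) (hW : W 0 = 0) :
    PickBlockPSD k ℓ Z W ↔
      PickBlockPSD k (kerShift ℓ w) (fun i => Z i.succ) (fun i => W i.succ) := by
  have key : ∀ u : Fin (n + 1) → (Fin N → ℂ),
      (∑ i, ∑ j, star (u i) ⬝ᵥ ((ℓ (Z i) (Z j) • (1 : Matrix (Fin N) (Fin N) ℂ)
        - k (Z i) (Z j) • (W i * (W j)ᴴ)) *ᵥ u j)) =
      (ℓ w w)⁻¹ * (star (ℓ w w • u 0 + ∑ j : Fin n, ℓ w (Z j.succ) • u j.succ) ⬝ᵥ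
        (ℓ w w • u 0 + ∑ j : Fin n, ℓ w (Z j.succ) • u j.succ)) +
      ∑ i : Fin n, ∑ j : Fin n, star (u i.succ) ⬝ᵥ
        ((kerShift ℓ w (Z i.succ) (Z j.succ) • (1 : Matrix (Fin N) (Fin N) ℂ)
        - k (Z i.succ) (Z j.succ) • (W i.succ * (W j.succ)ᴴ)) *ᵥ u j.succ) := by
    intro u
    have hw0 : ℓ w w ≠ 0 := hw.ne'
    have e : (ℓ w w)⁻¹ * (star (ℓ w w • u 0 + ∑ j : Fin n, ℓ w (Z j.succ) • u j.succ) ⬝ᵥ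
        (ℓ w w • u 0 + ∑ j : Fin n, ℓ w (Z j.succ) • u j.succ)) =
        ℓ w w * (star (u 0) ⬝ᵥ u 0) + ∑ j : Fin n, ℓ w (Z j.succ) * (star (u 0) ⬝ᵥ u j.succ)
        + ∑ j : Fin n, ℓ (Z j.succ) w * (star (u j.succ) ⬝ᵥ u 0)
        + ∑ i : Fin n, ∑ j : Fin n, (ℓ w w)⁻¹ * (ℓ (Z i.succ) w * (ℓ w (Z j.succ) *
          (star (u i.succ) ⬝ᵥ u j.succ))) := by
      simp only [star_add, star_sum, star_smul, hℓ.herm, add_dotProduct, dotProduct_add,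
        sum_dotProduct, dotProduct_sum, smul_dotProduct, dotProduct_smul, smul_eq_mul, mul_add,
        Finset.mul_sum, Finset.sum_add_distrib]
      have a1 : ∀ t : ℂ, (ℓ w w)⁻¹ * (ℓ w w * t) = t := fun t => by field_simp
      have a2 : ∀ s t : ℂ, (ℓ w w)⁻¹ * (s * (ℓ w w * t)) = s * t := fun s t => by field_simp
      simp only [a1, a2]
      rw [Finset.sum_comm (f := fun (x y : Fin n) => (ℓ w w)⁻¹ * (ℓ w (Z x.succ) *
        (ℓ (Z y.succ) w * _)))]
      have e3 : ∑ i : Fin n, ∑ j : Fin n, (ℓ w w)⁻¹ * (ℓ w (Z j.succ) * (ℓ (Z i.succ) w *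
          (star (u i.succ) ⬝ᵥ u j.succ))) = ∑ i : Fin n, ∑ j : Fin n, (ℓ w w)⁻¹ *
          (ℓ (Z i.succ) w * (ℓ w (Z j.succ) * (star (u i.succ) ⬝ᵥ u j.succ))) := by
        refine Finset.sum_congr rfl fun i _ => Finset.sum_congr rfl fun j _ => ?_
        ring
      rw [e3]
      abel
    rw [e, Fin.sum_univ_succ]
    simp only [Fin.sum_univ_succ, hZ, hW, kerShift, sub_mulVec, smul_mulVec, one_mulVec, zero_mul,
      conjTranspose_zero, mul_zero, smul_zero, zero_mulVec, sub_zero, dotProduct_sub, dotProduct_zero,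
      Finset.sum_const_zero,
      dotProduct_smul, smul_eq_mul, sub_mul, Finset.sum_add_distrib, Finset.sum_sub_distrib]
    have e2 : ∑ i : Fin n, ∑ j : Fin n, (ℓ w w)⁻¹ * (ℓ (Z i.succ) w * (ℓ w (Z j.succ) *
          (star (u i.succ) ⬝ᵥ u j.succ))) = ∑ i : Fin n, ∑ j : Fin n,
          ℓ (Z i.succ) w * ℓ w (Z j.succ) / ℓ w w * (star (u i.succ) ⬝ᵥ u j.succ) := by
      refine Finset.sum_congr rfl fun i _ => Finset.sum_congr rfl fun j _ => ?_
      ring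
    rw [e2]
    abel
  constructor
  · intro h u
    have := h (Fin.cons (-((ℓ w w)⁻¹ • ∑ j : Fin n, ℓ w (Z j.succ) • u j)) u)
    rw [key] at this
    simpa [smul_smul, hw.ne'] using this
  · intro h u
    rw [key]
    refine add_nonneg (mul_nonneg ?_ (dotProduct_star_self_nonneg _)) (h fun i => u i.succ)
    exact (inv_pos.2 hw).le

theorem rowForm {X : Type*} {k L : X → X → ℂ} {n N : ℕ} (z : Fin n → X)
    (W : Fin n → Matrix (Fin (N + 1)) (Fin (N + 1)) ℂ) (h : PickBlockPSD k L z W)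
    (c : Fin n → ℂ) :
    0 ≤ ∑ i, ∑ j, (starRingEnd ℂ) (c i) * c j *
      (L (z i) (z j) - k (z i) (z j) * (W i 0 ⬝ᵥ star (W j 0))) := by
  have := h fun i => Pi.single 0 (c i)
  convert this using 4 with i _ j _
  have e : star (Pi.single 0 (c i) : Fin (N + 1) → ℂ) = Pi.single 0 (star (c i)) := by
    ext p
    by_cases hp : p = 0 <;> simp [Pi.single_apply, hp]
  rw [e, single_dotProduct]
  simp [mulVec_single, Matrix.mul_apply, dotProduct]
  ring

theorem multKernel {X : Type*} {k L : X → X → ℂ} {N : ℕ}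
    (Φ : X → Matrix (Fin (N + 1)) (Fin (N + 1)) ℂ) (h : IsContractiveMultiplier k L Φ) :
    IsPosKernel fun x y => L x y - k x y * (Φ x 0 ⬝ᵥ star (Φ y 0)) :=
  fun n z c => rowForm z _ (h n z) c

theorem psd_zero {X : Type*} {L : X → X → ℂ} (hL : IsPosKernel L) {n N : ℕ} (z : Fin n → X)
    (u : Fin n → (Fin N → ℂ)) :
    0 ≤ ∑ i, ∑ j, star (u i) ⬝ᵥ (L (z i) (z j) • u j) := by
  have : ∑ i, ∑ j, star (u i) ⬝ᵥ (L (z i) (z j) • u j) =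
      ∑ a, ∑ i, ∑ j, (starRingEnd ℂ) (u i a) * u j a * L (z i) (z j) := by
    simp only [dotProduct, Pi.smul_apply, Pi.star_apply, smul_eq_mul]
    rw [Finset.sum_comm (s := (Finset.univ : Finset (Fin N)))]
    refine Finset.sum_congr rfl fun i _ => ?_
    rw [Finset.sum_comm]
    refine Finset.sum_congr rfl fun a _ => Finset.sum_congr rfl fun j _ => ?_
    simp only [starRingEnd_apply]; ring
  rw [this]
  exact Finset.sum_nonneg fun a _ => hL n z _

theorem kerShift_pos {X : Type*} (ℓ : X → X → ℂ) (hℓ : IsPosKernel ℓ) (w : X)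
    (hw : 0 < ℓ w w) : IsPosKernel (kerShift ℓ w) := by
  intro n z c
  have h := (schur_iff (fun _ _ => 0) ℓ hℓ w hw (N := 1) (Fin.cons w z) (fun _ => 0) rfl rfl).1
    (by
      intro u
      simpa [smul_mulVec] using psd_zero hℓ (Fin.cons w z) u)
  simpa using rowForm _ _ h c

theorem shift_pick {X : Type*} (k ℓ : X → X → ℂ) (hℓ : IsPosKernel ℓ)
    (hCP : IsCompletePickPair k ℓ) (w : X) (hw : 0 < ℓ w w) :
    IsCompletePickPair k (kerShift ℓ w) := by
  intro n N hn hN z W h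
  obtain ⟨Φ, hΦ, hv⟩ := hCP (n + 1) N (by omega) hN (Fin.cons w z) (Fin.cons 0 W)
    ((schur_iff k ℓ hℓ w hw (Fin.cons w z) (Fin.cons 0 W) rfl rfl).2 h)
  have h0 : Φ w = 0 := hv 0
  refine ⟨Φ, ?_, fun i => hv i.succ⟩
  intro m y
  exact (schur_iff k ℓ hℓ w hw (Fin.cons w y) (fun i => Φ ((Fin.cons w y : Fin (m+1) → X) i))
    rfl h0).1 (hΦ _ _)

theorem rowBlock {X : Type*} {k L : X → X → ℂ} (hL : IsPosKernel L) {n N : ℕ} (z : Fin n → X)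
    (b : Fin n → Fin (N + 1) → ℂ)
    (hb : ∀ i j, L (z i) (z j) = k (z i) (z j) * (b i ⬝ᵥ star (b j))) :
    PickBlockPSD k L z (fun i => Matrix.of fun p q => if p = 0 then b i q else 0) := by
  intro u
  have h := psd_zero hL z (fun i => (fun p : Fin N => u i p.succ))
  refine h.trans_eq (Finset.sum_congr rfl fun i _ => Finset.sum_congr rfl fun j _ => ?_)
  have : (L (z i) (z j) • (1 : Matrix (Fin (N+1)) (Fin (N+1)) ℂ) - k (z i) (z j) •
      ((Matrix.of fun p q => if p = 0 then b i q else 0) *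
      (Matrix.of fun p q => if p = 0 then b j q else 0)ᴴ)) =
      Matrix.diagonal (fun p => if p = 0 then 0 else L (z i) (z j)) := by
    ext p q
    have hb' := hb i j
    simp only [dotProduct, Pi.star_apply] at hb'
    by_cases hp : p = 0 <;> by_cases hq : q = 0
    · subst hp; subst hq
      simp [mul_apply, hb']
    · subst hp
      simp [mul_apply, hq, Ne.symm hq, Matrix.one_apply]
    · subst hq
      simp [mul_apply, hp, Matrix.one_apply]
    · simp [mul_apply, hp, hq, Matrix.one_apply, Matrix.diagonal_apply]
  rw [this]
  simp [dotProduct, mulVec_diagonal, Fin.sum_univ_succ]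

theorem step {X : Type*} {k L : X → X → ℂ} (hL : IsPosKernel L) (hCP : IsCompletePickPair k L)
    (F : Finset X) {N : ℕ} (B : X → Fin (N + 1) → ℂ)
    (hB : ∀ x ∈ F, ∀ y ∈ F, L x y = k x y * (B x ⬝ᵥ star (B y))) (v : X) :
    ∃ b : Fin (N + 1) → ℂ, (∀ x ∈ F, L v x = k v x * (b ⬝ᵥ star (B x))) ∧
      0 ≤ L v v - k v v * (b ⬝ᵥ star b) := by
  rcases F.eq_empty_or_nonempty with rfl | hF
  · exact ⟨0, by simp, by simpa using hL.diag v⟩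
  let z : Fin F.card → X := fun i => (F.equivFin.symm i : X)
  have hz : ∀ i, z i ∈ F := fun i => (F.equivFin.symm i).2
  obtain ⟨Φ, hΦ, hv⟩ := hCP F.card (N + 1) hF.card_pos (by omega) z _
    (rowBlock hL z (fun i => B (z i)) fun i j => hB _ (hz i) _ (hz j))
  have hM := multKernel Φ hΦ
  have hr : ∀ x ∈ F, Φ x 0 = B x := by
    intro x hx
    have h1 : z (F.equivFin ⟨x, hx⟩) = x := by simp [z]
    have h2 := hv (F.equivFin ⟨x, hx⟩)
    rw [h1] at h2
    rw [h2]
    ext q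
    simp
  refine ⟨Φ v 0, ?_, hM.diag v⟩
  intro x hx
  have h3 := hM.zero_of_diag x v (by simp [hr x hx, hB x hx x hx])
  simp only [hr x hx] at h3
  exact sub_eq_zero.1 h3

theorem finite_factor {X : Type*} {k L : X → X → ℂ} (hk : IsPosKernel k)
    (hkd : ∀ x, 0 < k x x) (hL : IsPosKernel L)
    (hCP : IsCompletePickPair k L) (F : Finset X) :
    ∃ (N : ℕ) (B : X → Fin (N + 1) → ℂ),
      ∀ x ∈ F, ∀ y ∈ F, L x y = k x y * (B x ⬝ᵥ star (B y)) := by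
  classical
  induction F using Finset.induction_on with
  | empty => exact ⟨0, fun _ => 0, by simp⟩
  | insert v F hvF ih =>
    obtain ⟨N, B, hB⟩ := ih
    obtain ⟨b, hb, hd⟩ := step hL hCP F B hB v
    set t := L v v - k v v * (b ⬝ᵥ star b) with ht
    have hq : 0 ≤ t / k v v := div_nonneg hd (hkd v).le
    obtain ⟨s, hs⟩ : ∃ s : ℂ, s * star s = t / k v v := by
      refine ⟨(Real.sqrt (t / k v v).re : ℝ), ?_⟩
      have h2 := Complex.le_def.1 hq
      apply Complex.ext
      · simp; exact Real.mul_self_sqrt h2.1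
      · simp; exact h2.2
    refine ⟨N + 1, fun x => if x = v then Fin.cons s b else Fin.cons 0 (B x), ?_⟩
    have hne : ∀ x ∈ F, x ≠ v := fun x hx h => hvF (h ▸ hx)
    have hcons : ∀ (p q : ℂ) (c d : Fin (N+1) → ℂ),
        (Fin.cons p c : Fin (N+1+1) → ℂ) ⬝ᵥ star (Fin.cons q d : Fin (N+1+1) → ℂ)
          = p * star q + c ⬝ᵥ star d := by
      intro p q c d
      simp [dotProduct, Fin.sum_univ_succ]
    intro x hx y hy
    rw [Finset.mem_insert] at hx hy
    rcases hx with rfl | hx <;> rcases hy with rfl | hy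
    · simp only [if_true, hcons, hs]
      have := (hkd y).ne'
      field_simp
      rw [ht]; ring
    · simp only [if_true, if_neg (hne y hy), hcons]
      simpa using hb y hy
    · simp only [if_true, if_neg (hne x hx), hcons]
      rw [← hL.herm, hb x hx, star_mul', hk.herm, zero_mul, zero_add]
      simp [dotProduct, mul_comm]
    · simp only [if_neg (hne x hx), if_neg (hne y hy), hcons]
      simpa using hB x hx y hy

theorem gram_pos {X : Type*} {N : ℕ} (B : X → Fin N → ℂ) :
    IsPosKernel fun x y => B x ⬝ᵥ star (B y) := by
  intro n z c
  have : ∑ i, ∑ j, (starRingEnd ℂ) (c i) * c j * (B (z i) ⬝ᵥ star (B (z j))) =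
      (∑ i, star (c i) • B (z i)) ⬝ᵥ star (∑ i, star (c i) • B (z i)) := by
    rw [star_sum, sum_dotProduct]
    refine Finset.sum_congr rfl fun i _ => ?_
    rw [dotProduct_sum]
    refine Finset.sum_congr rfl fun j _ => ?_
    simp only [star_smul, smul_dotProduct,
      dotProduct_smul, smul_eq_mul, star_star, starRingEnd_apply]
    ring
  rw [this]
  exact dotProduct_self_star_nonneg _

theorem gram_bound {N : ℕ} (a b : Fin N → ℂ) :
    ‖a ⬝ᵥ star b‖ ≤ ‖a ⬝ᵥ star a‖ + ‖b ⬝ᵥ star b‖ := by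
  have h : ∀ c : Fin N → ℂ, ‖c ⬝ᵥ star c‖ = ∑ i, ‖c i‖ ^ 2 := by
    intro c
    have : c ⬝ᵥ star c = ((∑ i, ‖c i‖ ^ 2 : ℝ) : ℂ) := by
      simp [dotProduct, Complex.mul_conj, Complex.normSq_eq_norm_sq]
    rw [this, Complex.norm_real, Real.norm_of_nonneg (by positivity)]
  rw [h, h, ← Finset.sum_add_distrib]
  refine (norm_sum_le _ _).trans (Finset.sum_le_sum fun i _ => ?_)
  rw [norm_mul, Pi.star_apply, norm_star]
  nlinarith [sq_nonneg (‖a i‖ - ‖b i‖), sq_nonneg ‖a i‖, sq_nonneg ‖b i‖]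

theorem factor {X : Type*} {k L : X → X → ℂ} (hk : IsPosKernel k)
    (hkd : ∀ x, 0 < k x x) (hL : IsPosKernel L) (hCP : IsCompletePickPair k L) :
    ∃ g : X → X → ℂ, IsPosKernel g ∧ ∀ z v, L z v = k z v * g z v := by
  classical
  choose N B hB using finite_factor hk hkd hL hCP
  let U : Ultrafilter (Finset X) := Ultrafilter.of Filter.atTop
  have hU : (U : Filter (Finset X)) ≤ Filter.atTop := Ultrafilter.of_le _
  have hmem : ∀ x y : X, ∀ᶠ F in (U : Filter (Finset X)), x ∈ F ∧ y ∈ F := by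
    intro x y
    apply hU
    filter_upwards [Filter.eventually_ge_atTop ({x, y} : Finset X)] with F hF
    exact ⟨hF (by simp), hF (by simp)⟩
  have hlim : ∀ x y : X, ∃ c : ℂ,
      Filter.Tendsto (fun F => B F x ⬝ᵥ star (B F y)) (U : Filter (Finset X)) (nhds c) := by
    intro x y
    obtain ⟨c, -, hc⟩ := (isCompact_closedBall (0 : ℂ)
      (‖L x x / k x x‖ + ‖L y y / k y y‖)).ultrafilter_le_nhds
      (U.map fun F => B F x ⬝ᵥ star (B F y)) (by
        rw [Filter.le_principal_iff]
        change ∀ᶠ F in (U : Filter (Finset X)), _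
        filter_upwards [hmem x y] with F hF
        have h1 := hB F x hF.1 x hF.1
        have h2 := hB F y hF.2 y hF.2
        have := gram_bound (B F x) (B F y)
        rw [h1, h2, mul_div_cancel_left₀ _ (hkd x).ne', mul_div_cancel_left₀ _ (hkd y).ne']
        simpa using this)
    exact ⟨c, hc⟩
  choose g hg using hlim
  refine ⟨g, ?_, ?_⟩
  · intro n z c
    have ht : Filter.Tendsto (fun F => ∑ i, ∑ j, (starRingEnd ℂ) (c i) * c j *
        (B F (z i) ⬝ᵥ star (B F (z j)))) (U : Filter (Finset X))
        (nhds (∑ i, ∑ j, (starRingEnd ℂ) (c i) * c j * g (z i) (z j))) :=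
      tendsto_finsetSum _ fun i _ => tendsto_finsetSum _ fun j _ => (hg _ _).const_mul _
    exact ge_of_tendsto' ht fun F => gram_pos (B F) n z c
  · intro x y
    refine tendsto_nhds_unique (tendsto_const_nhds.congr' ?_) ((hg x y).const_mul (k x y))
    filter_upwards [hmem x y] with F hF
    exact hB F x hF.1 y hF.2

/-- If `(k, ℓ)` is a complete Pick pair and `w ∈ X`, then `(k, ℓ^w)` is again a complete
Pick pair, and consequently `ℓ^w = k·g` for some positive kernel `g`. -/
theorem completePick_kerShift {X : Type*} [Nonempty X] (k ℓ : X → X → ℂ)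
    (hk : IsPosKernel k) (hℓ : IsPosKernel ℓ)
    (hkd : ∀ x, 0 < k x x) (hℓd : ∀ x, 0 < ℓ x x)
    (hCP : IsCompletePickPair k ℓ) (w : X) :
    IsCompletePickPair k (kerShift ℓ w) ∧
      ∃ g : X → X → ℂ, IsPosKernel g ∧ ∀ z v, kerShift ℓ w z v = k z v * g z v := by
  have h1 := shift_pick k ℓ hℓ hCP w (hℓd w)
  exact ⟨h1, factor hk hkd (kerShift_pos ℓ hℓ w (hℓd w)) h1⟩
end
end
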